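/- arXiv:2211.09975 — 2 statements merged into one kernel-verified Lean document; each statement's English description precedes it below -/
import Mathlib

section
/- For every real number x ≥ e^{500000}, the interval (x, x + x^{1/5}·log x] contains a squarefree integer. -/
def SqHit (x h : ℝ) (u : ℕ) : Prop :=
  ∃ m : ℤ, x < m * (u : ℝ) ^ 2 ∧ (m : ℝ) * (u : ℝ) ^ 2 ≤ x + h

lemma SqHit.theta {x h : ℝ} {u : ℕ} (hu : SqHit x h u) {z : ℝ} (hz : 0 < z) (hzu : z ≤ u) :
    ∃ m : ℤ, ∃ θ : ℝ, (m : ℝ) = x / (u : ℝ) ^ 2 + θ ∧ 0 ≤ θ ∧ θ ≤ h / (u : ℝ) ^ 2 := by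
  obtain ⟨m, h1, h2⟩ := hu
  have hu0 : (0 : ℝ) < (u : ℝ) ^ 2 := by have : (0 : ℝ) < u := by linarith
                                         positivity
  refine ⟨m, m - x / (u : ℝ) ^ 2, by ring, ?_, ?_⟩
  · rw [sub_nonneg, div_le_iff₀ hu0]; exact h1.le
  · rw [sub_le_iff_le_add, ← add_div, le_div_iff₀ hu0]; linarith

lemma int_dichotomy (I : ℤ) (M e E : ℝ) (hI : (I : ℝ) = M + e) (hM : 0 ≤ M) (he : |e| ≤ E) :
    M ≤ E ∨ 1 - E ≤ M := by
  by_cases h0 : I = 0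
  · left
    rw [h0] at hI
    have := abs_le.mp he
    push_cast at hI
    linarith
  · right
    have h1 : (1 : ℝ) ≤ |(I : ℝ)| := by exact_mod_cast Int.one_le_abs h0
    rw [hI] at h1
    have := abs_add_le M e
    rw [abs_of_nonneg hM] at this
    linarith

lemma div_sq_le {h z u : ℝ} (hh : 0 ≤ h) (hz : 0 < z) (hzu : z ≤ u) : h / u ^ 2 ≤ h / z ^ 2 := by
  gcongr

/-- three point inequality -/
lemma three_pt {x h z w : ℝ} (hx : 0 ≤ x) (hh : 0 ≤ h) (hz : 0 < z) {u a c : ℕ}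
    (hu : z ≤ u) (hw : (u : ℝ) + a + c ≤ w)
    (h0 : SqHit x h u) (h1 : SqHit x h (u + a)) (h2 : SqHit x h (u + a + c)) :
    3 * x * (a * c * (a + c)) / w ^ 4 ≤ (a + c) * h / z ^ 2 ∨
      1 - (a + c) * h / z ^ 2 ≤ 3 * x * (a * c * (a + c)) / z ^ 4 := by
  have ha : (0 : ℝ) ≤ a := by positivity
  have hc : (0 : ℝ) ≤ c := by positivity
  obtain ⟨m0, t0, e0, p0, q0⟩ := h0.theta hz hu
  obtain ⟨m1, t1, e1, p1, q1⟩ := h1.theta hz (by push_cast; linarith)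
  obtain ⟨m2, t2, e2, p2, q2⟩ := h2.theta hz (by push_cast; linarith)
  push_cast at e1 e2 q1 q2
  have hu0 : (0 : ℝ) < u := by linarith
  generalize (u : ℝ) = U at *
  have r0 := q0.trans (div_sq_le hh hz hu)
  have r1 := q1.trans (div_sq_le hh hz (by linarith : z ≤ U + a))
  have r2 := q2.trans (div_sq_le hh hz (by linarith : z ≤ U + a + c))
  set P : ℝ := (1 / U) * (1 / (U + a)) * (1 / (U + a + c)) * (1 / U + 1 / (U + a) + 1 / (U + a + c))
    with hP
  have key : (((c : ℤ) * m0 - (a + c : ℤ) * m1 + a * m2 : ℤ) : ℝ) =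
      x * (a * c * (a + c)) * P + (c * t0 - (a + c) * t1 + a * t2) := by
    push_cast
    rw [e0, e1, e2, hP]
    field_simp
    ring
  have hb : ∀ y : ℝ, z ≤ y → 1 / y ≤ 1 / z := fun y hy => one_div_le_one_div_of_le hz hy
  have hb' : ∀ y : ℝ, z ≤ y → y ≤ w → 1 / w ≤ 1 / y := fun y hy hy' =>
    one_div_le_one_div_of_le (by linarith) hy'
  have hw0 : 0 < w := by linarith
  have b0 := hb U hu
  have b1 := hb (U + a) (by linarith)
  have b2 := hb (U + a + c) (by linarith)
  have b0' := hb' U hu (by linarith)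
  have b1' := hb' (U + a) (by linarith) (by linarith)
  have b2' := hb' (U + a + c) (by linarith) (by linarith)
  have hPu : P ≤ 3 / z ^ 4 := by
    calc P ≤ (1 / z) * (1 / z) * (1 / z) * (1 / z + 1 / z + 1 / z) := by rw [hP]; gcongr
      _ = 3 / z ^ 4 := by field_simp; norm_num
  have hPl : 3 / w ^ 4 ≤ P := by
    calc 3 / w ^ 4 = (1 / w) * (1 / w) * (1 / w) * (1 / w + 1 / w + 1 / w) := by field_simp; norm_num
      _ ≤ P := by rw [hP]; gcongr
  have hK : 0 ≤ x * (a * c * (a + c)) := by positivity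
  have hP0 : 0 ≤ P := by positivity
  have herr : |c * t0 - (a + c) * t1 + a * t2| ≤ (a + c) * h / z ^ 2 := by
    have E1 := mul_le_mul_of_nonneg_left r0 hc
    have E2 := mul_le_mul_of_nonneg_left r1 (add_nonneg ha hc)
    have E3 := mul_le_mul_of_nonneg_left r2 ha
    have E1' := mul_nonneg hc p0
    have E2' := mul_nonneg (add_nonneg ha hc) p1
    have E3' := mul_nonneg ha p2
    rw [mul_div_assoc]
    generalize h / z ^ 2 = H at *
    rw [abs_le]; constructor <;> linarith
  rcases int_dichotomy _ _ _ _ key (mul_nonneg hK hP0) herr with H | H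
  · left
    refine le_trans ?_ H
    calc _ = x * (a * c * (a + c)) * (3 / w ^ 4) := by ring
      _ ≤ _ := mul_le_mul_of_nonneg_left hPl hK
  · right
    refine H.trans ?_
    calc _ ≤ x * (a * c * (a + c)) * (3 / z ^ 4) := mul_le_mul_of_nonneg_left hPu hK
      _ = _ := by ring

/-- four point inequality (D), `b = a + c` -/
lemma four_pt_D {x h z w : ℝ} (hx : 0 ≤ x) (hh : 0 ≤ h) (hz : 0 < z) {u a c : ℕ}
    (hu : z ≤ u) (hw : (u : ℝ) + a + (a + c) ≤ w)
    (h0 : SqHit x h u) (h1 : SqHit x h (u + a)) (h2 : SqHit x h (u + (a + c)))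
    (h3 : SqHit x h (u + (a + c) + a)) :
    4 * x * (a * (a + c) * (c * (2 * a + c))) / w ^ 5 ≤ 2 * (a + c) * h / z ^ 2 ∨
      1 - 2 * (a + c) * h / z ^ 2 ≤ 4 * x * (a * (a + c) * (c * (2 * a + c))) / z ^ 5 := by
  have ha : (0 : ℝ) ≤ a := by positivity
  have hc : (0 : ℝ) ≤ c := by positivity
  obtain ⟨m0, t0, e0, p0, q0⟩ := h0.theta hz hu
  obtain ⟨m1, t1, e1, p1, q1⟩ := h1.theta hz (by push_cast; linarith)
  obtain ⟨m2, t2, e2, p2, q2⟩ := h2.theta hz (by push_cast; linarith)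
  obtain ⟨m3, t3, e3, p3, q3⟩ := h3.theta hz (by push_cast; linarith)
  push_cast at e1 e2 e3 q1 q2 q3
  have hu0 : (0 : ℝ) < u := by linarith
  generalize (u : ℝ) = U at *
  have r0 := q0.trans (div_sq_le hh hz hu)
  have r1 := q1.trans (div_sq_le hh hz (by linarith : z ≤ U + a))
  have r2 := q2.trans (div_sq_le hh hz (by linarith : z ≤ U + (a + c)))
  have r3 := q3.trans (div_sq_le hh hz (by linarith : z ≤ U + (a + c) + a))
  set P : ℝ := (1 / U) * (1 / (U + a)) * (1 / (U + (a + c))) * (1 / (U + (a + c) + a)) *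
    (1 / U + 1 / (U + a) + 1 / (U + (a + c)) + 1 / (U + (a + c) + a)) with hP
  have key : (((c : ℤ) * m0 - (2 * a + c : ℤ) * m1 + (2 * a + c) * m2 - c * m3 : ℤ) : ℝ) =
      x * (a * (a + c) * (c * (2 * a + c))) * P +
        (c * t0 - (2 * a + c) * t1 + (2 * a + c) * t2 - c * t3) := by
    push_cast
    rw [e0, e1, e2, e3, hP]
    field_simp
    ring
  have hb : ∀ y : ℝ, z ≤ y → 1 / y ≤ 1 / z := fun y hy => one_div_le_one_div_of_le hz hy
  have hb' : ∀ y : ℝ, z ≤ y → y ≤ w → 1 / w ≤ 1 / y := fun y hy hy' =>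
    one_div_le_one_div_of_le (by linarith) hy'
  have hw0 : 0 < w := by linarith
  have b0 := hb U hu
  have b1 := hb (U + a) (by linarith)
  have b2 := hb (U + (a + c)) (by linarith)
  have b3 := hb (U + (a + c) + a) (by linarith)
  have b0' := hb' U hu (by linarith)
  have b1' := hb' (U + a) (by linarith) (by linarith)
  have b2' := hb' (U + (a + c)) (by linarith) (by linarith)
  have b3' := hb' (U + (a + c) + a) (by linarith) (by linarith)
  have hPu : P ≤ 4 / z ^ 5 := by
    calc P ≤ (1 / z) * (1 / z) * (1 / z) * (1 / z) * (1 / z + 1 / z + 1 / z + 1 / z) := by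
          rw [hP]; gcongr
      _ = 4 / z ^ 5 := by field_simp; norm_num
  have hPl : 4 / w ^ 5 ≤ P := by
    calc 4 / w ^ 5 = (1 / w) * (1 / w) * (1 / w) * (1 / w) * (1 / w + 1 / w + 1 / w + 1 / w) := by
          field_simp; norm_num
      _ ≤ P := by rw [hP]; gcongr
  have hK : 0 ≤ x * (a * (a + c) * (c * (2 * a + c)) : ℝ) := by positivity
  have hP0 : 0 ≤ P := by positivity
  have herr : |c * t0 - (2 * a + c) * t1 + (2 * a + c) * t2 - c * t3| ≤ 2 * (a + c) * h / z ^ 2 := by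
    have h2 : (0 : ℝ) ≤ 2 * a + c := by positivity
    have E0 := mul_le_mul_of_nonneg_left r0 hc
    have E1 := mul_le_mul_of_nonneg_left r1 h2
    have E2 := mul_le_mul_of_nonneg_left r2 h2
    have E3 := mul_le_mul_of_nonneg_left r3 hc
    have E0' := mul_nonneg hc p0
    have E1' := mul_nonneg h2 p1
    have E2' := mul_nonneg h2 p2
    have E3' := mul_nonneg hc p3
    rw [mul_div_assoc]
    generalize h / z ^ 2 = H at *
    rw [abs_le]; constructor <;> linarith
  rcases int_dichotomy _ _ _ _ key (mul_nonneg hK hP0) herr with H | H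
  · left
    refine le_trans ?_ H
    calc _ = x * (a * (a + c) * (c * (2 * a + c))) * (4 / w ^ 5) := by ring
      _ ≤ _ := mul_le_mul_of_nonneg_left hPl hK
  · right
    refine H.trans ?_
    calc _ ≤ x * (a * (a + c) * (c * (2 * a + c))) * (4 / z ^ 5) := mul_le_mul_of_nonneg_left hPu hK
      _ = _ := by ring

lemma coefA {h z U a t : ℝ} (hz : 0 < z) (hU : z ≤ U) (ha : 0 ≤ a) (haz : a ≤ z)
    (hh : 0 ≤ h) (ht : 0 ≤ t) (ht' : t ≤ h / U ^ 2) :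
    0 ≤ (2 * U - a) * t ∧ (2 * U - a) * t ≤ 2 * h / z := by
  have hU0 : 0 < U := by linarith
  refine ⟨mul_nonneg (by linarith) ht, ?_⟩
  calc (2 * U - a) * t ≤ (2 * U) * (h / U ^ 2) := by gcongr; linarith
    _ = 2 * h / U := by field_simp
    _ ≤ 2 * h / z := by gcongr

lemma coefB {h z U a t : ℝ} (hz : 0 < z) (hU : z ≤ U) (ha : 0 ≤ a)
    (hh : 0 ≤ h) (ht : 0 ≤ t) (ht' : t ≤ h / (U + a) ^ 2) :
    0 ≤ (2 * U + 3 * a) * t ∧ (2 * U + 3 * a) * t ≤ 2 * h / z := by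
  have hU0 : 0 < U := by linarith
  refine ⟨mul_nonneg (by linarith) ht, ?_⟩
  calc (2 * U + 3 * a) * t ≤ (2 * U + 3 * a) * (h / (U + a) ^ 2) := by gcongr
    _ ≤ 2 * h / U := by
      rw [← mul_div_assoc, div_le_div_iff₀ (by positivity) hU0]
      nlinarith [mul_nonneg hh (mul_nonneg hU0.le ha), mul_nonneg hh (mul_nonneg ha ha)]
    _ ≤ 2 * h / z := by gcongr

/-- Roth's two point inequality -/
lemma two_pt {x h z w : ℝ} (hx : 0 ≤ x) (hh : 0 ≤ h) (hz : 0 < z) {u a : ℕ}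
    (hu : z ≤ u) (hw : (u : ℝ) + a ≤ w) (haz : (a : ℝ) ≤ z)
    (h0 : SqHit x h u) (h1 : SqHit x h (u + a)) :
    x * (a : ℝ) ^ 3 / w ^ 4 ≤ 2 * h / z ∨ 1 - 2 * h / z ≤ x * (a : ℝ) ^ 3 / z ^ 4 := by
  have ha : (0 : ℝ) ≤ a := by positivity
  obtain ⟨m0, t0, e0, p0, q0⟩ := h0.theta hz hu
  obtain ⟨m1, t1, e1, p1, q1⟩ := h1.theta hz (by push_cast; linarith)
  push_cast at e1 q1
  have hu0 : (0 : ℝ) < u := by linarith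
  set P : ℝ := 1 / ((u : ℝ) ^ 2 * (u + a) ^ 2) with hP
  have key : (((2 * u + 3 * a : ℤ) * m1 - (2 * u - a : ℤ) * m0 : ℤ) : ℝ) =
      x * (a : ℝ) ^ 3 * P + ((2 * u + 3 * a) * t1 - (2 * u - a) * t0) := by
    push_cast
    rw [e0, e1, hP]
    field_simp
    ring
  have hw0 : 0 < w := by linarith
  have A := coefA hz hu ha haz hh p0 q0
  have B := coefB hz hu ha hh p1 q1
  have hPu : P ≤ 1 / z ^ 4 := by
    calc P ≤ 1 / (z ^ 2 * z ^ 2) := by rw [hP]; gcongr; linarith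
      _ = 1 / z ^ 4 := by ring
  have hPl : 1 / w ^ 4 ≤ P := by
    calc 1 / w ^ 4 = 1 / (w ^ 2 * w ^ 2) := by ring
      _ ≤ P := by rw [hP]; gcongr; linarith
  have hK : 0 ≤ x * (a : ℝ) ^ 3 := by positivity
  have herr : |(2 * u + 3 * a) * t1 - (2 * u - a) * t0| ≤ 2 * h / z := by
    rw [abs_le]; constructor <;> linarith [A.1, A.2, B.1, B.2]
  rcases int_dichotomy _ _ _ _ key (mul_nonneg hK (by positivity)) herr with H | H
  · left
    refine le_trans ?_ H
    calc _ = x * (a : ℝ) ^ 3 * (1 / w ^ 4) := by ring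
      _ ≤ _ := mul_le_mul_of_nonneg_left hPl hK
  · right
    refine H.trans ?_
    calc _ ≤ x * (a : ℝ) ^ 3 * (1 / z ^ 4) := mul_le_mul_of_nonneg_left hPu hK
      _ = _ := by ring

/-- four point inequality (F) -/
lemma four_pt_F {x h z w : ℝ} (hx : 0 ≤ x) (hh : 0 ≤ h) (hz : 0 < z) {u a b : ℕ}
    (hu : z ≤ u) (hw : (u : ℝ) + a + b ≤ w) (haz : (a : ℝ) ≤ z)
    (h0 : SqHit x h u) (h1 : SqHit x h (u + a)) (h2 : SqHit x h (u + b))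
    (h3 : SqHit x h (u + b + a)) :
    4 * x * ((a : ℝ) ^ 3 * b) / w ^ 5 ≤ 4 * h / z ∨
      1 - 4 * h / z ≤ 4 * x * ((a : ℝ) ^ 3 * b) / z ^ 5 := by
  have ha : (0 : ℝ) ≤ a := by positivity
  have hb0 : (0 : ℝ) ≤ b := by positivity
  obtain ⟨m0, t0, e0, p0, q0⟩ := h0.theta hz hu
  obtain ⟨m1, t1, e1, p1, q1⟩ := h1.theta hz (by push_cast; linarith)
  obtain ⟨m2, t2, e2, p2, q2⟩ := h2.theta hz (by push_cast; linarith)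
  obtain ⟨m3, t3, e3, p3, q3⟩ := h3.theta hz (by push_cast; linarith)
  push_cast at e1 e2 e3 q1 q2 q3
  have hu0 : (0 : ℝ) < u := by linarith
  have A := coefA hz hu ha haz hh p0 q0
  have B := coefB hz hu ha hh p1 q1
  have A' := coefA hz (by linarith : z ≤ (u : ℝ) + b) ha haz hh p2 q2
  have B' := coefB hz (by linarith : z ≤ (u : ℝ) + b) ha hh p3 q3
  set P : ℝ := (1 / (u : ℝ) + 1 / (u + b + a)) * (1 / (u + a)) * (1 / (u + b)) *
    ((1 / u) * (1 / (u + a)) + (1 / (u + b)) * (1 / (u + b + a))) with hP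
  have key : (((2 * u + 3 * a : ℤ) * m1 - (2 * u - a : ℤ) * m0
      + (2 * (u + b) - a : ℤ) * m2 - (2 * (u + b) + 3 * a : ℤ) * m3 : ℤ) : ℝ) =
      x * ((a : ℝ) ^ 3 * b) * P + ((2 * u + 3 * a) * t1 - (2 * u - a) * t0
        + (2 * (u + b) - a) * t2 - (2 * (u + b) + 3 * a) * t3) := by
    push_cast
    rw [e0, e1, e2, e3, hP]
    field_simp
    ring
  have hb : ∀ y : ℝ, z ≤ y → 1 / y ≤ 1 / z := fun y hy => one_div_le_one_div_of_le hz hy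
  have hb' : ∀ y : ℝ, z ≤ y → y ≤ w → 1 / w ≤ 1 / y := fun y hy hy' =>
    one_div_le_one_div_of_le (by linarith) hy'
  have hw0 : 0 < w := by linarith
  have b0 := hb u hu
  have b1 := hb (u + a) (by linarith)
  have b2 := hb (u + b) (by linarith)
  have b3 := hb (u + b + a) (by linarith)
  have b0' := hb' u hu (by linarith)
  have b1' := hb' (u + a) (by linarith) (by linarith)
  have b2' := hb' (u + b) (by linarith) (by linarith)
  have b3' := hb' (u + b + a) (by linarith) (by linarith)
  have hPu : P ≤ 4 / z ^ 5 := by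
    calc P ≤ (1 / z + 1 / z) * (1 / z) * (1 / z) * ((1 / z) * (1 / z) + (1 / z) * (1 / z)) := by
          rw [hP]; gcongr
      _ = 4 / z ^ 5 := by field_simp; norm_num
  have hPl : 4 / w ^ 5 ≤ P := by
    calc 4 / w ^ 5 = (1 / w + 1 / w) * (1 / w) * (1 / w) * ((1 / w) * (1 / w) + (1 / w) * (1 / w)) := by
          field_simp; norm_num
      _ ≤ P := by rw [hP]; gcongr
  have hK : 0 ≤ x * ((a : ℝ) ^ 3 * b) := by positivity
  have hP0 : 0 ≤ P := by positivity
  have herr : |(2 * u + 3 * a) * t1 - (2 * u - a) * t0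
        + (2 * (u + b) - a) * t2 - (2 * (u + b) + 3 * a) * t3| ≤ 4 * h / z := by
    have : 4 * h / z = 2 * h / z + 2 * h / z := by ring
    rw [abs_le, this]
    constructor <;> linarith [A.1, A.2, B.1, B.2, A'.1, A'.2, B'.1, B'.2]
  rcases int_dichotomy _ _ _ _ key (mul_nonneg hK hP0) herr with H | H
  · left
    refine le_trans ?_ H
    calc _ = x * ((a : ℝ) ^ 3 * b) * (4 / w ^ 5) := by ring
      _ ≤ _ := mul_le_mul_of_nonneg_left hPl hK
  · right
    refine H.trans ?_
    calc _ ≤ x * ((a : ℝ) ^ 3 * b) * (4 / z ^ 5) := mul_le_mul_of_nonneg_left hPu hK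
      _ = _ := by ring


lemma box_count (T : Finset ℕ) (p Z B K : ℝ) (hB : 0 < B) (hK : 0 ≤ K)
    (hT : ∀ u ∈ T, p ≤ (u : ℝ) ∧ (u : ℝ) ≤ p + Z) (hZ : 0 ≤ Z)
    (hM : ∀ T' ⊆ T, (∀ u ∈ T', ∀ v ∈ T', (v : ℝ) - u < B) → (T'.card : ℝ) ≤ K) :
    (T.card : ℝ) ≤ (Z / B + 1) * K := by
  classical
  set f : ℕ → ℕ := fun u => ⌊((u : ℝ) - p) / B⌋₊ with hf
  have hmaps : ∀ u ∈ T, f u ∈ Finset.range (⌊Z / B⌋₊ + 1) := by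
    intro u hu
    rw [Finset.mem_range, Nat.lt_succ_iff]
    apply Nat.floor_le_floor
    gcongr
    linarith [(hT u hu).2]
  rw [Finset.card_eq_sum_card_fiberwise hmaps]
  push_cast
  calc ∑ b ∈ Finset.range (⌊Z / B⌋₊ + 1), ((T.filter (fun a => f a = b)).card : ℝ)
      ≤ ∑ b ∈ Finset.range (⌊Z / B⌋₊ + 1), K := by
        apply Finset.sum_le_sum
        intro b _
        apply hM _ (Finset.filter_subset _ _)
        intro u hu v hv
        rw [Finset.mem_filter] at hu hv
        have h1 : (b : ℝ) ≤ ((u : ℝ) - p) / B := by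
          rw [← hu.2]
          apply Nat.floor_le
          apply div_nonneg _ hB.le
          linarith [(hT u hu.1).1]
        have h2 : ((v : ℝ) - p) / B < b + 1 := by
          rw [← hv.2]
          exact Nat.lt_floor_add_one _
        rw [le_div_iff₀ hB] at h1
        rw [div_lt_iff₀ hB] at h2
        nlinarith
    _ = (⌊Z / B⌋₊ + 1) * K := by simp
    _ ≤ (Z / B + 1) * K := by
        gcongr
        apply Nat.floor_le
        positivity

lemma card_le_two_of_gap (T : Finset ℕ) (g : ℕ → ℕ)
    (h : ∀ u ∈ T, ∀ v ∈ T, u < v → v = u + g u) : T.card ≤ 2 := by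
  classical
  rcases T.eq_empty_or_nonempty with rfl | hne
  · simp
  · set u := T.min' hne
    have hu : u ∈ T := T.min'_mem hne
    have : T ⊆ {u, u + g u} := by
      intro v hv
      rcases (T.min'_le v hv).eq_or_lt with h1 | h1
      · simp [u, h1]
      · simp [h u hu v hv h1]
    exact (Finset.card_le_card this).trans Finset.card_le_two

lemma gap_count (T : Finset ℕ) (p Z B : ℝ) (hB : 0 < B) (hZ : 0 ≤ Z) (g : ℕ → ℕ)
    (hT : ∀ u ∈ T, p ≤ (u : ℝ) ∧ (u : ℝ) ≤ p + Z)
    (h : ∀ u ∈ T, ∀ v ∈ T, u < v → v = u + g u ∨ B ≤ (v : ℝ) - u) :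
    (T.card : ℝ) ≤ (Z / B + 1) * 2 := by
  apply box_count T p Z B 2 hB (by norm_num) hT hZ
  intro T' hT' hd
  have := card_le_two_of_gap T' g (fun u hu v hv huv => by
    rcases h u (hT' hu) v (hT' hv) huv with h1 | h1
    · exact h1
    · exact absurd (hd u hu v hv) (not_lt.mpr h1))
  exact_mod_cast this

lemma spaced_count (T : Finset ℕ) (p Z B : ℝ) (hB : 0 < B) (hZ : 0 ≤ Z)
    (hT : ∀ u ∈ T, p ≤ (u : ℝ) ∧ (u : ℝ) ≤ p + Z)
    (h : ∀ u ∈ T, ∀ v ∈ T, u < v → B ≤ (v : ℝ) - u) :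
    (T.card : ℝ) ≤ Z / B + 1 := by
  have := box_count T p Z B 1 hB (by norm_num) hT hZ (by
    intro T' hT' hd
    have : T'.card ≤ 1 := by
      rw [Finset.card_le_one]
      intro u hu v hv
      rcases lt_trichotomy u v with h1 | h1 | h1
      · exact absurd (hd u hu v hv) (not_lt.mpr (h u (hT' hu) v (hT' hv) h1))
      · exact h1
      · exact absurd (hd v hv u hu) (not_lt.mpr (h v (hT' hv) u (hT' hu) h1))
    exact_mod_cast this)
  linarith

lemma two_level_count (T : Finset ℕ) (p Z B l β : ℝ) (hB : 0 < B) (hβ : 0 < β) (hl : 0 ≤ l)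
    (hZ : 0 ≤ Z) (g : ℕ → ℕ)
    (hT : ∀ u ∈ T, p ≤ (u : ℝ) ∧ (u : ℝ) ≤ p + Z)
    (h1 : ∀ u ∈ T, ∀ v ∈ T, u < v → v = u + g u ∨ β ≤ (v : ℝ) - u)
    (h2 : ∀ u ∈ T, ∀ v ∈ T, u < v → (v : ℝ) - u ≤ l ∨ B ≤ (v : ℝ) - u) :
    (T.card : ℝ) ≤ (Z / B + 1) * ((l / β + 1) * 2) := by
  apply box_count T p Z B _ hB (by positivity) hT hZ
  intro T' hT' hd
  rcases T'.eq_empty_or_nonempty with rfl | hne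
  · simp; positivity
  · apply gap_count T' (T'.min' hne : ℕ) l β hβ hl g
    · intro u hu
      have hm := T'.min'_mem hne
      have hle := T'.min'_le u hu
      refine ⟨by exact_mod_cast hle, ?_⟩
      rcases hle.eq_or_lt with h3 | h3
      · rw [h3]; linarith
      · rcases h2 _ (hT' hm) u (hT' hu) h3 with h4 | h4
        · linarith
        · exact absurd (hd _ hm u hu) (not_lt.mpr h4)
    · intro u hu v hv huv
      exact h1 u (hT' hu) v (hT' hv) huv

/-- a set in which every triple satisfies `(v-u)(w-v) ≤ C` is small -/
lemma card_le_of_triple (T : Finset ℕ) (C : ℕ)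
    (h : ∀ u ∈ T, ∀ v ∈ T, ∀ w ∈ T, u < v → v < w → (v - u) * (w - v) ≤ C) :
    T.card ≤ C + 2 := by
  by_contra! hc
  have hne : T.Nonempty := by
    rw [← Finset.card_pos]; omega
  set u := T.min' hne
  set w := T.max' hne
  have hu : u ∈ T := T.min'_mem hne
  have hw : w ∈ T := T.max'_mem hne
  have : ∃ v ∈ T, v ∉ ({u, w} : Finset ℕ) := by
    by_contra! h'
    have := (Finset.card_le_card (show T ⊆ {u, w} from h')).trans Finset.card_le_two
    omega
  obtain ⟨v, hv, hv'⟩ := this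
  have h1 : u < v := lt_of_le_of_ne (T.min'_le v hv) (fun h => hv' (by simp [h]))
  have h2 : v < w := lt_of_le_of_ne (T.le_max' v hv) (fun h => hv' (by simp [h]))
  have h3 := h u hu v hv w hw h1 h2
  have h4 : T ⊆ Finset.Icc u w := fun t ht => Finset.mem_Icc.mpr ⟨T.min'_le t ht, T.le_max' t ht⟩
  have h5 := Finset.card_le_card h4
  rw [Nat.card_Icc] at h5
  obtain ⟨a, rfl⟩ : ∃ a, v = u + 1 + a := ⟨v - u - 1, by omega⟩
  obtain ⟨c, hc'⟩ : ∃ c, w = u + 1 + a + 1 + c := ⟨w - (u + 1 + a) - 1, by omega⟩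
  rw [hc'] at h3 h5
  have e1 : u + 1 + a - u = a + 1 := by omega
  have e2 : u + 1 + a + 1 + c - (u + 1 + a) = c + 1 := by omega
  rw [e1, e2] at h3
  have h6 : T.card ≤ a + c + 3 := by omega
  nlinarith [Nat.zero_le (a * c)]


structure SqPiece (X L y lam : ℝ) (S : Finset ℕ) : Prop where
  hX : 0 < X
  hL : 500000 ≤ L
  hy : L ^ 2 / 500 ≤ y
  hyX : L * y ^ 2 ≤ 8 * X ^ 2
  hlam : 1 ≤ lam
  hlam' : lam ≤ 11 / 10
  hmem : ∀ u ∈ S, y * X ≤ (u : ℝ) ∧ (u : ℝ) ≤ lam * (y * X)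
  hodd : ∀ u ∈ S, u % 2 = 1
  hhit : ∀ u ∈ S, SqHit (X ^ 5) (X * L) u

namespace SqPiece
variable {X L y lam : ℝ} {S : Finset ℕ}

lemma Ly (P : SqPiece X L y lam S) : 1000 * L ≤ y := by
  have := P.hy; have := P.hL; nlinarith

lemma y_pos (P : SqPiece X L y lam S) : 0 < y := by
  have := P.Ly; have := P.hL; linarith

lemma diff_le (P : SqPiece X L y lam S) {u v : ℕ} (hu : u ∈ S) (hv : v ∈ S) :
    (v : ℝ) - u ≤ y * X / 10 := by
  have h1 := (P.hmem u hu).1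
  have h2 := (P.hmem v hv).2
  have h3 : lam * (y * X) ≤ 11 / 10 * (y * X) :=
    mul_le_mul_of_nonneg_right P.hlam' (mul_pos P.y_pos P.hX).le
  linarith

lemma err_le (P : SqPiece X L y lam S) : X * L / (y * X) ≤ 1 / 1000 := by
  have := P.Ly; have := P.hX; have := P.y_pos
  rw [div_le_div_iff₀ (by positivity) (by norm_num)]
  nlinarith

lemma lam4 (P : SqPiece X L y lam S) : lam ^ 4 ≤ 1.4641 := by
  have h0 : 0 ≤ lam := by linarith [P.hlam]
  calc lam ^ 4 ≤ (11 / 10) ^ 4 := pow_le_pow_left₀ h0 P.hlam' 4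
    _ = _ := by norm_num

lemma lam5 (P : SqPiece X L y lam S) : lam ^ 5 ≤ 1.6106 := by
  have h0 : 0 ≤ lam := by linarith [P.hlam]
  calc lam ^ 5 ≤ (11 / 10) ^ 5 := pow_le_pow_left₀ h0 P.hlam' 5
    _ ≤ _ := by norm_num

lemma L2 (P : SqPiece X L y lam S) {u a : ℕ} (h0 : u ∈ S) (h1 : u + a ∈ S) :
    0.996 * y ^ 4 ≤ (a : ℝ) ^ 3 * X ∨ (a : ℝ) ^ 3 * X ≤ 2.93 * (L * y ^ 3) := by
  have hX := P.hX; have hy := P.y_pos; have hL := P.hL; have hl := P.hlam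
  have hd := P.diff_le h0 h1
  have he := P.err_le
  push_cast at hd
  have hz : 0 < y * X := by positivity
  rcases two_pt (by positivity) (by positivity) hz (P.hmem u h0).1
    (by have := (P.hmem _ h1).2; push_cast at this; exact this) (by linarith)
    (P.hhit _ h0) (P.hhit _ h1) with H | H
  · right
    have e : X ^ 5 * (a : ℝ) ^ 3 / (lam * (y * X)) ^ 4 = (a : ℝ) ^ 3 * X / (lam ^ 4 * y ^ 4) := by
      field_simp
    have e2 : 2 * (X * L) / (y * X) = 2 * L / y := by field_simp
    rw [e, e2, div_le_div_iff₀ (by positivity) hy] at H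
    have h4 := P.lam4
    have : (a : ℝ) ^ 3 * X * y ≤ (2 * lam ^ 4) * (L * y ^ 3) * y := by linarith
    have := le_of_mul_le_mul_right this hy
    refine this.trans ?_
    gcongr
    linarith
  · left
    have e : X ^ 5 * (a : ℝ) ^ 3 / (y * X) ^ 4 = (a : ℝ) ^ 3 * X / y ^ 4 := by
      field_simp
    rw [e] at H
    have : (0.996 : ℝ) ≤ (a : ℝ) ^ 3 * X / y ^ 4 := by
      refine le_trans ?_ H
      rw [mul_div_assoc]
      linarith
    rwa [le_div_iff₀ (by positivity)] at this

lemma L3 (P : SqPiece X L y lam S) {u a c : ℕ} (h0 : u ∈ S) (h1 : u + a ∈ S)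
    (h2 : u + a + c ∈ S) (ha : 0 < a) (hc : 0 < c) :
    0.996 * y ^ 4 ≤ 3 * ((a : ℝ) * c * (a + c)) * X := by
  have hX := P.hX; have hy := P.y_pos; have hL := P.hL; have hl := P.hlam
  have hd := P.diff_le h0 h2
  have he := P.err_le
  push_cast at hd
  have hz : 0 < y * X := by positivity
  have o0 := P.hodd _ h0
  have o1 := P.hodd _ h1
  have o2 := P.hodd _ h2
  have ha2 : (2 : ℝ) ≤ a := by exact_mod_cast (by omega : 2 ≤ a)
  have hc2 : (2 : ℝ) ≤ c := by exact_mod_cast (by omega : 2 ≤ c)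
  rcases three_pt (by positivity) (by positivity) hz (P.hmem u h0).1
    (by have := (P.hmem _ h2).2; push_cast at this; exact this)
    (P.hhit _ h0) (P.hhit _ h1) (P.hhit _ h2) with H | H
  · exfalso
    have e : 3 * X ^ 5 * ((a : ℝ) * c * (a + c)) / (lam * (y * X)) ^ 4
      = 3 * (a * c * (a + c)) * X / (lam ^ 4 * y ^ 4) := by
      field_simp
    have e2 : ((a : ℝ) + c) * (X * L) / (y * X) ^ 2 = (a + c) * L / (X * y ^ 2) := by field_simp
    rw [e, e2, div_le_div_iff₀ (by positivity) (by positivity)] at H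
    have h4 := P.lam4
    have hk : 0 < ((a : ℝ) + c) * y ^ 2 := by positivity
    have h5 : (3 * (a * c : ℝ) * X ^ 2) * ((a + c) * y ^ 2) ≤
        (lam ^ 4 * (L * y ^ 2)) * ((a + c) * y ^ 2) := by linarith
    have h6 := le_of_mul_le_mul_right h5 hk
    have h7 : lam ^ 4 * (L * y ^ 2) ≤ 1.4641 * (8 * X ^ 2) := by
      have := P.hyX
      gcongr
    have h8 : (4 : ℝ) ≤ a * c := by nlinarith
    have hX2 : 0 < X ^ 2 := by positivity
    nlinarith
  · have e : 3 * X ^ 5 * ((a : ℝ) * c * (a + c)) / (y * X) ^ 4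
      = 3 * (a * c * (a + c)) * X / y ^ 4 := by
      field_simp
    rw [e] at H
    have h5 : ((a : ℝ) + c) * (X * L) / (y * X) ^ 2 ≤ 1 / 1000 := by
      calc ((a : ℝ) + c) * (X * L) / (y * X) ^ 2 ≤ (y * X) * (X * L) / (y * X) ^ 2 := by
            gcongr; linarith
        _ = X * L / (y * X) := by field_simp
        _ ≤ _ := he
    have : (0.996 : ℝ) ≤ 3 * (a * c * (a + c)) * X / y ^ 4 := by
      refine le_trans ?_ H
      linarith
    rwa [le_div_iff₀ (by positivity)] at this

lemma LD (P : SqPiece X L y lam S) {u a c : ℕ} (h0 : u ∈ S) (h1 : u + a ∈ S)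
    (h2 : u + (a + c) ∈ S) (h3 : u + (a + c) + a ∈ S) (ha : 0 < a) (hc : 0 < c) :
    0.996 * y ^ 5 ≤ 4 * (a : ℝ) * (a + c) ^ 3 := by
  have hX := P.hX; have hy := P.y_pos; have hL := P.hL; have hl := P.hlam
  have hd := P.diff_le h0 h3
  have he := P.err_le
  push_cast at hd
  have hz : 0 < y * X := by positivity
  have ha2 : (0 : ℝ) < a := by exact_mod_cast ha
  have hc2 : (0 : ℝ) < c := by exact_mod_cast hc
  have T := P.L3 h0 h1 (by rwa [add_assoc]) ha hc
  rcases four_pt_D (w := lam * (y * X)) (by positivity) (by positivity) hz (P.hmem u h0).1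
    (by have := (P.hmem _ h3).2; push_cast at this; linarith)
    (P.hhit _ h0) (P.hhit _ h1) (P.hhit _ h2) (P.hhit _ h3) with H | H
  · exfalso
    have e : 4 * X ^ 5 * ((a : ℝ) * (a + c) * (c * (2 * a + c))) / (lam * (y * X)) ^ 5
      = 4 * (a * (a + c) * (c * (2 * a + c))) / (lam ^ 5 * y ^ 5) := by
      field_simp
    have e2 : 2 * ((a : ℝ) + c) * (X * L) / (y * X) ^ 2 = 2 * (a + c) * L / (X * y ^ 2) := by
      field_simp
    rw [e, e2, div_le_div_iff₀ (by positivity) (by positivity)] at H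
    have h4 := P.lam5
    have hk : 0 < 2 * ((a : ℝ) + c) * y ^ 2 := by positivity
    have h5 : (2 * (a * (c * (2 * a + c)) : ℝ) * X) * (2 * (a + c) * y ^ 2) ≤
        (lam ^ 5 * (L * y ^ 3)) * (2 * (a + c) * y ^ 2) := by linarith
    have h6 := le_of_mul_le_mul_right h5 hk
    have h7 : lam ^ 5 * (L * y ^ 3) ≤ 1.6106 * (y / 1000 * y ^ 3) := by
      have := P.Ly
      gcongr
      linarith
    have h8 : (a : ℝ) * c * (a + c) * X ≤ a * (c * (2 * a + c)) * X := by
      have : (a : ℝ) * c * (a + c) ≤ a * (c * (2 * a + c)) := by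
        nlinarith [mul_pos (mul_pos ha2 hc2) ha2]
      gcongr
    have hX2 : 0 < y ^ 4 := by positivity
    have : y / 1000 * y ^ 3 = y ^ 4 / 1000 := by ring
    rw [this] at h7
    linarith
  · have e : 4 * X ^ 5 * ((a : ℝ) * (a + c) * (c * (2 * a + c))) / (y * X) ^ 5
      = 4 * (a * (a + c) * (c * (2 * a + c))) / y ^ 5 := by
      field_simp
    rw [e] at H
    have h5 : 2 * ((a : ℝ) + c) * (X * L) / (y * X) ^ 2 ≤ 2 / 1000 := by
      calc 2 * ((a : ℝ) + c) * (X * L) / (y * X) ^ 2 ≤ 2 * (y * X) * (X * L) / (y * X) ^ 2 := by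
            gcongr; linarith
        _ = 2 * (X * L / (y * X)) := by field_simp
        _ ≤ _ := by linarith
    have : (0.996 : ℝ) ≤ 4 * (a * (a + c) * (c * (2 * a + c))) / y ^ 5 := by
      refine le_trans ?_ H
      linarith
    rw [le_div_iff₀ (by positivity)] at this
    refine this.trans ?_
    have h9 : (c : ℝ) * (2 * a + c) ≤ (a + c) ^ 2 := by nlinarith
    calc 4 * ((a : ℝ) * (a + c) * (c * (2 * a + c))) ≤ 4 * (a * (a + c) * (a + c) ^ 2) := by gcongr
      _ = _ := by ring

lemma LF (P : SqPiece X L y lam S) {u a b : ℕ} (h0 : u ∈ S) (h1 : u + a ∈ S)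
    (h2 : u + b ∈ S) (h3 : u + b + a ∈ S) :
    (a : ℝ) ^ 3 * b ≤ 1.6106 * (L * y ^ 4) ∨ 0.996 * y ^ 5 ≤ 4 * ((a : ℝ) ^ 3 * b) := by
  have hX := P.hX; have hy := P.y_pos; have hL := P.hL; have hl := P.hlam
  have hd := P.diff_le h0 h1
  have he := P.err_le
  push_cast at hd
  have hz : 0 < y * X := by positivity
  rcases four_pt_F (w := lam * (y * X)) (by positivity) (by positivity) hz (P.hmem u h0).1
    (by have := (P.hmem _ h3).2; push_cast at this; linarith) (by linarith)
    (P.hhit _ h0) (P.hhit _ h1) (P.hhit _ h2) (P.hhit _ h3) with H | H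
  · left
    have e : 4 * X ^ 5 * ((a : ℝ) ^ 3 * b) / (lam * (y * X)) ^ 5
      = 4 * ((a : ℝ) ^ 3 * b) / (lam ^ 5 * y ^ 5) := by
      field_simp
    have e2 : 4 * (X * L) / (y * X) = 4 * L / y := by field_simp
    rw [e, e2, div_le_div_iff₀ (by positivity) hy] at H
    have h4 := P.lam5
    have : (a : ℝ) ^ 3 * b * y ≤ (lam ^ 5) * (L * y ^ 4) * y := by linarith
    have := le_of_mul_le_mul_right this hy
    refine this.trans ?_
    gcongr
  · right
    have e : 4 * X ^ 5 * ((a : ℝ) ^ 3 * b) / (y * X) ^ 5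
      = 4 * ((a : ℝ) ^ 3 * b) / y ^ 5 := by
      field_simp
    rw [e] at H
    have : (0.996 : ℝ) ≤ 4 * ((a : ℝ) ^ 3 * b) / y ^ 5 := by
      refine le_trans ?_ H
      rw [mul_div_assoc]
      linarith
    rwa [le_div_iff₀ (by positivity)] at this

end SqPiece


lemma exists_gap_fun (S : Finset ℕ) (A : ℝ) : ∃ g : ℕ → ℕ, ∀ u ∈ S,
    (∃ v ∈ S, u < v ∧ (v : ℝ) - u ≤ A) →
      0 < g u ∧ u + g u ∈ S ∧ (g u : ℝ) ≤ A ∧ ∀ v ∈ S, u < v → u + g u ≤ v := by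
  classical
  have : ∀ u : ℕ, ∃ a : ℕ, u ∈ S → (∃ v ∈ S, u < v ∧ (v : ℝ) - u ≤ A) →
      0 < a ∧ u + a ∈ S ∧ (a : ℝ) ≤ A ∧ ∀ v ∈ S, u < v → u + a ≤ v := by
    intro u
    by_cases h : ∃ v ∈ S, u < v ∧ (v : ℝ) - u ≤ A
    · obtain ⟨v0, hv0, huv0, hA⟩ := h
      have hne : (S.filter (fun v => u < v)).Nonempty := ⟨v0, by simp [hv0, huv0]⟩
      set w := (S.filter (fun v => u < v)).min' hne with hw
      have hwm := (S.filter (fun v => u < v)).min'_mem hne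
      rw [← hw, Finset.mem_filter] at hwm
      have hle : ∀ v ∈ S, u < v → w ≤ v := fun v hv huv =>
        Finset.min'_le _ _ (by simp [hv, huv])
      refine ⟨w - u, fun _ _ => ⟨by omega, ?_, ?_, ?_⟩⟩
      · rw [Nat.add_sub_cancel' hwm.2.le]; exact hwm.1
      · rw [Nat.cast_sub hwm.2.le]
        have : (w : ℝ) ≤ v0 := by exact_mod_cast hle v0 hv0 huv0
        linarith
      · intro v hv huv
        have := hle v hv huv
        omega
    · exact ⟨0, fun _ h' => absurd h' h⟩
  choose g hg using this
  exact ⟨g, fun u hu h => hg u hu h⟩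

lemma sum_cubes (J : ℕ) : ∑ j ∈ Finset.Icc 1 J, (2 * (j : ℝ)) ^ 3 = 2 * ((J : ℝ) * (J + 1)) ^ 2 := by
  induction J with
  | zero => simp
  | succ n ih =>
    rw [Finset.sum_Icc_succ_top (by omega), ih]
    push_cast
    ring

namespace SqPiece
variable {V M r lam : ℝ} {S : Finset ℕ}

lemma gap_D {X L y : ℝ} (P : SqPiece X L y lam S) {g : ℕ → ℕ} {u v : ℕ} (hu : u ∈ S) (hv : v ∈ S)
    (hgu : 0 < g u ∧ u + g u ∈ S ∧ ∀ v ∈ S, u < v → u + g u ≤ v) (hgv : v + g u ∈ S)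
    (huv : u < v) : v = u + g u ∨ 0.996 * y ^ 5 ≤ 4 * (g u : ℝ) * ((v : ℝ) - u) ^ 3 := by
  obtain ⟨h1, h2, h3⟩ := hgu
  have h4 := h3 v hv huv
  obtain ⟨c, hc⟩ : ∃ c, v = u + (g u + c) := ⟨v - u - g u, by omega⟩
  rcases Nat.eq_zero_or_pos c with rfl | hc0
  · left; omega
  · right
    have := P.LD hu h2 (by rwa [← hc]) (by rwa [← hc]) h1 hc0
    have e : (v : ℝ) - u = g u + c := by rw [hc]; push_cast; ring
    rwa [e]

lemma count_big (P : SqPiece (V ^ 9) (M ^ 18) (r ^ 6) lam S) (hV : 0 < V) (hM : 0 < M) (hr : 0 < r)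
    (T : Finset ℕ) (hTS : T ⊆ S) (g : ℕ → ℕ)
    (hg : ∀ u ∈ T, 0 < g u ∧ u + g u ∈ S ∧ (g u : ℝ) ≤ 0.75 * r ^ 6 ∧
      ∀ v ∈ S, u < v → u + g u ≤ v)
    (hbig : ∀ u ∈ T, 0.996 * (r ^ 6) ^ 4 ≤ (g u : ℝ) ^ 3 * V ^ 9) :
    (T.card : ℝ) ≤ 0.0318 * V ^ 9 + 0.75 * r ^ 6 + 2.462 * (V ^ 9 * M ^ 18 / r ^ 2) := by
  classical
  set J := ⌊0.375 * r ^ 6⌋₊ with hJ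
  have hr6 : (5e8 : ℝ) ≤ r ^ 6 := by
    have h1 := P.hy
    have h2 := P.hL
    have : (500000 : ℝ) ^ 2 ≤ (M ^ 18) ^ 2 := by gcongr
    norm_num at this ⊢
    linarith
  have hJle : (J : ℝ) ≤ 0.375 * r ^ 6 := Nat.floor_le (by positivity)
  have heven : ∀ u ∈ T, 2 * (g u / 2) = g u := by
    intro u hu
    have o0 := P.hodd _ (hTS hu)
    have o1 := P.hodd _ (hg u hu).2.1
    omega
  have hmaps : ∀ u ∈ T, g u / 2 ∈ Finset.Icc 1 J := by
    intro u hu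
    have h1 := heven u hu
    have h2 := (hg u hu).1
    rw [Finset.mem_Icc]
    refine ⟨by omega, ?_⟩
    rw [hJ]
    apply Nat.le_floor
    have h3 : (2 : ℝ) * ((g u / 2 : ℕ) : ℝ) = g u := by exact_mod_cast h1
    linarith [(hg u hu).2.2.1]
  rw [Finset.card_eq_sum_card_fiberwise hmaps]
  push_cast
  have key : ∀ j ∈ Finset.Icc 1 J, ((T.filter (fun u => g u / 2 = j)).card : ℝ) ≤
      0.8033 * V ^ 9 / (r ^ 6) ^ 4 * (2 * (j : ℝ)) ^ 3 + (2 + 6.563 * (V ^ 9 * M ^ 18 / r ^ 8)) := by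
    intro j hj
    rw [Finset.mem_Icc] at hj
    have hj0 : (0 : ℝ) < j := by exact_mod_cast hj.1
    set F := T.filter (fun u => g u / 2 = j) with hF
    rcases F.eq_empty_or_nonempty with h0 | ⟨u0, hu0⟩
    · rw [h0]; simp only [Finset.card_empty, Nat.cast_zero]; positivity
    set a : ℝ := 2 * (j : ℝ) with ha
    have ha0 : 0 < a := by positivity
    have hFT : ∀ u ∈ F, u ∈ T ∧ g u = 2 * j := by
      intro u hu
      rw [hF, Finset.mem_filter] at hu
      refine ⟨hu.1, ?_⟩
      rw [← hu.2, heven u hu.1]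
    have hga : ∀ u ∈ F, (g u : ℝ) = a := by
      intro u hu
      rw [(hFT u hu).2, ha]; push_cast; ring
    have habig : 0.996 * (r ^ 6) ^ 4 ≤ a ^ 3 * V ^ 9 := by
      rw [← hga u0 hu0]; exact hbig _ (hFT u0 hu0).1
    have hale : a ≤ 0.75 * r ^ 6 := by
      rw [← hga u0 hu0]; exact (hg _ (hFT u0 hu0).1).2.2.1
    have hcount := two_level_count F (r ^ 6 * V ^ 9) (0.1 * (r ^ 6 * V ^ 9))
      (0.249 * (r ^ 6) ^ 5 / a ^ 3) (1.6106 * (M ^ 18 * (r ^ 6) ^ 4) / a ^ 3) (0.69 * r ^ 8)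
      (by positivity) (by positivity) (by positivity) (by positivity) g
      (by
        intro u hu
        have h1 := P.hmem u (hTS (hFT u hu).1)
        refine ⟨h1.1, h1.2.trans ?_⟩
        have := mul_le_mul_of_nonneg_right P.hlam' (by positivity : 0 ≤ r ^ 6 * V ^ 9)
        linarith)
      (by
        intro u hu v hv huv
        have hu' := (hFT u hu).1
        have hv' := (hFT v hv).1
        have hgu := hg u hu'
        have hgv := hg v hv'
        have e : g v = g u := by rw [(hFT u hu).2, (hFT v hv).2]
        rcases P.gap_D (hTS hu') (hTS hv') ⟨hgu.1, hgu.2.1, hgu.2.2.2⟩ (e ▸ hgv.2.1) huv with h | h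
        · left; exact h
        · right
          rw [hga u hu] at h
          have hd : (0 : ℝ) ≤ (v : ℝ) - u := by
            have : (u : ℝ) < v := by exact_mod_cast huv
            linarith
          generalize (v : ℝ) - u = b at *
          have h5 : 0.996 * (r ^ 6) ^ 5 ≤ 4 * (0.75 * r ^ 6) * b ^ 3 := by
            refine h.trans ?_
            gcongr
          have h6 : (0.332 * r ^ 24) * r ^ 6 ≤ b ^ 3 * r ^ 6 := by
            nlinarith
          have h7 := le_of_mul_le_mul_right h6 (by positivity)
          have h8 : (0.69 * r ^ 8) ^ 3 ≤ b ^ 3 := by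
            refine le_trans ?_ h7
            have : 0 < r ^ 24 := by positivity
            have e : (0.69 * r ^ 8) ^ 3 = 0.69 ^ 3 * r ^ 24 := by ring
            rw [e]; gcongr; norm_num
          exact le_of_pow_le_pow_left₀ (by norm_num) hd h8)
      (by
        intro u hu v hv huv
        have hu' := (hFT u hu).1
        have hv' := (hFT v hv).1
        have hgu := hg u hu'
        have hgv := hg v hv'
        have e : g v = g u := by rw [(hFT u hu).2, (hFT v hv).2]
        obtain ⟨b, rfl⟩ : ∃ b, v = u + b := ⟨v - u, by omega⟩
        have hb : ((u + b : ℕ) : ℝ) - u = b := by push_cast; ring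
        rw [hb]
        rcases P.LF (hTS hu') hgu.2.1 (hTS hv') (e ▸ hgv.2.1) with h | h
        · left
          rw [hga u hu] at h
          rw [le_div_iff₀ (by positivity)]
          linarith
        · right
          rw [hga u hu] at h
          rw [div_le_iff₀ (by positivity)]
          linarith)
    refine hcount.trans ?_
    set l := 1.6106 * (M ^ 18 * (r ^ 6) ^ 4) / a ^ 3 with hl
    have e1 : 0.1 * (r ^ 6 * V ^ 9) / (0.249 * (r ^ 6) ^ 5 / a ^ 3) =
        (0.1 / 0.249) * (V ^ 9 / (r ^ 6) ^ 4 * a ^ 3) := by field_simp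
    have e2 : l * (0.1 * (r ^ 6 * V ^ 9) / (0.249 * (r ^ 6) ^ 5 / a ^ 3)) =
        (0.16106 / 0.249) * (V ^ 9 * M ^ 18) := by
      rw [hl]; field_simp; norm_num
    have e3 : l ≤ (1.6106 / 0.996) * (V ^ 9 * M ^ 18) := by
      rw [hl, div_le_iff₀ (by positivity)]
      have : 0 ≤ M ^ 18 := by positivity
      nlinarith [mul_le_mul_of_nonneg_left habig this]
    have e4 : (0.1 * (r ^ 6 * V ^ 9) / (0.249 * (r ^ 6) ^ 5 / a ^ 3) + 1) * ((l / (0.69 * r ^ 8) + 1) * 2)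
      = 2 * (0.1 * (r ^ 6 * V ^ 9) / (0.249 * (r ^ 6) ^ 5 / a ^ 3)) + 2 +
        2 * ((l * (0.1 * (r ^ 6 * V ^ 9) / (0.249 * (r ^ 6) ^ 5 / a ^ 3)) + l) / (0.69 * r ^ 8)) := by
      ring
    rw [e4, e2, e1]
    have e5 : ((0.16106 / 0.249) * (V ^ 9 * M ^ 18) + l) / (0.69 * r ^ 8) ≤
        (2.264 * (V ^ 9 * M ^ 18)) / (0.69 * r ^ 8) := by
      gcongr
      have : 0 < V ^ 9 * M ^ 18 := by positivity
      nlinarith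
    have e6 : (2.264 * (V ^ 9 * M ^ 18)) / (0.69 * r ^ 8) = (2.264 / 0.69) * (V ^ 9 * M ^ 18 / r ^ 8) := by
      field_simp
    have e7 : 0.8033 * V ^ 9 / (r ^ 6) ^ 4 * a ^ 3 = 0.8033 * (V ^ 9 / (r ^ 6) ^ 4 * a ^ 3) := by ring
    rw [e7]
    rw [e6] at e5
    have p1 : 0 < V ^ 9 / (r ^ 6) ^ 4 * a ^ 3 := by positivity
    have p2 : 0 < V ^ 9 * M ^ 18 / r ^ 8 := by positivity
    generalize V ^ 9 / (r ^ 6) ^ 4 * a ^ 3 = A1 at *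
    generalize V ^ 9 * M ^ 18 / r ^ 8 = A2 at *
    norm_num at *
    linarith
  refine (Finset.sum_le_sum key).trans ?_
  rw [Finset.sum_add_distrib, ← Finset.mul_sum, sum_cubes]
  simp only [Finset.sum_const, Nat.card_Icc, nsmul_eq_mul, Nat.add_sub_cancel]
  have f1 : 0.8033 * V ^ 9 / (r ^ 6) ^ 4 * (2 * ((J : ℝ) * (J + 1)) ^ 2) ≤ 0.0318 * V ^ 9 := by
    have g1 : (J : ℝ) * (J + 1) ≤ (0.375 * r ^ 6) * (0.37501 * r ^ 6) := by
      have : (J : ℝ) + 1 ≤ 0.37501 * r ^ 6 := by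
        norm_num at *
        linarith
      gcongr
    calc 0.8033 * V ^ 9 / (r ^ 6) ^ 4 * (2 * ((J : ℝ) * (J + 1)) ^ 2)
        ≤ 0.8033 * V ^ 9 / (r ^ 6) ^ 4 * (2 * ((0.375 * r ^ 6) * (0.37501 * r ^ 6)) ^ 2) := by gcongr
      _ = (0.8033 * 2 * 0.375 ^ 2 * 0.37501 ^ 2) * V ^ 9 := by field_simp
      _ ≤ 0.0318 * V ^ 9 := by gcongr; norm_num
  have f2 : (J : ℝ) * (2 + 6.563 * (V ^ 9 * M ^ 18 / r ^ 8)) ≤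
      0.75 * r ^ 6 + 2.462 * (V ^ 9 * M ^ 18 / r ^ 2) := by
    calc (J : ℝ) * (2 + 6.563 * (V ^ 9 * M ^ 18 / r ^ 8)) ≤
        (0.375 * r ^ 6) * (2 + 6.563 * (V ^ 9 * M ^ 18 / r ^ 8)) := by gcongr
      _ = 0.75 * r ^ 6 + (0.375 * 6.563) * (V ^ 9 * M ^ 18 / r ^ 2) := by field_simp; ring
      _ ≤ _ := by gcongr; norm_num
  linarith

end SqPiece


namespace SqPiece
variable {V M r lam : ℝ} {S : Finset ℕ}

lemma count_small_A (P : SqPiece (V ^ 9) (M ^ 18) (r ^ 6) lam S) (hV : 0 < V) (hM : 0 < M)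
    (hr : 0 < r) (hMV : 144 * M ^ 6 ≤ V ^ 3)
    (T : Finset ℕ) (hTS : T ⊆ S) (g : ℕ → ℕ)
    (hg : ∀ u ∈ T, 0 < g u ∧ u + g u ∈ S ∧ ∀ v ∈ S, u < v → u + g u ≤ v)
    (hs : ∀ u ∈ T, (g u : ℝ) * V ^ 3 ≤ 1.44 * (M ^ 6 * r ^ 6)) :
    (T.card : ℝ) ≤ 0.26 * (M ^ 8 * V ^ 5 * r ^ 4) + 0.01 * r ^ 6 := by
  classical
  set J := ⌊0.72 * (M ^ 6 * r ^ 6) / V ^ 3⌋₊ with hJ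
  have hJle : (J : ℝ) ≤ 0.72 * (M ^ 6 * r ^ 6) / V ^ 3 := Nat.floor_le (by positivity)
  have heven : ∀ u ∈ T, 2 * (g u / 2) = g u := by
    intro u hu
    have o0 := P.hodd _ (hTS hu)
    have o1 := P.hodd _ (hg u hu).2.1
    omega
  have hmaps : ∀ u ∈ T, g u / 2 ∈ Finset.Icc 1 J := by
    intro u hu
    have h1 := heven u hu
    have h2 := (hg u hu).1
    rw [Finset.mem_Icc]
    refine ⟨by omega, ?_⟩
    rw [hJ]
    apply Nat.le_floor
    have h3 : (2 : ℝ) * ((g u / 2 : ℕ) : ℝ) = g u := by exact_mod_cast h1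
    rw [le_div_iff₀ (by positivity)]
    have := hs u hu
    rw [← h3] at this
    linarith
  rw [Finset.card_eq_sum_card_fiberwise hmaps]
  push_cast
  have key : ∀ j ∈ Finset.Icc 1 J, ((T.filter (fun u => g u / 2 = j)).card : ℝ) ≤
      ((0.1 * (r ^ 6 * V ^ 9)) / (0.557 * (r ^ 8 * V) / M ^ 2) + 1) * 2 := by
    intro j hj
    rw [Finset.mem_Icc] at hj
    set F := T.filter (fun u => g u / 2 = j) with hF
    have hFT : ∀ u ∈ F, u ∈ T ∧ g u = 2 * j := by
      intro u hu
      rw [hF, Finset.mem_filter] at hu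
      refine ⟨hu.1, ?_⟩
      rw [← hu.2, heven u hu.1]
    apply gap_count F (r ^ 6 * V ^ 9) _ _ (by positivity) (by positivity) g
    · intro u hu
      have h1 := P.hmem u (hTS (hFT u hu).1)
      refine ⟨h1.1, h1.2.trans ?_⟩
      have := mul_le_mul_of_nonneg_right P.hlam' (by positivity : 0 ≤ r ^ 6 * V ^ 9)
      linarith
    · intro u hu v hv huv
      have hu' := (hFT u hu).1
      have hv' := (hFT v hv).1
      have hgu := hg u hu'
      have hgv := hg v hv'
      have e : g v = g u := by rw [(hFT u hu).2, (hFT v hv).2]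
      rcases P.gap_D (hTS hu') (hTS hv') hgu (e ▸ hgv.2.1) huv with h | h
      · left; exact h
      · right
        have hd : (0 : ℝ) ≤ (v : ℝ) - u := by
          have : (u : ℝ) < v := by exact_mod_cast huv
          linarith
        have hsu := hs u hu'
        generalize (v : ℝ) - u = b at *
        have h5 : (0.996 * (r ^ 24 * V ^ 3)) * r ^ 6 ≤ (5.76 * M ^ 6 * b ^ 3) * r ^ 6 := by
          have a1 := mul_le_mul_of_nonneg_right h (by positivity : 0 ≤ V ^ 3)
          have a2 := mul_le_mul_of_nonneg_right hsu (by positivity : 0 ≤ 4 * b ^ 3)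
          nlinarith
        have h7 := le_of_mul_le_mul_right h5 (by positivity)
        have h8 : (0.557 * (r ^ 8 * V) / M ^ 2) ^ 3 ≤ b ^ 3 := by
          rw [div_pow, div_le_iff₀ (by positivity)]
          have : 0 < r ^ 24 * V ^ 3 := by positivity
          have e : (0.557 * (r ^ 8 * V)) ^ 3 = 0.557 ^ 3 * (r ^ 24 * V ^ 3) := by ring
          have e' : b ^ 3 * (M ^ 2) ^ 3 = M ^ 6 * b ^ 3 := by ring
          rw [e, e']
          nlinarith
        exact le_of_pow_le_pow_left₀ (by norm_num) hd h8
  refine (Finset.sum_le_sum key).trans ?_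
  simp only [Finset.sum_const, Nat.card_Icc, nsmul_eq_mul, Nat.add_sub_cancel]
  calc (J : ℝ) * (((0.1 * (r ^ 6 * V ^ 9)) / (0.557 * (r ^ 8 * V) / M ^ 2) + 1) * 2)
      ≤ (0.72 * (M ^ 6 * r ^ 6) / V ^ 3) *
        (((0.1 * (r ^ 6 * V ^ 9)) / (0.557 * (r ^ 8 * V) / M ^ 2) + 1) * 2) := by gcongr
    _ = (0.144 / 0.557) * (M ^ 8 * V ^ 5 * r ^ 4) + 1.44 * (M ^ 6 * r ^ 6) / V ^ 3 := by
        field_simp; ring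
    _ ≤ _ := by
        apply add_le_add
        · gcongr; norm_num
        · rw [div_le_iff₀ (by positivity)]
          have := mul_le_mul_of_nonneg_right hMV (by positivity : 0 ≤ r ^ 6)
          linarith

lemma count_small_B (P : SqPiece (V ^ 9) (M ^ 18) (r ^ 6) lam S) (hV : 0 < V) (hM : 0 < M)
    (hr : 0 < r)
    (T : Finset ℕ) (hTS : T ⊆ S) (g : ℕ → ℕ)
    (hg : ∀ u ∈ T, 0 < g u ∧ u + g u ∈ S ∧ ∀ v ∈ S, u < v → u + g u ≤ v)
    (hs : ∀ u ∈ T, (g u : ℝ) * V ^ 3 ≤ 1.44 * (M ^ 6 * r ^ 6)) :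
    (T.card : ℝ) ≤ 0.417 * (V ^ 12 * M ^ 3 / r ^ 3) + 2 := by
  have := gap_count T (r ^ 6 * V ^ 9) (0.1 * (r ^ 6 * V ^ 9)) (0.48 * r ^ 9 / (V ^ 3 * M ^ 3))
    (by positivity) (by positivity) g
    (by
      intro u hu
      have h1 := P.hmem u (hTS hu)
      refine ⟨h1.1, h1.2.trans ?_⟩
      have := mul_le_mul_of_nonneg_right P.hlam' (by positivity : 0 ≤ r ^ 6 * V ^ 9)
      linarith)
    (by
      intro u hu v hv huv
      obtain ⟨h1, h2, h3⟩ := hg u hu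
      have h4 := h3 v (hTS hv) huv
      obtain ⟨c, hc⟩ : ∃ c, v = u + g u + c := ⟨v - u - g u, by omega⟩
      rcases Nat.eq_zero_or_pos c with rfl | hc0
      · left; omega
      · right
        have h := P.L3 (hTS hu) h2 (by rw [← hc]; exact hTS hv) h1 hc0
        have e : (v : ℝ) - u = g u + c := by rw [hc]; push_cast; ring
        rw [e]
        have hsu := hs u hu
        have hc' : (0 : ℝ) ≤ c := by positivity
        have hg' : (0 : ℝ) ≤ g u := by positivity
        generalize (c : ℝ) = c at *
        generalize (g u : ℝ) = a at *
        have h5 : 0.996 * (r ^ 6) ^ 4 ≤ 3 * (a * (a + c) * (a + c)) * V ^ 9 := by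
          refine h.trans ?_
          gcongr
          linarith
        have h6 : (0.996 * r ^ 18) * r ^ 6 ≤ (4.32 * (M ^ 6 * V ^ 6) * (a + c) ^ 2) * r ^ 6 := by
          have a2 := mul_le_mul_of_nonneg_right hsu (by positivity : 0 ≤ 3 * (a + c) ^ 2 * V ^ 6)
          nlinarith
        have h7 := le_of_mul_le_mul_right h6 (by positivity)
        have h8 : (0.48 * r ^ 9 / (V ^ 3 * M ^ 3)) ^ 2 ≤ (a + c) ^ 2 := by
          rw [div_pow, div_le_iff₀ (by positivity)]
          have : 0 < r ^ 18 := by positivity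
          have e : (0.48 * r ^ 9) ^ 2 = 0.48 ^ 2 * r ^ 18 := by ring
          have e' : (a + c) ^ 2 * (V ^ 3 * M ^ 3) ^ 2 = (M ^ 6 * V ^ 6) * (a + c) ^ 2 := by ring
          rw [e, e']
          nlinarith
        exact le_of_pow_le_pow_left₀ (by norm_num) (by positivity) h8)
  refine this.trans ?_
  have e : (0.1 * (r ^ 6 * V ^ 9) / (0.48 * r ^ 9 / (V ^ 3 * M ^ 3)) + 1) * 2 =
    (0.2 / 0.48) * (V ^ 12 * M ^ 3 / r ^ 3) + 2 := by
    field_simp; ring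
  rw [e]
  gcongr; norm_num

lemma count_small (P : SqPiece (V ^ 9) (M ^ 18) (r ^ 6) lam S) (hV : 0 < V) (hM : 2 ≤ M)
    (hr : 0 < r) (hMV : 144 * M ^ 6 ≤ V ^ 3)
    (T : Finset ℕ) (hTS : T ⊆ S) (g : ℕ → ℕ)
    (hg : ∀ u ∈ T, 0 < g u ∧ u + g u ∈ S ∧ ∀ v ∈ S, u < v → u + g u ≤ v)
    (hs : ∀ u ∈ T, (g u : ℝ) ^ 3 * V ^ 9 ≤ 2.93 * (M ^ 18 * (r ^ 6) ^ 3)) :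
    (T.card : ℝ) ≤ 0.26 * (M ^ 8 * V ^ 9) * min ((r / V) ^ 3) ((V / r) ^ 3) + 0.01 * r ^ 6 + 2 := by
  have hM0 : 0 < M := by linarith
  have hs' : ∀ u ∈ T, (g u : ℝ) * V ^ 3 ≤ 1.44 * (M ^ 6 * r ^ 6) := by
    intro u hu
    refine le_of_pow_le_pow_left₀ (n := 3) (by norm_num) (by positivity) ?_
    have := hs u hu
    have p : 0 < M ^ 18 * r ^ 18 := by positivity
    calc ((g u : ℝ) * V ^ 3) ^ 3 = (g u : ℝ) ^ 3 * V ^ 9 := by ring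
      _ ≤ 2.93 * (M ^ 18 * (r ^ 6) ^ 3) := this
      _ = 2.93 * (M ^ 18 * r ^ 18) := by ring
      _ ≤ 1.44 ^ 3 * (M ^ 18 * r ^ 18) := by gcongr; norm_num
      _ = _ := by ring
  rcases le_total r V with h | h
  · have c := P.count_small_A hV hM0 hr hMV T hTS g hg hs'
    have q1 : r / V ≤ 1 := by rw [div_le_one hV]; exact h
    have q2 : 1 ≤ V / r := by rw [one_le_div hr]; exact h
    have q3 : (r / V) ^ 3 ≤ (V / r) ^ 3 := by
      apply pow_le_pow_left₀ (by positivity); linarith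
    rw [min_eq_left q3]
    have e : M ^ 8 * V ^ 5 * r ^ 4 = (M ^ 8 * V ^ 9) * (r / V) ^ 4 := by field_simp
    have : (r / V) ^ 4 ≤ (r / V) ^ 3 := pow_le_pow_of_le_one (by positivity) q1 (by norm_num)
    rw [e] at c
    have := mul_le_mul_of_nonneg_left this (by positivity : 0 ≤ M ^ 8 * V ^ 9)
    linarith
  · have c := P.count_small_B hV hM0 hr T hTS g hg hs'
    have q1 : 1 ≤ r / V := by rw [one_le_div hV]; exact h
    have q2 : V / r ≤ 1 := by rw [div_le_one hr]; exact h
    have q3 : (V / r) ^ 3 ≤ (r / V) ^ 3 := by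
      apply pow_le_pow_left₀ (by positivity); linarith
    rw [min_eq_right q3]
    have e : V ^ 12 * M ^ 3 / r ^ 3 = M ^ 3 * (V ^ 9 * (V / r) ^ 3) := by field_simp
    have m5 : (32 : ℝ) ≤ M ^ 5 := by
      calc (32 : ℝ) = 2 ^ 5 := by norm_num
        _ ≤ M ^ 5 := by gcongr
    have p : 0 < M ^ 3 * (V ^ 9 * (V / r) ^ 3) := by positivity
    have e2 : 0.26 * (M ^ 8 * V ^ 9) * (V / r) ^ 3 = 0.26 * M ^ 5 * (M ^ 3 * (V ^ 9 * (V / r) ^ 3)) := by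
      ring
    rw [e] at c
    rw [e2]
    have : 0 < r ^ 6 := by positivity
    nlinarith

theorem count (P : SqPiece (V ^ 9) (M ^ 18) (r ^ 6) lam S) (hV : 0 < V) (hM : 2 ≤ M)
    (hr : 0 < r) (hMV : 144 * M ^ 6 ≤ V ^ 3) :
    (S.card : ℝ) ≤ 0.1652 * V ^ 9 + 2.462 * (V ^ 9 * M ^ 18 / r ^ 2) +
      0.26 * (M ^ 8 * V ^ 9) * min ((r / V) ^ 3) ((V / r) ^ 3) + 0.76 * r ^ 6 + 3 := by
  classical
  have hM0 : 0 < M := by linarith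
  obtain ⟨g, hg⟩ := exists_gap_fun S (0.75 * r ^ 6)
  set Q : ℕ → Prop := fun u => ∃ v ∈ S, u < v ∧ (v : ℝ) - u ≤ 0.75 * r ^ 6 with hQ
  set B : ℕ → Prop := fun u => 0.996 * (r ^ 6) ^ 4 ≤ (g u : ℝ) ^ 3 * V ^ 9 with hB
  have s1 : ((S.filter (fun u => ¬ Q u)).card : ℝ) ≤ 0.1 * (r ^ 6 * V ^ 9) / (0.75 * r ^ 6) + 1 := by
    apply spaced_count _ (r ^ 6 * V ^ 9) _ _ (by positivity) (by positivity)
    · intro u hu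
      have h1 := P.hmem u (Finset.mem_filter.1 hu).1
      refine ⟨h1.1, h1.2.trans ?_⟩
      have := mul_le_mul_of_nonneg_right P.hlam' (by positivity : 0 ≤ r ^ 6 * V ^ 9)
      linarith
    · intro u hu v hv huv
      by_contra hc
      exact (Finset.mem_filter.1 hu).2 ⟨v, (Finset.mem_filter.1 hv).1, huv, by linarith⟩
  have s2 := P.count_big hV hM0 hr ((S.filter Q).filter B) (fun u hu => by
      simp only [Finset.mem_filter] at hu; exact hu.1.1) g
    (fun u hu => by simp only [Finset.mem_filter] at hu; exact hg u hu.1.1 hu.1.2)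
    (fun u hu => by simp only [Finset.mem_filter] at hu; exact hu.2)
  have s3 := P.count_small hV hM hr hMV ((S.filter Q).filter (fun u => ¬ B u)) (fun u hu => by
      simp only [Finset.mem_filter] at hu; exact hu.1.1) g
    (fun u hu => by
      simp only [Finset.mem_filter] at hu
      have := hg u hu.1.1 hu.1.2
      exact ⟨this.1, this.2.1, this.2.2.2⟩)
    (fun u hu => by
      simp only [Finset.mem_filter] at hu
      have := hg u hu.1.1 hu.1.2
      exact (P.L2 hu.1.1 this.2.1).resolve_left hu.2)
  have c1 := Finset.card_filter_add_card_filter_not (s := S) Q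
  have c2 := Finset.card_filter_add_card_filter_not (s := S.filter Q) B
  have c : (S.card : ℝ) = ((S.filter Q).filter B).card + ((S.filter Q).filter (fun u => ¬ B u)).card
      + (S.filter (fun u => ¬ Q u)).card := by
    rw [← c1, ← c2]; push_cast; ring
  have e : 0.1 * (r ^ 6 * V ^ 9) / (0.75 * r ^ 6) = (0.1 / 0.75) * V ^ 9 := by field_simp
  rw [e] at s1
  have p : 0 < V ^ 9 := by positivity
  rw [c]
  have : (0.1 / 0.75 : ℝ) * V ^ 9 ≤ 0.1334 * V ^ 9 := by gcongr; norm_num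
  linarith

end SqPiece


lemma lossy_count {V M r : ℝ} (S : Finset ℕ) (hV : 0 < V) (hM : 0 < M) (hr : 0 < r)
    (hLy : M ^ 18 * r ^ 12 ≤ 40 * V ^ 18) (hy : 1000 * M ^ 18 ≤ r ^ 6)
    (hlow : V ^ 9 ≤ r ^ 6 * M ^ 9)
    (hmem : ∀ u ∈ S, r ^ 6 * V ^ 9 ≤ (u : ℝ) ∧ (u : ℝ) ≤ 2 * (r ^ 6 * V ^ 9))
    (hhit : ∀ u ∈ S, SqHit ((V ^ 9) ^ 5) (V ^ 9 * M ^ 18) u) :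
    (S.card : ℝ) ≤ 215 * (V ^ 9 * M ^ 3 + 1) := by
  have h1 := box_count S (r ^ 6 * V ^ 9) (r ^ 6 * V ^ 9) (r ^ 8 / V ^ 3) 215 (by positivity)
    (by norm_num) (fun u hu => ⟨(hmem u hu).1, by linarith [(hmem u hu).2]⟩) (by positivity)
    (by
      intro T hT hd
      have := card_le_of_triple T 213 (by
        intro u hu v hv w hw huv hvw
        obtain ⟨a, rfl⟩ : ∃ a, v = u + a := ⟨v - u, by omega⟩
        obtain ⟨c, rfl⟩ : ∃ c, w = u + a + c := ⟨w - (u + a), by omega⟩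
        have e1 : u + a - u = a := by omega
        have e2 : u + a + c - (u + a) = c := by omega
        rw [e1, e2]
        have ha : 0 < a := by omega
        have hc : 0 < c := by omega
        have ha' : (0 : ℝ) < a := by exact_mod_cast ha
        have hc' : (0 : ℝ) < c := by exact_mod_cast hc
        have hb := hd u hu _ hw
        push_cast at hb
        have hm0 := hmem u (hT hu)
        have hm2 := hmem _ (hT hw)
        push_cast at hm2
        rcases three_pt (z := r ^ 6 * V ^ 9) (w := 2 * (r ^ 6 * V ^ 9)) (by positivity)
          (by positivity) (by positivity) hm0.1 hm2.2 (hhit _ (hT hu)) (hhit _ (hT hv))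
          (hhit _ (hT hw)) with H | H
        · have e : 3 * (V ^ 9) ^ 5 * ((a : ℝ) * c * (a + c)) / (2 * (r ^ 6 * V ^ 9)) ^ 4 =
            3 * (a * c * (a + c)) * V ^ 9 / (16 * r ^ 24) := by field_simp; ring
          have e2 : ((a : ℝ) + c) * (V ^ 9 * M ^ 18) / (r ^ 6 * V ^ 9) ^ 2 =
            (a + c) * M ^ 18 / (V ^ 9 * r ^ 12) := by field_simp
          rw [e, e2, div_le_div_iff₀ (by positivity) (by positivity)] at H
          have h5 : (3 * ((a : ℝ) * c) * V ^ 18) * ((a + c) * r ^ 12) ≤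
            (16 * (M ^ 18 * r ^ 12)) * ((a + c) * r ^ 12) := by linarith
          have h6 := le_of_mul_le_mul_right h5 (by positivity)
          have h7 : (3 * ((a : ℝ) * c)) * V ^ 18 ≤ 640 * V ^ 18 := by linarith
          have h8 := le_of_mul_le_mul_right h7 (by positivity)
          have h9 : 3 * (a * c) ≤ 640 := by exact_mod_cast h8
          omega
        · exfalso
          have e : 3 * (V ^ 9) ^ 5 * ((a : ℝ) * c * (a + c)) / (r ^ 6 * V ^ 9) ^ 4 =
            3 * (a * c * (a + c)) * V ^ 9 / r ^ 24 := by field_simp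
          have e2 : ((a : ℝ) + c) * (V ^ 9 * M ^ 18) / (r ^ 6 * V ^ 9) ^ 2 ≤ 1 / 1000 := by
            calc ((a : ℝ) + c) * (V ^ 9 * M ^ 18) / (r ^ 6 * V ^ 9) ^ 2
                ≤ (r ^ 6 * V ^ 9) * (V ^ 9 * M ^ 18) / (r ^ 6 * V ^ 9) ^ 2 := by
                  gcongr; linarith
              _ = M ^ 18 / r ^ 6 := by field_simp
              _ ≤ 1 / 1000 := by
                  rw [div_le_div_iff₀ (by positivity) (by norm_num)]; linarith
          rw [e] at H
          have H2 : (999 / 1000 : ℝ) ≤ 3 * (a * c * (a + c)) * V ^ 9 / r ^ 24 := by linarith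
          rw [le_div_iff₀ (by positivity)] at H2
          have b1 : ((a : ℝ) + c) * V ^ 3 ≤ r ^ 8 := by
            have : (a : ℝ) + c ≤ r ^ 8 / V ^ 3 := by linarith
            rwa [le_div_iff₀ (by positivity)] at this
          have b2 : (((a : ℝ) + c) * V ^ 3) ^ 3 ≤ (r ^ 8) ^ 3 := by gcongr
          have b3 : (a : ℝ) * c * (a + c) ≤ (a + c) ^ 3 / 4 := by
            nlinarith [mul_nonneg (by positivity : (0 : ℝ) ≤ a + c) (sq_nonneg ((a : ℝ) - c))]
          have b4 := mul_le_mul_of_nonneg_right b3 (by positivity : 0 ≤ V ^ 9)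
          have : 0 < r ^ 24 := by positivity
          nlinarith)
      exact_mod_cast this)
  refine h1.trans ?_
  have e : r ^ 6 * V ^ 9 / (r ^ 8 / V ^ 3) = V ^ 12 / r ^ 2 := by field_simp
  have h2 : V ^ 3 ≤ r ^ 2 * M ^ 3 := by
    refine le_of_pow_le_pow_left₀ (n := 3) (by norm_num) (by positivity) ?_
    linarith
  have h3 : V ^ 12 / r ^ 2 ≤ V ^ 9 * M ^ 3 := by
    rw [div_le_iff₀ (by positivity)]
    nlinarith [mul_le_mul_of_nonneg_left h2 (by positivity : 0 ≤ V ^ 9)]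
  rw [e]
  linarith

lemma top_count {x h w : ℝ} (S : Finset ℕ) (hx : 0 < x) (hh : 0 ≤ h) (hxh : h ^ 2 ≤ 4 * x)
    (hw : 0 < w) (hS : ∀ u ∈ S, w ≤ (u : ℝ) ∧ SqHit x h u) :
    (S.card : ℝ) ≤ (x + h) / w ^ 2 := by
  have : ∀ u : ℕ, ∃ m : ℕ, u ∈ S → 1 ≤ m ∧ x < (m : ℝ) * (u : ℝ) ^ 2 ∧
      (m : ℝ) * (u : ℝ) ^ 2 ≤ x + h := by
    intro u
    by_cases hu : u ∈ S
    · obtain ⟨h1, m, h2, h3⟩ := hS u hu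
      have hm : (0 : ℝ) < m := by
        by_contra hc
        push Not at hc
        nlinarith [sq_nonneg (u : ℝ)]
      have hm' : 0 < m := by exact_mod_cast hm
      lift m to ℕ using hm'.le
      refine ⟨m, fun _ => ⟨by omega, ?_, ?_⟩⟩
      · exact_mod_cast h2
      · exact_mod_cast h3
    · exact ⟨0, fun h => absurd h hu⟩
  choose m hm using this
  have hinj : ∀ u ∈ S, ∀ v ∈ S, u < v → m u ≠ m v := by
    intro u hu v hv huv he
    obtain ⟨a1, a2, a3⟩ := hm u hu
    obtain ⟨b1, b2, b3⟩ := hm v hv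
    rw [← he] at b2 b3
    have hv' : (u : ℝ) + 1 ≤ v := by exact_mod_cast huv
    have hm1 : (1 : ℝ) ≤ m u := by exact_mod_cast a1
    have hu0 : (0 : ℝ) < u := hw.trans_le (hS u hu).1
    generalize (m u : ℝ) = m at *
    generalize (u : ℝ) = u at *
    generalize (v : ℝ) = v at *
    have h1 : (u + 1) ^ 2 ≤ v ^ 2 := by gcongr
    have h2 : m * (2 * u) ≤ h := by nlinarith
    have h3 : (m * (2 * u)) ^ 2 ≤ h ^ 2 := by gcongr
    have h4 : m * u ^ 2 ≤ m * (m * u ^ 2) := by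
      have : 0 < m * u ^ 2 := by positivity
      nlinarith
    nlinarith
  have hcard : S.card ≤ (Finset.Icc 1 ⌊(x + h) / w ^ 2⌋₊).card := by
    apply Finset.card_le_card_of_injOn m
    · intro u hu
      obtain ⟨a1, a2, a3⟩ := hm u hu
      simp only [Finset.coe_Icc, Set.mem_Icc]
      refine ⟨a1, Nat.le_floor ?_⟩
      rw [le_div_iff₀ (by positivity)]
      refine le_trans ?_ a3
      have := (hS u hu).1
      gcongr
    · intro u hu v hv he
      by_contra hne
      rcases lt_or_gt_of_ne hne with h1 | h1
      · exact hinj u hu v hv h1 he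
      · exact hinj v hv u hu h1 he.symm
  rw [Nat.card_Icc, Nat.add_sub_cancel] at hcard
  calc (S.card : ℝ) ≤ (⌊(x + h) / w ^ 2⌋₊ : ℝ) := by exact_mod_cast hcard
    _ ≤ _ := Nat.floor_le (by positivity)

lemma stepG {t : ℝ} (ht : 0 < t) :
    0.26 * min t (1 / t) ≤ 22 * ((127 / 125 : ℝ) ^ 3 * t / (1 + (127 / 125 : ℝ) ^ 3 * t) - t / (1 + t)) := by
  have e : (127 / 125 : ℝ) ^ 3 * t / (1 + (127 / 125 : ℝ) ^ 3 * t) - t / (1 + t) =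
    (((127 / 125 : ℝ) ^ 3 - 1) * t) / ((1 + (127 / 125 : ℝ) ^ 3 * t) * (1 + t)) := by
    field_simp; ring
  rw [e, mul_div_assoc', le_div_iff₀ (by positivity)]
  rcases le_total t 1 with h | h
  · have : min t (1 / t) ≤ t := min_le_left _ _
    calc 0.26 * min t (1 / t) * ((1 + (127 / 125 : ℝ) ^ 3 * t) * (1 + t))
        ≤ 0.26 * t * ((1 + (127 / 125 : ℝ) ^ 3 * 1) * (1 + 1)) := by gcongr
      _ ≤ _ := by norm_num; linarith
  · have : min t (1 / t) ≤ 1 / t := min_le_right _ _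
    calc 0.26 * min t (1 / t) * ((1 + (127 / 125 : ℝ) ^ 3 * t) * (1 + t))
        ≤ 0.26 * (1 / t) * ((1 * t + (127 / 125 : ℝ) ^ 3 * t) * (1 * t + t)) := by
          gcongr <;> linarith
      _ = 0.26 * 2 * (1 + (127 / 125 : ℝ) ^ 3) * t := by field_simp; ring
      _ ≤ _ := by norm_num; linarith

lemma pieces_sum {V M r0 : ℝ} (H : Finset ℕ) (hV : 0 < V) (hM : 2 ≤ M) (hr : 0 < r0)
    (hMV : 144 * M ^ 6 ≤ V ^ 3) (hL : 500000 ≤ M ^ 18) (hy : (M ^ 18) ^ 2 / 500 ≤ r0 ^ 6)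
    (hmem : ∀ u ∈ H, r0 ^ 6 * V ^ 9 ≤ (u : ℝ)) (hodd : ∀ u ∈ H, u % 2 = 1)
    (hhit : ∀ u ∈ H, SqHit ((V ^ 9) ^ 5) (V ^ 9 * M ^ 18) u) (n : ℕ)
    (hn : ∀ k < n, M ^ 18 * ((r0 * (127 / 125) ^ k) ^ 6) ^ 2 ≤ 8 * (V ^ 9) ^ 2) :
    ((H.filter (fun u : ℕ => (u : ℝ) < (r0 * (127 / 125) ^ n) ^ 6 * V ^ 9)).card : ℝ) ≤
      n * (0.1652 * V ^ 9 + 3) +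
      78.8 * (V ^ 9 * M ^ 18) * (1 / r0 ^ 2 - 1 / (r0 * (127 / 125) ^ n) ^ 2) +
      22 * (M ^ 8 * V ^ 9) *
        ((r0 * (127 / 125) ^ n / V) ^ 3 / (1 + (r0 * (127 / 125) ^ n / V) ^ 3)) +
      7.8 * (r0 * (127 / 125) ^ n) ^ 6 := by
  classical
  have hM0 : 0 < M := by linarith
  induction n with
  | zero =>
    have : H.filter (fun u : ℕ => (u : ℝ) < (r0 * (127 / 125) ^ 0) ^ 6 * V ^ 9) = ∅ := by
      apply Finset.filter_eq_empty_iff.2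
      intro u hu
      have := hmem u hu
      simp only [pow_zero, mul_one]
      linarith
    rw [this]
    simp only [Finset.card_empty, Nat.cast_zero, pow_zero, mul_one, sub_self]
    positivity
  | succ n ih =>
    have ih' := ih (fun k hk => hn k (by omega))
    have hnn := hn n (by omega)
    have er : r0 * (127 / 125) ^ (n + 1) = (127 / 125) * (r0 * (127 / 125) ^ n) := by ring
    have hr1 : r0 ≤ r0 * (127 / 125) ^ n := by
      have : (1 : ℝ) ≤ (127 / 125) ^ n := one_le_pow₀ (by norm_num)
      nlinarith
    rw [er]
    set r := r0 * (127 / 125) ^ n with hrdef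
    have hr0 : 0 < r := by positivity
    have P : SqPiece (V ^ 9) (M ^ 18) (r ^ 6) (11 / 10)
        (H.filter (fun u : ℕ => r ^ 6 * V ^ 9 ≤ (u : ℝ) ∧ (u : ℝ) < (127 / 125 * r) ^ 6 * V ^ 9)) := by
      refine ⟨by positivity, hL, hy.trans (by gcongr), hnn, by norm_num, le_rfl, ?_, ?_, ?_⟩
      · intro u hu
        simp only [Finset.mem_filter] at hu
        refine ⟨hu.2.1, hu.2.2.le.trans ?_⟩
        have : (127 / 125 * r) ^ 6 * V ^ 9 = (127 / 125) ^ 6 * (r ^ 6 * V ^ 9) := by ring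
        rw [this]
        gcongr
        norm_num
      · intro u hu
        exact hodd u (Finset.mem_filter.1 hu).1
      · intro u hu
        exact hhit u (Finset.mem_filter.1 hu).1
    have hc := P.count hV hM hr0 hMV
    have hsub : (H.filter (fun u : ℕ => (u : ℝ) < (127 / 125 * r) ^ 6 * V ^ 9)) ⊆
        (H.filter (fun u : ℕ => (u : ℝ) < r ^ 6 * V ^ 9)) ∪
        (H.filter (fun u : ℕ => r ^ 6 * V ^ 9 ≤ (u : ℝ) ∧ (u : ℝ) < (127 / 125 * r) ^ 6 * V ^ 9)) := by
      intro u hu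
      simp only [Finset.mem_union, Finset.mem_filter] at hu ⊢
      rcases lt_or_ge (u : ℝ) (r ^ 6 * V ^ 9) with h | h
      · left; exact ⟨hu.1, h⟩
      · right; exact ⟨hu.1, h, hu.2⟩
    have hle := (Finset.card_le_card hsub).trans (Finset.card_union_le _ _)
    have hle' : ((H.filter (fun u : ℕ => (u : ℝ) < (127 / 125 * r) ^ 6 * V ^ 9)).card : ℝ) ≤
      (H.filter (fun u : ℕ => (u : ℝ) < r ^ 6 * V ^ 9)).card +
      (H.filter (fun u : ℕ => r ^ 6 * V ^ 9 ≤ (u : ℝ) ∧ (u : ℝ) < (127 / 125 * r) ^ 6 * V ^ 9)).card := by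
      exact_mod_cast hle
    have s1 : 2.462 * (V ^ 9 * M ^ 18 / r ^ 2) ≤
        78.8 * (V ^ 9 * M ^ 18) * (1 / r ^ 2 - 1 / (127 / 125 * r) ^ 2) := by
      have e : 78.8 * (V ^ 9 * M ^ 18) * (1 / r ^ 2 - 1 / (127 / 125 * r) ^ 2) =
        (78.8 * (1 - (125 / 127) ^ 2)) * (V ^ 9 * M ^ 18 / r ^ 2) := by field_simp
      rw [e]
      gcongr
      norm_num
    have s2 : 0.26 * (M ^ 8 * V ^ 9) * min ((r / V) ^ 3) ((V / r) ^ 3) ≤ 22 * (M ^ 8 * V ^ 9) *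
        ((127 / 125 * r / V) ^ 3 / (1 + (127 / 125 * r / V) ^ 3) - (r / V) ^ 3 / (1 + (r / V) ^ 3)) := by
      have := stepG (t := (r / V) ^ 3) (by positivity)
      have e1 : (127 / 125 * r / V) ^ 3 = (127 / 125) ^ 3 * (r / V) ^ 3 := by ring
      have e2 : (V / r) ^ 3 = 1 / (r / V) ^ 3 := by field_simp
      rw [e1, e2]
      have := mul_le_mul_of_nonneg_left this (by positivity : 0 ≤ M ^ 8 * V ^ 9)
      linarith
    have s3 : 0.76 * r ^ 6 ≤ 7.8 * (127 / 125 * r) ^ 6 - 7.8 * r ^ 6 := by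
      have e : (127 / 125 * r) ^ 6 = (127 / 125) ^ 6 * r ^ 6 := by ring
      have : 0 < r ^ 6 := by positivity
      rw [e]
      norm_num
      linarith
    push_cast
    linarith


lemma exp_big {L : ℝ} (hL : 500000 ≤ L) : L ^ 5 ≤ Real.exp (L / 5) := by
  have h1 : L / 50 ≤ Real.exp (L / 50) := by linarith [Real.add_one_le_exp (L / 50)]
  have h2 : (L / 50) ^ 10 ≤ Real.exp (L / 50) ^ 10 := by
    have : 0 ≤ L / 50 := by linarith
    gcongr
  have e : Real.exp (L / 50) ^ 10 = Real.exp (L / 5) := by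
    rw [← Real.exp_nat_mul]; congr 1; push_cast; ring
  rw [e] at h2
  refine le_trans ?_ h2
  have e2 : (L / 50) ^ 10 = L ^ 5 * (L / 2500) ^ 5 := by ring
  have h3 : (1 : ℝ) ≤ (L / 2500) ^ 5 := one_le_pow₀ (by linarith)
  rw [e2]
  have : 0 ≤ L ^ 5 := by positivity
  nlinarith

lemma aux_a1 {L : ℝ} (hL : 500000 ≤ L) : 500000000 ≤ L ^ 2 / 500 := by nlinarith

lemma aux_a2 {L : ℝ} (hL : 500000 ≤ L) : 1000 * L ≤ L ^ 2 / 500 := by nlinarith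

lemma aux_a3 {L : ℝ} (hL : 500000 ≤ L) : 8 ≤ L * (L ^ 2 / 500) ^ 2 := by
  have a2 : (1 : ℝ) ≤ (L ^ 2 / 500) ^ 2 := one_le_pow₀ (by linarith [aux_a1 hL])
  nlinarith

lemma aux_m {a b c : ℝ} (ha : 0 ≤ a) (hb : 1 ≤ b) (h : b * a ≤ c) : a ≤ c := by nlinarith

lemma aux_m' {a b : ℝ} (ha : 0 ≤ a) (hb : 1 ≤ b) : a ≤ b * a := by nlinarith

lemma aux_8 {b a c : ℝ} (ha : 0 ≤ a) (hb : 8 ≤ b) (h : b * a ≤ 8 * c) : a ≤ c := by nlinarith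

lemma aux_97 {b a c : ℝ} (ha : 0 ≤ a) (hb : 500000 ≤ b) (h : b * a ≤ 9.7 * c) : a ≤ c := by
  norm_num at h
  nlinarith

set_option maxHeartbeats 4000000 in
lemma H_count {V M r0 : ℝ} (H : Finset ℕ) (hV : 0 < V) (hM : 0 < M) (hr : 0 < r0)
    (hL : 500000 ≤ M ^ 18) (hX : V ^ 9 = Real.exp (M ^ 18 / 5))
    (hy : r0 ^ 6 = (M ^ 18) ^ 2 / 500)
    (hmem : ∀ u ∈ H, r0 ^ 6 * V ^ 9 ≤ (u : ℝ)) (hodd : ∀ u ∈ H, u % 2 = 1)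
    (hhit : ∀ u ∈ H, SqHit ((V ^ 9) ^ 5) (V ^ 9 * M ^ 18) u) :
    (H.card : ℝ) ≤ 0.481 * (V ^ 9 * M ^ 18) := by
  classical
  have hM2 : 2 ≤ M := by
    refine le_of_pow_le_pow_left₀ (n := 18) (by norm_num) hM.le ?_
    norm_num; linarith
  have hXL : (M ^ 18) ^ 5 ≤ V ^ 9 := by rw [hX]; exact exp_big hL
  have hX1 : 60000000000000000000000 * M ^ 18 ≤ V ^ 9 := by
    have : (500000 : ℝ) ^ 4 ≤ (M ^ 18) ^ 4 := by gcongr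
    have h2 : (M ^ 18) ^ 4 * M ^ 18 ≤ V ^ 9 := by
      calc _ = (M ^ 18) ^ 5 := by ring
        _ ≤ _ := hXL
    refine le_trans (mul_le_mul_of_nonneg_right ?_ (by positivity)) h2
    exact le_trans (by norm_num) this
  have hMV : 144 * M ^ 6 ≤ V ^ 3 := by
    refine le_of_pow_le_pow_left₀ (n := 3) (by norm_num) (by positivity) ?_
    have : (144 * M ^ 6) ^ 3 = 144 ^ 3 * M ^ 18 := by ring
    rw [this, ← pow_mul]
    norm_num
    linarith
  have hex : ∃ n : ℕ, 8 * (V ^ 9) ^ 2 ≤ M ^ 18 * ((r0 * (127 / 125) ^ n) ^ 6) ^ 2 := by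
    obtain ⟨n, hn⟩ := pow_unbounded_of_one_lt (8 * (V ^ 9) ^ 2) (show (1 : ℝ) < (127 / 125) ^ 12 by norm_num)
    refine ⟨n, hn.le.trans ?_⟩
    have e : M ^ 18 * ((r0 * (127 / 125) ^ n) ^ 6) ^ 2 = M ^ 18 * (r0 ^ 6) ^ 2 * ((127 / 125) ^ 12) ^ n := by
      rw [← pow_mul (127 / 125 : ℝ) 12 n, mul_comm 12 n, pow_mul]; ring
    rw [e, hy]
    have a3 := aux_a3 hL
    exact aux_m' (by positivity) (by linarith)
  set n := Nat.find hex with hn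
  have hn1 := Nat.find_spec hex
  have hn2 : ∀ k < n, M ^ 18 * ((r0 * (127 / 125) ^ k) ^ 6) ^ 2 ≤ 8 * (V ^ 9) ^ 2 := by
    intro k hk
    have := Nat.find_min hex hk
    linarith
  rw [← hn] at hn1
  have hn0 : 0 < n := by
    rcases Nat.eq_zero_or_pos n with h | h
    · exfalso
      rw [h, pow_zero, mul_one, hy] at hn1
      have a : (M ^ 18) * (((M ^ 18) ^ 2 / 500) ^ 2) ≤ (M ^ 18) ^ 5 := by
        have : 0 < (M ^ 18) ^ 5 := by positivity
        have e : (M ^ 18) * (((M ^ 18) ^ 2 / 500) ^ 2) = (M ^ 18) ^ 5 / 250000 := by ring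
        rw [e]; linarith
      have b : 1 ≤ V ^ 9 := by linarith
      have c : V ^ 9 ≤ V ^ 9 * V ^ 9 := aux_m' (by positivity) b
      have d : 0 < V ^ 9 * V ^ 9 := by positivity
      rw [pow_two (V ^ 9)] at hn1
      linarith
    · exact h
  obtain ⟨k, hk⟩ : ∃ k, n = k + 1 := ⟨n - 1, by omega⟩
  have hkk := hn2 k (by omega)
  have hnL : (n : ℝ) ≤ 127 / 60 * M ^ 18 + 1 := by
    have h1 : (((127 / 125 : ℝ) ^ k) ^ 6) ^ 2 ≤ (V ^ 9) ^ 2 := by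
      have e : M ^ 18 * ((r0 * (127 / 125) ^ k) ^ 6) ^ 2 =
        (M ^ 18 * (r0 ^ 6) ^ 2) * (((127 / 125 : ℝ) ^ k) ^ 6) ^ 2 := by ring
      rw [e, hy] at hkk
      exact aux_8 (by positivity) (aux_a3 hL) hkk
    have h2 : ((127 / 125 : ℝ) ^ k) ^ 6 ≤ V ^ 9 :=
      le_of_pow_le_pow_left₀ (n := 2) (by norm_num) (by positivity) h1
    have h3 := Real.log_le_log (by positivity) h2
    rw [hX, Real.log_exp, Real.log_pow, Real.log_pow] at h3
    have h4 := Real.one_sub_inv_le_log_of_pos (show (0 : ℝ) < 127 / 125 by norm_num)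
    norm_num at h4
    push_cast at h3
    have hk0 : (0 : ℝ) ≤ k := by positivity
    have h5 := mul_le_mul_of_nonneg_left h4 hk0
    rw [hk]; push_cast
    linarith
  have hsum := pieces_sum H hV hM2 hr hMV hL hy.ge hmem hodd hhit n hn2
  have hrn : r0 * (127 / 125) ^ n = (127 / 125) * (r0 * (127 / 125) ^ k) := by rw [hk]; ring
  have hr1 : r0 ≤ r0 * (127 / 125) ^ n := by
    have : (1 : ℝ) ≤ (127 / 125) ^ n := one_le_pow₀ (by norm_num)
    exact le_mul_of_one_le_right hr.le this
  have hup : M ^ 18 * ((r0 * (127 / 125) ^ n) ^ 6) ^ 2 ≤ 9.7 * (V ^ 9) ^ 2 := by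
    rw [hrn]
    have e : M ^ 18 * ((127 / 125 * (r0 * (127 / 125) ^ k)) ^ 6) ^ 2 =
      (127 / 125) ^ 12 * (M ^ 18 * ((r0 * (127 / 125) ^ k) ^ 6) ^ 2) := by ring
    rw [e]
    have : (127 / 125 : ℝ) ^ 12 * (M ^ 18 * ((r0 * (127 / 125) ^ k) ^ 6) ^ 2) ≤
      (127 / 125 : ℝ) ^ 12 * (8 * (V ^ 9) ^ 2) := by gcongr
    refine this.trans ?_
    have : 0 < (V ^ 9) ^ 2 := by positivity
    linarith
  clear hkk hn2 hrn
  set r := r0 * (127 / 125) ^ n with hrdef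
  have hrpos : 0 < r := by positivity
  have hr6 : 1000 * M ^ 18 ≤ r ^ 6 := by
    have : r0 ^ 6 ≤ r ^ 6 := by gcongr
    rw [hy] at this
    exact (aux_a2 hL).trans this
  -- lossy pieces
  have hlow : V ^ 9 ≤ r ^ 6 * M ^ 9 := by
    refine le_of_pow_le_pow_left₀ (n := 2) (by norm_num) (by positivity) ?_
    have : 0 < (V ^ 9) ^ 2 := by positivity
    have e : (r ^ 6 * M ^ 9) ^ 2 = M ^ 18 * (r ^ 6) ^ 2 := by ring
    rw [e]; linarith
  have c1 := lossy_count (H.filter (fun u : ℕ => r ^ 6 * V ^ 9 ≤ (u : ℝ) ∧ (u : ℝ) ≤ 2 * (r ^ 6 * V ^ 9)))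
    hV hM hrpos (by
      have : 0 < (V ^ 9) ^ 2 := by positivity
      calc M ^ 18 * r ^ 12 = M ^ 18 * (r ^ 6) ^ 2 := by ring
        _ ≤ 9.7 * (V ^ 9) ^ 2 := hup
        _ ≤ 40 * (V ^ 9) ^ 2 := by gcongr; norm_num
        _ = _ := by ring) hr6 hlow (fun u hu => (Finset.mem_filter.1 hu).2)
    (fun u hu => hhit u (Finset.mem_filter.1 hu).1)
  obtain ⟨q, hq0, hq⟩ : ∃ q : ℝ, 0 < q ∧ q ^ 6 = 2 := by
    refine ⟨(2 : ℝ) ^ (1 / 6 : ℝ), by positivity, ?_⟩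
    rw [← Real.rpow_natCast, ← Real.rpow_mul (by norm_num)]; norm_num
  have eq6 : (q * r) ^ 6 = 2 * r ^ 6 := by rw [mul_pow, hq]
  have c2 := lossy_count (r := q * r)
    (H.filter (fun u : ℕ => (q * r) ^ 6 * V ^ 9 ≤ (u : ℝ) ∧ (u : ℝ) ≤ 2 * ((q * r) ^ 6 * V ^ 9)))
    hV hM (by positivity) (by
      have : 0 < (V ^ 9) ^ 2 := by positivity
      calc M ^ 18 * (q * r) ^ 12 = M ^ 18 * ((q * r) ^ 6) ^ 2 := by ring
        _ = 4 * (M ^ 18 * (r ^ 6) ^ 2) := by rw [eq6]; ring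
        _ ≤ 4 * (9.7 * (V ^ 9) ^ 2) := by gcongr
        _ ≤ 40 * (V ^ 9) ^ 2 := by linarith
        _ = _ := by ring)
    (by rw [eq6]; have : 0 < r ^ 6 := by positivity
        linarith)
    (by rw [eq6]; have : 0 < r ^ 6 * M ^ 9 := by positivity
        linarith) (fun u hu => (Finset.mem_filter.1 hu).2)
    (fun u hu => hhit u (Finset.mem_filter.1 hu).1)
  rw [eq6] at c2
  have c3 := top_count (x := (V ^ 9) ^ 5) (h := V ^ 9 * M ^ 18) (w := 4 * (r ^ 6 * V ^ 9))
    (H.filter (fun u : ℕ => 4 * (r ^ 6 * V ^ 9) ≤ (u : ℝ))) (by positivity) (by positivity)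
    (by
      have a : 1 ≤ V ^ 9 := by linarith
      have b : M ^ 18 ≤ V ^ 9 := by linarith
      calc (V ^ 9 * M ^ 18) ^ 2 ≤ (V ^ 9 * V ^ 9) ^ 2 := by gcongr
        _ = (V ^ 9) ^ 4 := by ring
        _ ≤ (V ^ 9) ^ 5 := pow_le_pow_right₀ a (by norm_num)
        _ ≤ _ := by have : 0 < (V ^ 9) ^ 5 := by positivity
                    linarith) (by positivity)
    (fun u hu => ⟨(Finset.mem_filter.1 hu).2, hhit u (Finset.mem_filter.1 hu).1⟩)
  have hsub : H ⊆ H.filter (fun u : ℕ => (u : ℝ) < r ^ 6 * V ^ 9) ∪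
      (H.filter (fun u : ℕ => r ^ 6 * V ^ 9 ≤ (u : ℝ) ∧ (u : ℝ) ≤ 2 * (r ^ 6 * V ^ 9)) ∪
      (H.filter (fun u : ℕ => 2 * r ^ 6 * V ^ 9 ≤ (u : ℝ) ∧ (u : ℝ) ≤ 2 * (2 * r ^ 6 * V ^ 9)) ∪
      H.filter (fun u : ℕ => 4 * (r ^ 6 * V ^ 9) ≤ (u : ℝ)))) := by
    intro u hu
    simp only [Finset.mem_union, Finset.mem_filter, hu, true_and]
    rcases lt_or_ge (u : ℝ) (r ^ 6 * V ^ 9) with h | h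
    · left; exact h
    · right
      rcases le_or_gt (u : ℝ) (2 * (r ^ 6 * V ^ 9)) with h1 | h1
      · left; exact ⟨h, h1⟩
      · right
        rcases le_or_gt (u : ℝ) (4 * (r ^ 6 * V ^ 9)) with h2 | h2
        · left; constructor <;> linarith
        · right; exact h2.le
  have hcard := Finset.card_le_card hsub
  have u1 := Finset.card_union_le (H.filter (fun u : ℕ => (u : ℝ) < r ^ 6 * V ^ 9))
      (H.filter (fun u : ℕ => r ^ 6 * V ^ 9 ≤ (u : ℝ) ∧ (u : ℝ) ≤ 2 * (r ^ 6 * V ^ 9)) ∪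
      (H.filter (fun u : ℕ => 2 * r ^ 6 * V ^ 9 ≤ (u : ℝ) ∧ (u : ℝ) ≤ 2 * (2 * r ^ 6 * V ^ 9)) ∪
      H.filter (fun u : ℕ => 4 * (r ^ 6 * V ^ 9) ≤ (u : ℝ))))
  have u2 := Finset.card_union_le 
      (H.filter (fun u : ℕ => r ^ 6 * V ^ 9 ≤ (u : ℝ) ∧ (u : ℝ) ≤ 2 * (r ^ 6 * V ^ 9)))
      (H.filter (fun u : ℕ => 2 * r ^ 6 * V ^ 9 ≤ (u : ℝ) ∧ (u : ℝ) ≤ 2 * (2 * r ^ 6 * V ^ 9)) ∪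
      H.filter (fun u : ℕ => 4 * (r ^ 6 * V ^ 9) ≤ (u : ℝ)))
  have u3 := Finset.card_union_le 
      (H.filter (fun u : ℕ => 2 * r ^ 6 * V ^ 9 ≤ (u : ℝ) ∧ (u : ℝ) ≤ 2 * (2 * r ^ 6 * V ^ 9)))
      (H.filter (fun u : ℕ => 4 * (r ^ 6 * V ^ 9) ≤ (u : ℝ)))
  have utot : (H.card : ℝ) ≤ (H.filter (fun u : ℕ => (u : ℝ) < r ^ 6 * V ^ 9)).card +
      ((H.filter (fun u : ℕ => r ^ 6 * V ^ 9 ≤ (u : ℝ) ∧ (u : ℝ) ≤ 2 * (r ^ 6 * V ^ 9))).card +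
      ((H.filter (fun u : ℕ => 2 * r ^ 6 * V ^ 9 ≤ (u : ℝ) ∧ (u : ℝ) ≤ 2 * (2 * r ^ 6 * V ^ 9))).card +
      (H.filter (fun u : ℕ => 4 * (r ^ 6 * V ^ 9) ≤ (u : ℝ))).card)) := by
    have := hcard.trans (u1.trans (Nat.add_le_add_left (u2.trans (Nat.add_le_add_left u3 _)) _))
    exact_mod_cast this
  -- numerical bounds
  have hh : 0 < V ^ 9 * M ^ 18 := by positivity
  have hXh : 500000 * V ^ 9 ≤ V ^ 9 * M ^ 18 := by
    rw [mul_comm (V ^ 9)]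
    exact mul_le_mul_of_nonneg_right hL (by positivity)
  have hLh : 1000000 * M ^ 18 ≤ V ^ 9 * M ^ 18 := by
    have : (1000000 : ℝ) ≤ V ^ 9 := by linarith
    exact mul_le_mul_of_nonneg_right this (by positivity)
  have hh1 : 100000000000 ≤ V ^ 9 * M ^ 18 := by linarith
  have nA : (n : ℝ) * (0.1652 * V ^ 9 + 3) ≤ 0.3498 * (V ^ 9 * M ^ 18) := by
    calc (n : ℝ) * (0.1652 * V ^ 9 + 3) ≤ (127 / 60 * M ^ 18 + 1) * (0.1652 * V ^ 9 + 3) := by gcongr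
      _ = (127 / 60 * 0.1652) * (V ^ 9 * M ^ 18) + 127 / 20 * M ^ 18 + 0.1652 * V ^ 9 + 3 := by ring
      _ ≤ _ := by
        linarith
  have nB : 78.8 * (V ^ 9 * M ^ 18) * (1 / r0 ^ 2 - 1 / r ^ 2) ≤ 0.0995 * (V ^ 9 * M ^ 18) := by
    have a1 : (793 : ℝ) ≤ r0 ^ 2 := by
      refine le_of_pow_le_pow_left₀ (n := 3) (by norm_num) (by positivity) ?_
      have : (r0 ^ 2) ^ 3 = r0 ^ 6 := by ring
      rw [this, hy]
      exact le_trans (by norm_num) (aux_a1 hL)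
    have a2 : 1 / r0 ^ 2 ≤ 1 / 793 := one_div_le_one_div_of_le (by norm_num) a1
    have a3 : 0 < 1 / r ^ 2 := by positivity
    have a4 : 1 / r0 ^ 2 - 1 / r ^ 2 ≤ 1 / 793 := by linarith
    calc 78.8 * (V ^ 9 * M ^ 18) * (1 / r0 ^ 2 - 1 / r ^ 2) ≤ 78.8 * (V ^ 9 * M ^ 18) * (1 / 793) := by gcongr
      _ = (78.8 / 793) * (V ^ 9 * M ^ 18) := by ring
      _ ≤ _ := by gcongr; norm_num
  have nC : 22 * (M ^ 8 * V ^ 9) * ((r / V) ^ 3 / (1 + (r / V) ^ 3)) ≤ 0.0158 * (V ^ 9 * M ^ 18) := by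
    have a1 : (r / V) ^ 3 / (1 + (r / V) ^ 3) ≤ 1 := by
      rw [div_le_one (by positivity)]; linarith
    have a2 : (1400 : ℝ) ≤ M ^ 10 := by
      refine le_of_pow_le_pow_left₀ (n := 9) (by norm_num) (by positivity) ?_
      have e : (M ^ 10) ^ 9 = (M ^ 18) ^ 5 := by ring
      rw [e]
      calc (1400 : ℝ) ^ 9 ≤ 500000 ^ 5 := by norm_num
        _ ≤ _ := by gcongr
    calc 22 * (M ^ 8 * V ^ 9) * ((r / V) ^ 3 / (1 + (r / V) ^ 3)) ≤ 22 * (M ^ 8 * V ^ 9) * 1 := by gcongr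
      _ = (22 / 1400) * (M ^ 8 * V ^ 9) * 1400 := by ring
      _ ≤ (22 / 1400) * (M ^ 8 * V ^ 9) * M ^ 10 := by gcongr
      _ = (22 / 1400) * (V ^ 9 * M ^ 18) := by ring
      _ ≤ _ := by gcongr; norm_num
  have nD : 7.8 * r ^ 6 ≤ 0.0001 * (V ^ 9 * M ^ 18) := by
    have a1 : r ^ 6 ≤ V ^ 9 := by
      refine le_of_pow_le_pow_left₀ (n := 2) (by norm_num) (by positivity) ?_
      exact aux_97 (by positivity) hL hup
    linarith
  have nE : 215 * (V ^ 9 * M ^ 3 + 1) ≤ 0.00385 * (V ^ 9 * M ^ 18) := by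
    have a2 : (56000 : ℝ) ≤ M ^ 15 := by
      refine le_of_pow_le_pow_left₀ (n := 6) (by norm_num) (by positivity) ?_
      have e : (M ^ 15) ^ 6 = (M ^ 18) ^ 5 := by ring
      rw [e]
      calc (56000 : ℝ) ^ 6 ≤ 500000 ^ 5 := by norm_num
        _ ≤ _ := by gcongr
    have a3 : V ^ 9 * M ^ 3 * 56000 ≤ V ^ 9 * M ^ 18 := by
      calc V ^ 9 * M ^ 3 * 56000 ≤ V ^ 9 * M ^ 3 * M ^ 15 := by gcongr
        _ = _ := by ring
    linarith
  have nF : ((V ^ 9) ^ 5 + V ^ 9 * M ^ 18) / (4 * (r ^ 6 * V ^ 9)) ^ 2 ≤ 0.0079 * (V ^ 9 * M ^ 18) := by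
    rw [div_le_iff₀ (by positivity)]
    have e : 0.0079 * (V ^ 9 * M ^ 18) * (4 * (r ^ 6 * V ^ 9)) ^ 2 =
      0.1264 * (V ^ 9) ^ 3 * (M ^ 18 * (r ^ 6) ^ 2) := by ring
    rw [e]
    have a1 : 0.1264 * (V ^ 9) ^ 3 * (8 * (V ^ 9) ^ 2) ≤ 0.1264 * (V ^ 9) ^ 3 * (M ^ 18 * (r ^ 6) ^ 2) := by
      gcongr
    refine le_trans ?_ a1
    have a : 1000 ≤ V ^ 9 := by linarith
    have b : M ^ 18 ≤ V ^ 9 := by linarith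
    have c : V ^ 9 * M ^ 18 ≤ 0.001 * (V ^ 9) ^ 5 := by
      calc V ^ 9 * M ^ 18 ≤ V ^ 9 * V ^ 9 := by gcongr
        _ = (V ^ 9) ^ 2 := by ring
        _ ≤ 0.001 * ((V ^ 9) ^ 2 * 1000) := by norm_num; linarith
        _ ≤ 0.001 * ((V ^ 9) ^ 2 * V ^ 9) := by gcongr
        _ = 0.001 * (V ^ 9) ^ 3 := by ring
        _ ≤ 0.001 * (V ^ 9) ^ 5 := by
          gcongr
          · linarith
          · norm_num
    have : 0 < (V ^ 9) ^ 5 := by positivity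
    have e2 : 0.1264 * (V ^ 9) ^ 3 * (8 * (V ^ 9) ^ 2) = 1.0112 * (V ^ 9) ^ 5 := by ring
    rw [e2]
    linarith
  have e1 := utot.trans (add_le_add hsum (add_le_add c1 (add_le_add c2 c3)))
  linarith


lemma ioc_dvd_card (a b d : ℕ) (hd : 0 < d) :
    ((Finset.Ioc a b).filter (fun n => d ∣ n)).card ≤ (b - a) / d + 1 := by
  have hcard : ((Finset.Ioc a b).filter (fun n => d ∣ n)).card ≤
      (Finset.Ioc (a / d) (b / d)).card := by
    apply Finset.card_le_card_of_injOn (fun n => n / d)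
    · intro n hn
      simp only [Finset.coe_filter, Finset.mem_Ioc, Set.mem_ofPred_eq] at hn
      obtain ⟨⟨h1, h2⟩, m, rfl⟩ := hn
      simp only [Finset.coe_Ioc, Set.mem_Ioc]
      refine ⟨?_, Nat.div_le_div_right h2⟩
      rw [Nat.mul_div_cancel_left _ hd, Nat.div_lt_iff_lt_mul hd, mul_comm]
      exact h1
    · intro n hn m hm h
      simp only [Finset.coe_filter, Set.mem_ofPred_eq] at hn hm
      obtain ⟨_, n', rfl⟩ := hn
      obtain ⟨_, m', rfl⟩ := hm
      simp only [Nat.mul_div_cancel_left _ hd] at h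
      rw [h]
  rw [Nat.card_Ioc] at hcard
  refine hcard.trans ?_
  rcases le_total b a with h | h
  · have := Nat.div_le_div_right (c := d) h
    generalize (b - a) / d = q at *
    omega
  · obtain ⟨k, rfl⟩ := Nat.exists_eq_add_of_le h
    rw [Nat.add_sub_cancel_left, Nat.add_div hd]
    generalize a / d = a' at *
    generalize k / d = k' at *
    split_ifs <;> omega

lemma sum_inv_sq_even (m : ℕ) : ∑ p ∈ (Finset.range (2 * (m + 8) + 1)).filter Nat.Prime, 1 / (p : ℝ) ^ 2 ≤
    0.43571 + 1 / 32 - 1 / (4 * ((m : ℝ) + 8)) := by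
  induction m with
  | zero =>
    have : (Finset.range (2 * (0 + 8) + 1)).filter Nat.Prime = {2, 3, 5, 7, 11, 13} := by decide
    rw [this]
    norm_num
  | succ m ih =>
    rw [show 2 * (m + 1 + 8) + 1 = (2 * (m + 8) + 1) + 1 + 1 by ring, Finset.range_add_one,
      Finset.filter_insert, if_neg, Finset.range_add_one, Finset.filter_insert]
    · have h2 : 1 / ((2 * (m + 8) + 1 : ℕ) : ℝ) ^ 2 ≤ 1 / (4 * ((m : ℝ) + 8)) - 1 / (4 * ((m + 1 : ℕ) + 8 : ℝ)) := by
        push_cast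
        have e : 1 / (4 * ((m : ℝ) + 8)) - 1 / (4 * ((m : ℝ) + 1 + 8)) = 1 / (4 * ((m : ℝ) + 8) * (m + 9)) := by
          field_simp; ring
        rw [e]
        apply one_div_le_one_div_of_le (by positivity)
        nlinarith
      have h0 : 0 ≤ 1 / ((2 * (m + 8) + 1 : ℕ) : ℝ) ^ 2 := by positivity
      split_ifs
      · rw [Finset.sum_insert (by simp)]
        linarith
      · linarith
    · intro hp
      rcases hp.eq_one_or_self_of_dvd 2 ⟨m + 9, by ring⟩ with h | h <;> omega

lemma sum_inv_sq (N : ℕ) : ∑ p ∈ (Finset.range (N + 1)).filter Nat.Prime, 1 / (p : ℝ) ^ 2 ≤ 0.46696 := by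
  have h := sum_inv_sq_even N
  have h1 : ∑ p ∈ (Finset.range (N + 1)).filter Nat.Prime, 1 / (p : ℝ) ^ 2 ≤
    ∑ p ∈ (Finset.range (2 * (N + 8) + 1)).filter Nat.Prime, 1 / (p : ℝ) ^ 2 := by
    apply Finset.sum_le_sum_of_subset_of_nonneg
    · apply Finset.filter_subset_filter
      apply Finset.range_mono; omega
    · intros; positivity
  have : 0 < 1 / (4 * ((N : ℝ) + 8)) := by positivity
  linarith

lemma pi_bound {X L : ℝ} (hL : 500000 ≤ L) (hX : X = Real.exp (L / 5)) :
    (((Finset.range (⌊L ^ 2 / 500 * X⌋₊ + 1)).filter Nat.Prime).card : ℝ) ≤ 0.0279 * (X * L) := by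
  have hX0 : 0 < X := by rw [hX]; positivity
  have hy := aux_a1 hL
  have hz1 : X ≤ L ^ 2 / 500 * X := aux_m' hX0.le (by linarith)
  have hXL : L ^ 5 ≤ X := by rw [hX]; exact exp_big hL
  have hX6 : (1000000 : ℝ) ^ 2 ≤ X := by
    refine le_trans ?_ hXL
    calc (1000000 : ℝ) ^ 2 ≤ 500000 ^ 5 := by norm_num
      _ ≤ _ := by gcongr
  have h := Chebyshev.pi_le_log4_mul_div (x := L ^ 2 / 500 * X) (by linarith)
  have e : (((Finset.range (⌊L ^ 2 / 500 * X⌋₊ + 1)).filter Nat.Prime).card) =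
    Nat.primeCounting ⌊L ^ 2 / 500 * X⌋₊ := by
    rw [Nat.primeCounting, Nat.primeCounting', Nat.count_eq_card_filter_range]
  rw [e]
  refine h.trans ?_
  have l1 : L / 10 ≤ Real.log √(L ^ 2 / 500 * X) := by
    rw [Real.log_sqrt (by positivity)]
    have : Real.log X ≤ Real.log (L ^ 2 / 500 * X) := Real.log_le_log hX0 hz1
    rw [hX, Real.log_exp, ← hX] at this
    linarith
  have l2 : Real.log 4 ≤ 1.38630 := by
    have : Real.log 4 = 2 * Real.log 2 := by
      rw [show (4 : ℝ) = 2 ^ 2 by norm_num, Real.log_pow]; norm_num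
    rw [this]
    linarith [Real.log_two_lt_d9]
  have b1 : Real.log 4 * (L ^ 2 / 500 * X) / Real.log √(L ^ 2 / 500 * X) ≤ 0.0278 * (X * L) := by
    calc Real.log 4 * (L ^ 2 / 500 * X) / Real.log √(L ^ 2 / 500 * X)
        ≤ 1.38630 * (L ^ 2 / 500 * X) / (L / 10) := by gcongr
      _ = (1.38630 / 50) * (X * L) := by field_simp; ring
      _ ≤ _ := by gcongr; norm_num
  have b2 : √(L ^ 2 / 500 * X) ≤ 0.0001 * (X * L) := by
    apply Real.sqrt_le_iff.2
    refine ⟨by positivity, ?_⟩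
    calc L ^ 2 / 500 * X = 1 / 500 * (L ^ 2 * X) * 1 := by ring
      _ ≤ 1 / 500 * (L ^ 2 * X) * (500 * 0.0001 ^ 2 * X) := by
        gcongr; norm_num at *; linarith
      _ = _ := by ring
  norm_num at *
  linarith


lemma final_count {X L : ℝ} (hL : 500000 ≤ L) (hX : X = Real.exp (L / 5)) :
    ∃ n : ℕ, 0 < n ∧ X ^ 5 < (n : ℝ) ∧ (n : ℝ) ≤ X ^ 5 + X * L ∧ Squarefree n := by
  classical
  have hX0 : 0 < X := by rw [hX]; positivity
  have hL0 : 0 < L := by linarith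
  obtain ⟨V, hV, hVX⟩ : ∃ V : ℝ, 0 < V ∧ V ^ 9 = X := by
    refine ⟨Real.exp (L / 45), by positivity, ?_⟩
    rw [← Real.exp_nat_mul, hX]; congr 1; push_cast; ring
  obtain ⟨M, hM, hML⟩ : ∃ M : ℝ, 0 < M ∧ M ^ 18 = L := by
    refine ⟨L ^ (1 / 18 : ℝ), by positivity, ?_⟩
    rw [← Real.rpow_natCast, ← Real.rpow_mul hL0.le]; norm_num
  obtain ⟨r0, hr0, hry⟩ : ∃ r0 : ℝ, 0 < r0 ∧ r0 ^ 6 = L ^ 2 / 500 := by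
    refine ⟨(L ^ 2 / 500) ^ (1 / 6 : ℝ), by positivity, ?_⟩
    rw [← Real.rpow_natCast, ← Real.rpow_mul (by positivity)]; norm_num
  have hXL : L ^ 5 ≤ X := by rw [hX]; exact exp_big hL
  have hX6 : (1000000 : ℝ) ≤ X := by
    refine le_trans ?_ hXL
    calc (1000000 : ℝ) ≤ 500000 ^ 5 := by norm_num
      _ ≤ _ := by gcongr
  set h := X * L with hh
  have hh1 : 1000000 * 500000 ≤ h := by rw [hh]; gcongr
  set a := ⌊X ^ 5⌋₊ with ha
  set b := ⌊X ^ 5 + h⌋₊ with hb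
  have ha1 : (a : ℝ) ≤ X ^ 5 := Nat.floor_le (by positivity)
  have ha2 : X ^ 5 < a + 1 := Nat.lt_floor_add_one _
  have hb1 : (b : ℝ) ≤ X ^ 5 + h := Nat.floor_le (by positivity)
  have hb2 : X ^ 5 + h < b + 1 := Nat.lt_floor_add_one _
  have hab : a ≤ b := Nat.floor_mono (by linarith)
  have hba : ((b - a : ℕ) : ℝ) = b - a := Nat.cast_sub hab
  have hI : ∀ n ∈ Finset.Ioc a b, X ^ 5 < (n : ℝ) ∧ (n : ℝ) ≤ X ^ 5 + h := by
    intro n hn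
    rw [Finset.mem_Ioc] at hn
    exact ⟨Nat.lt_of_floor_lt hn.1, (Nat.le_floor_iff (by positivity)).1 hn.2⟩
  by_contra hcon
  push Not at hcon
  have hns : ∀ n ∈ Finset.Ioc a b, ¬ Squarefree n := by
    intro n hn
    have := hI n hn
    exact hcon n (by rw [Finset.mem_Ioc] at hn; omega) this.1 this.2
  set N0 := ⌊L ^ 2 / 500 * X⌋₊ with hN0
  set P0 := (Finset.range (N0 + 1)).filter Nat.Prime with hP0
  set H := (Finset.range (b + 1)).filter (fun p => p.Prime ∧ N0 < p ∧ SqHit (X ^ 5) h p) with hH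
  have hHz : ∀ p ∈ H, L ^ 2 / 500 * X ≤ (p : ℝ) := by
    intro p hp
    rw [hH, Finset.mem_filter] at hp
    exact (Nat.lt_of_floor_lt hp.2.2.1).le
  have hyL := aux_a1 hL
  have hyL2 := aux_a2 hL
  have hHc : (H.card : ℝ) ≤ 0.481 * h := by
    have := H_count H hV hM hr0 (by rw [hML]; exact hL) (by rw [hVX, hML]; exact hX)
      (by rw [hML]; exact hry)
      (by rw [hry, hVX]; exact hHz)
      (by
        intro u hu
        have h1 := hHz u hu
        rw [hH, Finset.mem_filter] at hu
        rcases hu.2.1.eq_two_or_odd with h2 | h2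
        · exfalso
          have h3 : X ≤ L ^ 2 / 500 * X := aux_m' hX0.le (by linarith)
          rw [h2] at h1
          push_cast at h1
          linarith
        · exact h2)
      (by
        intro u hu
        rw [hH, Finset.mem_filter] at hu
        rw [hVX, hML]
        exact hu.2.2.2)
    rwa [hVX, hML] at this
  have hcover : Finset.Ioc a b ⊆
      P0.biUnion (fun p => (Finset.Ioc a b).filter (fun n => p ^ 2 ∣ n)) ∪
      H.biUnion (fun p => (Finset.Ioc a b).filter (fun n => p ^ 2 ∣ n)) := by
    intro n hn
    have h1 := hns n hn
    rw [Nat.squarefree_iff_prime_squarefree] at h1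
    push Not at h1
    obtain ⟨p, hp, hpn⟩ := h1
    rw [← pow_two] at hpn
    simp only [Finset.mem_union, Finset.mem_biUnion, Finset.mem_filter]
    rcases le_or_gt p N0 with h2 | h2
    · left
      exact ⟨p, by rw [hP0, Finset.mem_filter, Finset.mem_range]; exact ⟨by omega, hp⟩, hn, hpn⟩
    · right
      refine ⟨p, ?_, hn, hpn⟩
      rw [hH, Finset.mem_filter, Finset.mem_range]
      have hnb := (Finset.mem_Ioc.1 hn)
      have hple : p ≤ n := by
        have h3 := Nat.le_of_dvd (by omega) hpn
        have h4 : p ≤ p ^ 2 := Nat.le_self_pow (by norm_num) p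
        omega
      refine ⟨by omega, hp, h2, ?_⟩
      obtain ⟨m, hm⟩ := hpn
      have h5 := hI n hn
      have e : ((m : ℤ) : ℝ) * (p : ℝ) ^ 2 = n := by rw [hm]; push_cast; ring
      exact ⟨m, by rw [e]; exact h5.1, by rw [e]; exact h5.2⟩
  have hc := (Finset.card_le_card hcover).trans ((Finset.card_union_le _ _).trans
    (add_le_add Finset.card_biUnion_le Finset.card_biUnion_le))
  rw [Nat.card_Ioc] at hc
  have hc' : ((b - a : ℕ) : ℝ) ≤
    ∑ p ∈ P0, (((Finset.Ioc a b).filter (fun n => p ^ 2 ∣ n)).card : ℝ) +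
    ∑ p ∈ H, (((Finset.Ioc a b).filter (fun n => p ^ 2 ∣ n)).card : ℝ) := by exact_mod_cast hc
  have s1 : ∑ p ∈ P0, (((Finset.Ioc a b).filter (fun n => p ^ 2 ∣ n)).card : ℝ) ≤
      (h + 1) * 0.46696 + 0.0279 * h := by
    have : ∀ p ∈ P0, (((Finset.Ioc a b).filter (fun n => p ^ 2 ∣ n)).card : ℝ) ≤
        (h + 1) * (1 / (p : ℝ) ^ 2) + 1 := by
      intro p hp
      rw [hP0, Finset.mem_filter] at hp
      have hp0 := hp.2.pos
      have h1 := ioc_dvd_card a b (p ^ 2) (by positivity)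
      have h2 : (((Finset.Ioc a b).filter (fun n => p ^ 2 ∣ n)).card : ℝ) ≤ (((b - a) / p ^ 2 : ℕ) : ℝ) + 1 := by
        exact_mod_cast h1
      refine h2.trans ?_
      have h3 : (((b - a) / p ^ 2 : ℕ) : ℝ) ≤ ((b - a : ℕ) : ℝ) / ((p ^ 2 : ℕ) : ℝ) := Nat.cast_div_le
      have h4 : ((b - a : ℕ) : ℝ) / ((p ^ 2 : ℕ) : ℝ) ≤ (h + 1) / (p : ℝ) ^ 2 := by
        push_cast
        rw [hba]
        gcongr
        linarith
      have h5 : (h + 1) / (p : ℝ) ^ 2 = (h + 1) * (1 / (p : ℝ) ^ 2) := by ring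
      linarith
    refine (Finset.sum_le_sum this).trans ?_
    rw [Finset.sum_add_distrib, ← Finset.mul_sum]
    simp only [Finset.sum_const, nsmul_eq_mul, mul_one]
    have q1 := sum_inv_sq N0
    have q2 := pi_bound hL hX
    have q3 : 0 ≤ h + 1 := by linarith
    exact add_le_add (mul_le_mul_of_nonneg_left q1 q3) q2
  have s2 : ∑ p ∈ H, (((Finset.Ioc a b).filter (fun n => p ^ 2 ∣ n)).card : ℝ) ≤ 0.481 * h := by
    have : ∀ p ∈ H, (((Finset.Ioc a b).filter (fun n => p ^ 2 ∣ n)).card : ℝ) ≤ 1 := by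
      intro p hp
      have h0 := hHz p hp
      rw [hH, Finset.mem_filter] at hp
      have hp0 := hp.2.1.pos
      have h1 := ioc_dvd_card a b (p ^ 2) (by positivity)
      have h2 : b - a < p ^ 2 := by
        have : ((b - a : ℕ) : ℝ) < ((p ^ 2 : ℕ) : ℝ) := by
          rw [hba]; push_cast
          have g1 : 1000 * h ≤ (p : ℝ) := by
            refine le_trans ?_ h0
            rw [hh]
            calc 1000 * (X * L) = (1000 * L) * X := by ring
              _ ≤ _ := by gcongr
          have g2 : (1 : ℝ) ≤ p := by exact_mod_cast hp0
          have g3 : (p : ℝ) ≤ (p : ℝ) ^ 2 := by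
            rw [pow_two]; exact aux_m' (by linarith) g2
          linarith
        exact_mod_cast this
      rw [Nat.div_eq_of_lt h2] at h1
      exact_mod_cast h1
    refine (Finset.sum_le_sum this).trans ?_
    simpa using hHc
  linarith

/-- For every real `x ≥ e^{500000}`, the interval `(x, x + x^{1/5}·log x]` contains a
squarefree integer. -/
theorem squarefree_in_interval_largest (x : ℝ) (hx : Real.exp 500000 ≤ x) :
    ∃ n : ℕ, 0 < n ∧ x < (n : ℝ) ∧ (n : ℝ) ≤ x + x ^ ((1 : ℝ) / 5) * Real.log x ∧
      Squarefree n := by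
  have hx0 : 0 < x := (Real.exp_pos _).trans_le hx
  have hL : 500000 ≤ Real.log x := by
    rwa [Real.le_log_iff_exp_le hx0]
  have hX : x ^ ((1 : ℝ) / 5) = Real.exp (Real.log x / 5) := by
    rw [Real.rpow_def_of_pos hx0]; congr 1; ring
  have h5 : (x ^ ((1 : ℝ) / 5)) ^ 5 = x := by
    rw [← Real.rpow_natCast, ← Real.rpow_mul hx0.le]; norm_num
  have := final_count hL hX
  rwa [h5] at this
end

section
/- For every real number x ≥ 2, the interval (x, x + 5·x^{1/4}] contains a squarefree integer. -/
/-- The product of all primes up to 1000. -/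
def sqfP : ℕ :=
  19590340644999083431262508198206381046123972390589368223882605328968666316379870661851951648789482321596229559115436019149189529725215266728292282990852649023362731392404017939142010958261393634959471483757196721672243410067118516227661133135192488848989914892157188308679896875137439519338903968094905549750386407106033836586660683539201011635917900039904495065203299749542985993134669814805318474080581207891125910

/-- A fast sufficient test for squarefreeness, with the gcd as an argument. -/
def sqfTestAux (n g : ℕ) : Bool :=
  cond (Nat.beq (Nat.gcd g (Nat.div n g)) 1) (Nat.ble (Nat.div n g) 1000000) false

/-- A fast sufficient test for squarefreeness. -/
def sqfTest (n : ℕ) : Bool := sqfTestAux n (Nat.gcd sqfP n)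

/-- Search for a number passing the test in `[n, n + w)`. -/
def sqfFind (w : ℕ) : ℕ → Bool :=
  Nat.rec (fun _ => false) (fun _ ih n => cond (sqfTest n) true (ih (Nat.succ n))) w

/-- Force the evaluation of the base point, then search. -/
def sqfLeaf (w n : ℕ) : Bool :=
  Nat.rec false (fun k _ => sqfFind w (Nat.succ k)) n

/-- Search in all of the `2 ^ d` blocks of length `B` starting from `n`. -/
def sqfAll (B w d : ℕ) : ℕ → Bool :=
  Nat.rec (fun n => sqfLeaf w n)
    (fun d ih n => cond (ih n) (ih (Nat.add n (Nat.mul (Nat.pow 2 d) B))) false) d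

theorem sqfAll_succ (B w d n : ℕ) :
    sqfAll B w (d + 1) n = (sqfAll B w d n && sqfAll B w d (n + 2 ^ d * B)) := by
  have : sqfAll B w (d + 1) n = cond (sqfAll B w d n) (sqfAll B w d (n + 2 ^ d * B)) false := rfl
  rw [this]
  cases sqfAll B w d n <;> rfl

theorem sqfFind_succ (w n : ℕ) :
    sqfFind (w + 1) n = (sqfTest n || sqfFind w (n + 1)) := by
  have : sqfFind (w + 1) n = cond (sqfTest n) true (sqfFind w (n + 1)) := rfl
  rw [this]
  cases sqfTest n <;> rfl

theorem sqfTest_eq (n : ℕ) : sqfTest n =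
    (Nat.beq (Nat.gcd (Nat.gcd sqfP n) (n / Nat.gcd sqfP n)) 1 &&
      Nat.ble (n / Nat.gcd sqfP n) 1000000) := by
  have : sqfTest n = cond (Nat.beq (Nat.gcd (Nat.gcd sqfP n) (n / Nat.gcd sqfP n)) 1)
      (Nat.ble (n / Nat.gcd sqfP n) 1000000) false := rfl
  rw [this]
  cases Nat.beq (Nat.gcd (Nat.gcd sqfP n) (n / Nat.gcd sqfP n)) 1 <;> rfl

/-- Run through a table of ranges. -/
def sqfTable : List (ℕ × ℕ × ℕ) → ℕ → ℕ → Bool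
  | [], A, E => Nat.ble E A
  | (B, w, d) :: l, A, E =>
      Nat.ble ((B + w) ^ 4) (625 * A) && sqfAll B w d (A + B) && sqfTable l (A + 2 ^ d * B) E

/-- Trial division by `2, …, 31`. -/
def trialPrime (n : ℕ) : Bool :=
  Nat.ble 2 n && (List.range 32).all (fun m => Nat.ble m 1 || Nat.ble n m || !(Nat.beq (n % m) 0))

theorem trialPrime_iff (n : ℕ) (hn : n < 1001) : n.Prime ↔ trialPrime n = true := by
  unfold trialPrime
  rw [Nat.prime_def_le_sqrt, Bool.and_eq_true, List.all_eq_true]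
  constructor
  · rintro ⟨h1, h2⟩
    refine ⟨Nat.ble_eq_true_of_le h1, fun m hm => ?_⟩
    rw [List.mem_range] at hm
    by_contra hc
    simp only [Bool.or_eq_true, not_or, Nat.ble_eq, Bool.not_eq_true', Bool.not_eq_false,
      Nat.beq_eq] at hc
    obtain ⟨⟨h3, h4⟩, h5⟩ := hc
    have hp : n.Prime := Nat.prime_def_le_sqrt.2 ⟨h1, h2⟩
    have h6 : m ∣ n := Nat.dvd_of_mod_eq_zero (by simpa using h5)
    rcases (Nat.dvd_prime hp).1 h6 with h | h <;> omega
  · rintro ⟨h1, h2⟩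
    refine ⟨Nat.le_of_ble_eq_true h1, fun m hm2 hms hmd => ?_⟩
    have hsq : Nat.sqrt n < 32 := by rw [Nat.sqrt_lt]; omega
    have h3 := h2 m (List.mem_range.2 (by omega))
    have hlt : m < n := lt_of_le_of_lt hms (Nat.sqrt_lt_self (Nat.le_of_ble_eq_true h1))
    have h4 : n % m = 0 := Nat.mod_eq_zero_of_dvd hmd
    simp [h4] at h3
    omega

theorem sqfP_eq : sqfP = primorial 1000 := by
  have : primorial 1000 = ∏ p ∈ (Finset.range 1001).filter (fun n => trialPrime n = true), p := by
    unfold primorial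
    refine Finset.prod_congr (Finset.filter_congr fun n hn => ?_) (fun _ _ => rfl)
    exact trialPrime_iff n (Finset.mem_range.1 hn)
  rw [this]
  decide +kernel

theorem primeCounting_650 : Nat.primeCounting 650 = 118 := by
  rw [Nat.primeCounting, Nat.primeCounting', Nat.count_eq_card_filter_range]
  rw [Finset.filter_congr (q := fun n => trialPrime n = true)
    (fun n hn => trialPrime_iff n (by have := Finset.mem_range.1 hn; omega))]
  decide +kernel

theorem primeCounting_1000 : Nat.primeCounting 1000 = 168 := by
  rw [Nat.primeCounting, Nat.primeCounting', Nat.count_eq_card_filter_range]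
  rw [Finset.filter_congr (q := fun n => trialPrime n = true)
    (fun n hn => trialPrime_iff n (by have := Finset.mem_range.1 hn; omega))]
  decide +kernel

theorem sqfTest_sound (n : ℕ) (hn : 0 < n) (h : sqfTest n = true) : Squarefree n := by
  rw [sqfTest_eq] at h
  rw [Bool.and_eq_true] at h
  obtain ⟨h1, h2⟩ := h
  replace h1 := Nat.eq_of_beq_eq_true h1
  replace h2 := Nat.le_of_ble_eq_true h2
  rw [sqfP_eq] at h1 h2
  set g := Nat.gcd (primorial 1000) n with hg
  have hgn : g ∣ n := Nat.gcd_dvd_right _ _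
  have hgP : g ∣ primorial 1000 := Nat.gcd_dvd_left _ _
  have hmul : g * (n / g) = n := Nat.mul_div_cancel' hgn
  set r := n / g with hr
  have hr0 : r ≠ 0 := by
    rintro h0
    rw [h0] at hmul
    omega
  have hgs : Squarefree g := (squarefree_primorial 1000).squarefree_of_dvd hgP
  have hrs : Squarefree r := by
    rw [Nat.squarefree_iff_prime_squarefree]
    intro q hq hqr
    have hq1 : q ∣ r := dvd_trans (dvd_mul_right q q) hqr
    have hqn : q ∣ n := hmul ▸ (hq1.mul_left g)
    have hqL : ¬ q ≤ 1000 := by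
      intro hle
      have h3 : q ∣ primorial 1000 := hq.dvd_primorial_iff.2 hle
      have h4 : q ∣ g := Nat.dvd_gcd h3 hqn
      have h5 : q ∣ Nat.gcd g r := Nat.dvd_gcd h4 hq1
      rw [h1] at h5
      exact hq.one_lt.ne' (Nat.dvd_one.1 h5)
    have := Nat.le_of_dvd (Nat.pos_of_ne_zero hr0) hqr
    push Not at hqL
    have h9 : 1001 * 1001 ≤ q * q := Nat.mul_le_mul hqL hqL
    omega
  rw [← hmul]
  exact (Nat.squarefree_mul h1).2 ⟨hgs, hrs⟩

theorem sqfFind_sound (w n : ℕ) (hn : 0 < n) (h : sqfFind w n = true) :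
    ∃ k, n ≤ k ∧ k < n + w ∧ Squarefree k := by
  induction w generalizing n with
  | zero => simp [sqfFind] at h
  | succ w ih =>
    rw [sqfFind_succ, Bool.or_eq_true] at h
    rcases h with h | h
    · exact ⟨n, le_rfl, by omega, sqfTest_sound n hn h⟩
    · obtain ⟨k, h1, h2, h3⟩ := ih (n + 1) (by omega) h
      exact ⟨k, by omega, by omega, h3⟩

theorem sqfLeaf_sound (w n : ℕ) (h : sqfLeaf w n = true) :
    ∃ k, n ≤ k ∧ k < n + w ∧ Squarefree k := by
  cases n with
  | zero => simp [sqfLeaf] at h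
  | succ n => exact sqfFind_sound w (n + 1) (by omega) h

theorem sqfAll_sound (B w d n : ℕ) (h : sqfAll B w d n = true) (j : ℕ) (hj : j < 2 ^ d) :
    ∃ k, n + j * B ≤ k ∧ k < n + j * B + w ∧ Squarefree k := by
  induction d generalizing n j with
  | zero =>
    have : j = 0 := by simpa using hj
    subst this
    simpa using sqfLeaf_sound w n h
  | succ d ih =>
    rw [sqfAll_succ, Bool.and_eq_true] at h
    by_cases hjd : j < 2 ^ d
    · exact ih n h.1 j hjd
    · have h1 : j - 2 ^ d < 2 ^ d := by rw [pow_succ] at hj; omega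
      obtain ⟨k, hk1, hk2, hk3⟩ := ih _ h.2 (j - 2 ^ d) h1
      have h2 : n + 2 ^ d * B + (j - 2 ^ d) * B = n + j * B := by
        rw [add_assoc, ← add_mul]
        congr 2
        omega
      rw [h2] at hk1 hk2
      exact ⟨k, hk1, hk2, hk3⟩

theorem sqfTable_sound (l : List (ℕ × ℕ × ℕ)) (A E : ℕ) (h : sqfTable l A E = true)
    (x : ℝ) (hA : (A : ℝ) ≤ x) (hE : x < E) :
    ∃ n : ℕ, x < n ∧ (n : ℝ) ≤ x + 5 * x ^ ((1 : ℝ) / 4) ∧ Squarefree n := by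
  induction l generalizing A with
  | nil =>
    have := Nat.le_of_ble_eq_true h
    have : (E : ℝ) ≤ A := by exact_mod_cast this
    linarith
  | cons t l ih =>
    obtain ⟨B, w, d⟩ := t
    rw [sqfTable, Bool.and_eq_true, Bool.and_eq_true] at h
    obtain ⟨⟨h1, h2⟩, h3⟩ := h
    by_cases hx : ((A + 2 ^ d * B : ℕ) : ℝ) ≤ x
    · exact ih _ h3 hx
    push Not at hx
    replace h1 := Nat.le_of_ble_eq_true h1
    have hx0 : (0 : ℝ) ≤ x := le_trans (Nat.cast_nonneg A) hA
    have hfl : A ≤ ⌊x⌋₊ := Nat.le_floor hA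
    have hfl2 : ⌊x⌋₊ < A + 2 ^ d * B := (Nat.floor_lt hx0).2 hx
    have hB : 0 < B := by
      rcases Nat.eq_zero_or_pos B with h0 | h0
      · subst h0; omega
      · exact h0
    have hj : (⌊x⌋₊ - A) / B < 2 ^ d := by
      rw [Nat.div_lt_iff_lt_mul hB]; omega
    obtain ⟨k, hk1, hk2, hk3⟩ := sqfAll_sound B w d _ h2 _ hj
    have hdm := Nat.div_add_mod (⌊x⌋₊ - A) B
    have hml := Nat.mod_lt (⌊x⌋₊ - A) hB
    rw [mul_comm] at hdm
    set J := (⌊x⌋₊ - A) / B * B with hJ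
    have e1 : ⌊x⌋₊ < k := by omega
    have e2 : k ≤ ⌊x⌋₊ + (B + w) := by omega
    have e3 : ((B + w : ℕ) : ℝ) ≤ 5 * x ^ ((1 : ℝ) / 4) := by
      have h5 : ((B + w : ℕ) : ℝ) ^ 4 ≤ (5 * x ^ ((1 : ℝ) / 4)) ^ 4 := by
        rw [mul_pow, ← Real.rpow_natCast (x ^ ((1 : ℝ) / 4)), ← Real.rpow_mul hx0]
        norm_num
        have : (((B + w) ^ 4 : ℕ) : ℝ) ≤ ((625 * A : ℕ) : ℝ) := by exact_mod_cast h1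
        push_cast at this
        linarith
      exact le_of_pow_le_pow_left₀ (by norm_num) (by positivity) h5
    refine ⟨k, (Nat.floor_lt hx0).1 e1, ?_, hk3⟩
    have e4 : (k : ℝ) ≤ ⌊x⌋₊ + ((B + w : ℕ) : ℝ) := by exact_mod_cast e2
    have e5 := Nat.floor_le hx0
    linarith

/-- `b = true`, with a decision procedure that evaluates `b` only once. -/
def IsTrueBool (b : Bool) : Prop := b = true

instance (b : Bool) : Decidable (IsTrueBool b) :=
  Bool.rec (motive := fun b => Decidable (IsTrueBool b))
    (isFalse Bool.false_ne_true) (isTrue (Eq.refl true)) b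

theorem sqf_finite_check : IsTrueBool (sqfTable
    [(4,1,0), (5,2,0), (8,1,0), (7,3,0), (9,2,0), (11,1,0), (12,1,0), (12,1,0), (13,1,0),
    (14,1,0), (14,1,0), (12,4,1), (16,1,1), (16,1,1), (16,2,1), (18,1,1), (19,1,1), (18,2,2),
    (20,2,2), (22,1,2), (21,3,2), (22,3,2), (23,2,2), (24,2,3), (25,3,3), (27,2,3), (28,2,3),
    (28,3,3), (29,3,4), (32,2,4), (33,3,4), (34,4,4), (36,3,4), (37,3,4), (40,2,4), (40,3,5),
    (42,3,5), (44,3,5), (46,3,5), (48,3,5), (50,3,5), (52,2,6), (54,3,6), (55,5,6), (50,12,6),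
    (52,12,7), (56,12,7), (59,12,7), (62,12,7), (65,12,7), (67,12,7), (70,12,8), (75,12,8),
    (79,12,8), (83,12,8), (86,12,8), (90,12,8), (93,12,9), (99,12,9), (104,12,9), (109,12,9),
    (114,12,9), (118,12,9), (122,12,10), (129,12,10), (136,12,10), (142,12,10), (148,12,10),
    (154,12,10), (159,12,11), (168,12,11), (177,12,11), (184,12,11), (192,12,11), (199,12,11),
    (201,16,12), (213,16,12), (227,12,12), (233,16,12), (242,16,12), (251,16,12), (259,16,13),
    (265,24,13), (278,24,13), (299,16,13), (310,16,13), (321,16,13), (323,24,14), (341,24,14),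
    (358,24,14), (373,24,14)] 2 41000000) := by
  decide +kernel

theorem sqf_small (x : ℝ) (hx : 2 ≤ x) (hE : x < 41000000) :
    ∃ n : ℕ, x < n ∧ (n : ℝ) ≤ x + 5 * x ^ ((1 : ℝ) / 4) ∧ Squarefree n :=
  sqfTable_sound _ 2 41000000 sqf_finite_check x (by exact_mod_cast hx) (by exact_mod_cast hE)

theorem B_log (w : ℝ) (hw : 3.98 ≤ w) : 0.697 * w ≤ Real.log (w^5/2) * (0.035*w+0.3106) := by
  have hmono : MonotoneOn (fun w : ℝ => 5 * Real.log w - 0.697 * w/(0.035*w+0.3106)) (Set.Ici 3.98) := by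
    have hd : ∀ y : ℝ, 0 < y → HasDerivAt (fun w : ℝ => 5 * Real.log w - 0.697 * w/(0.035*w+0.3106))
        (5 * y⁻¹ - (0.697*(0.035*y+0.3106) - 0.697*y*0.035)/(0.035*y+0.3106)^2) y := by
      intro y hy
      have h1 := (Real.hasDerivAt_log hy.ne').const_mul 5
      have h2 : HasDerivAt (fun w : ℝ => 0.697 * w) 0.697 y := by
        simpa using (hasDerivAt_id y).const_mul (0.697:ℝ)
      have h3 : HasDerivAt (fun w : ℝ => 0.035 * w + 0.3106) 0.035 y := by
        simpa using ((hasDerivAt_id y).const_mul (0.035:ℝ)).add_const (0.3106:ℝ)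
      exact h1.sub (h2.div h3 (by positivity))
    apply monotoneOn_of_deriv_nonneg (convex_Ici _)
    · intro y hy
      have : (0:ℝ) < y := by have := Set.mem_Ici.1 hy; linarith
      exact (hd y this).continuousAt.continuousWithinAt
    · intro y hy
      rw [interior_Ici] at hy
      have : (0:ℝ) < y := by have := Set.mem_Ioi.1 hy; linarith
      exact (hd y this).differentiableAt.differentiableWithinAt
    · intro y hy
      rw [interior_Ici] at hy
      have hy0 : (0:ℝ) < y := by have := Set.mem_Ioi.1 hy; linarith
      rw [(hd y hy0).deriv]
      have : 5 * y⁻¹ - (0.697*(0.035*y+0.3106) - 0.697*y*0.035)/(0.035*y+0.3106)^2 = 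
        (5 * (0.035*y+0.3106)^2 - 0.697*0.3106*y)/(y*(0.035*y+0.3106)^2) := by
        field_simp
        ring
      rw [this]
      apply div_nonneg _ (by positivity)
      nlinarith [sq_nonneg (0.035*y-0.3106)]
  have h := hmono (Set.mem_Ici.2 le_rfl) (Set.mem_Ici.2 hw) hw
  simp only at h
  have hw0 : (0:ℝ) < w := by linarith
  have e1 : Real.log (w^5/2) = 5 * Real.log w - Real.log 2 := by
    rw [Real.log_div (by positivity) (by norm_num), Real.log_pow]; norm_num
  have h0 : 9 * Real.log 2 - 0.0260 ≤ 5 * Real.log 3.98 - Real.log 2 := by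
    have a : 5 * Real.log 3.98 = Real.log (3.98^5) := by rw [Real.log_pow]; norm_num
    have b : (9:ℝ) * Real.log 2 = Real.log (2^9) := by rw [Real.log_pow]; norm_num
    have c : 1 - (2^9 / (3.98^5/2) : ℝ) ≤ Real.log ((3.98^5/2) / 2^9) := by
      have := Real.one_sub_inv_le_log_of_pos (x := ((3.98^5/2) / 2^9 : ℝ)) (by norm_num)
      rwa [inv_div] at this
    rw [Real.log_div (by norm_num) (by norm_num), Real.log_div (by norm_num) (by norm_num)] at c
    norm_num at a b c ⊢
    linarith
  have h2 := Real.log_two_gt_d9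
  have h3 : (0.697 * 3.98/(0.035*3.98+0.3106) : ℝ) ≤ 6.17 := by norm_num
  have h4 : 0.697 * w/(0.035*w+0.3106) ≤ Real.log (w^5/2) := by
    rw [e1]
    linarith
  rwa [div_le_iff₀ (by positivity)] at h4

theorem B_prim (m k : ℕ) (hk : k ≤ m) :
    m ^ (Nat.primeCounting (m+k) - Nat.primeCounting m) ≤ 2^(m+k) := by
  have hc : ∀ n : ℕ, Nat.primeCounting n = ((Finset.range (n+1)).filter Nat.Prime).card := by
    intro n
    rw [Nat.primeCounting, Nat.primeCounting', Nat.count_eq_card_filter_range]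
  have hs : Nat.primeCounting (m+k) = Nat.primeCounting m +
      ((Finset.Ico (m+1) (m+k+1)).filter Nat.Prime).card := by
    rw [hc, hc, ← Finset.card_union_of_disjoint, ← Finset.filter_union]
    · congr 2
      ext a; simp only [Finset.mem_range, Finset.mem_union, Finset.mem_Ico]; omega
    · rw [Finset.disjoint_left]
      intro a ha hb
      simp only [Finset.mem_filter, Finset.mem_range, Finset.mem_Ico] at ha hb
      omega
  have h1 := primorial_add_le hk
  rw [primorial_add] at h1
  have h2 := Nat.le_of_mul_le_mul_left h1 (primorial_pos m)
  have h3 : (m+k).choose m ≤ 2^(m+k) := Nat.choose_le_two_pow _ _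
  refine le_trans ?_ (h2.trans h3)
  rw [hs, Nat.add_sub_cancel_left]
  apply Finset.pow_card_le_prod
  intro p hp
  simp only [Finset.mem_filter, Finset.mem_Ico] at hp
  omega

theorem B_pow (w v : ℝ) (hw : 1 ≤ w) (hv : 0 ≤ v) (h : v^5 ≤ (w^5+1)/2) :
    v^4 ≤ 0.5744 * (w^4+1) := by
  have h1 : (v^4)^5 ≤ (0.5744 * (w^4+1))^5 := by
    have : (v^5)^4 ≤ ((w^5+1)/2)^4 := by gcongr
    have e : (v^4)^5 = (v^5)^4 := by ring
    rw [e]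
    refine this.trans ?_
    have a : w^15 ≤ w^16 := pow_le_pow_right₀ hw (by norm_num)
    have b : w^10 ≤ w^12 := pow_le_pow_right₀ hw (by norm_num)
    have c : w^5 ≤ w^8 := pow_le_pow_right₀ hw (by norm_num)
    have a' : 0 ≤ w^15 := by positivity
    have b' : 0 ≤ w^10 := by positivity
    have c' : 0 ≤ w^5 := by positivity
    have d' : 0 ≤ w^4 := by positivity
    have k : (w^5+1)^4 ≤ (w^4+1)^5 := by nlinarith
    have k' : 0 ≤ (w^4+1)^5 := by positivity
    rw [div_pow, mul_pow]
    norm_num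
    linarith
  exact le_of_pow_le_pow_left₀ (by norm_num) (by positivity) h1

theorem B_main (n : ℕ) : 500 ≤ n → ∀ w : ℝ, 0 ≤ w → w^5 = n →
    (Nat.primeCounting n : ℝ) ≤ 0.07 * n + 0.73 * w^4 := by
  induction n using Nat.strong_induction_on with
  | _ n ih =>
  intro hn w hw0 hw
  rcases lt_or_ge n 650 with h1 | h1
  · have a : Nat.primeCounting n ≤ 118 := primeCounting_650 ▸ Nat.monotone_primeCounting h1.le
    have a' : (Nat.primeCounting n : ℝ) ≤ 118 := by exact_mod_cast a
    have hn' : (500:ℝ) ≤ n := by exact_mod_cast hn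
    have : 3.4 ≤ w := by
      by_contra hc
      push Not at hc
      have : w^5 < 3.4^5 := by gcongr
      rw [hw] at this; norm_num at this; linarith
    have : (3.4:ℝ)^4 ≤ w^4 := by gcongr
    norm_num at this
    linarith
  rcases lt_or_ge n 1000 with h2 | h2
  · have a : Nat.primeCounting n ≤ 168 := primeCounting_1000 ▸ Nat.monotone_primeCounting h2.le
    have a' : (Nat.primeCounting n : ℝ) ≤ 168 := by exact_mod_cast a
    have hn' : (650:ℝ) ≤ n := by exact_mod_cast h1
    have : 3.65 ≤ w := by
      by_contra hc
      push Not at hc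
      have : w^5 < 3.65^5 := by gcongr
      rw [hw] at this; norm_num at this; linarith
    have : (3.65:ℝ)^4 ≤ w^4 := by gcongr
    norm_num at this
    linarith
  have hn' : (1000:ℝ) ≤ n := by exact_mod_cast h2
  have hw1 : 3.98 ≤ w := by
    by_contra hc
    push Not at hc
    have : w^5 < 3.98^5 := by gcongr
    rw [hw] at this; norm_num at this; linarith
  obtain ⟨m, k, hmk, hk, hkm⟩ : ∃ m k : ℕ, m + k = n ∧ k ≤ m ∧ m ≤ k + 1 :=
    ⟨(n+1)/2, n/2, by omega, by omega, by omega⟩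
  have hm2 : (m:ℝ) ≤ (n+1)/2 := by
    have : (2 * m : ℝ) ≤ n + 1 := by exact_mod_cast (by omega : 2 * m ≤ n+1)
    linarith
  have hm3 : (n:ℝ)/2 ≤ m := by
    have : (n : ℝ) ≤ 2 * m := by exact_mod_cast (by omega : n ≤ 2 * m)
    linarith
  have hv5 : ((m:ℝ) ^ ((1:ℝ)/5))^5 = m := by
    rw [← Real.rpow_natCast, ← Real.rpow_mul (by positivity)]; norm_num
  set v := (m:ℝ) ^ ((1:ℝ)/5) with hv
  have hv0 : 0 ≤ v := by positivity
  have im := ih m (by omega) (by omega) v hv0 hv5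
  have hvp := B_pow w v (by linarith) hv0 (by rw [hv5, hw]; exact hm2)
  have hp := B_prim m k hk
  rw [hmk] at hp
  set j := Nat.primeCounting n - Nat.primeCounting m with hj
  have hpi : Nat.primeCounting n = Nat.primeCounting m + j := by
    have : Nat.primeCounting m ≤ Nat.primeCounting n := Nat.monotone_primeCounting (by omega)
    omega
  have hlog : (j:ℝ) * Real.log (w^5/2) ≤ n * Real.log 2 := by
    have : ((m:ℝ)^j) ≤ 2^n := by exact_mod_cast hp
    have h3 := Real.log_le_log (by have : 0 < m := by omega
                                   positivity) this
    rw [Real.log_pow, Real.log_pow] at h3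
    refine le_trans ?_ h3
    gcongr
    rw [hw]; exact hm3
  have hB := B_log w hw1
  have hl2 := Real.log_two_lt_d9
  set L := Real.log (w^5/2)
  have hj' : 0.697 * (j:ℝ) ≤ 0.6932 * (0.035 * w^5 + 0.3106 * w^4) := by
    have hjj : (0:ℝ) ≤ j := by positivity
    have a1 : 0.697 * w * j ≤ L * (0.035*w+0.3106) * j := by gcongr
    have a2 : L * (0.035*w+0.3106) * j ≤ 0.6932 * w^5 * (0.035*w+0.3106) := by
      have : (j:ℝ) * L ≤ 0.6932 * w^5 := by
        refine hlog.trans ?_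
        rw [hw]; nlinarith
      calc _ = (j * L) * (0.035*w+0.3106) := by ring
        _ ≤ _ := by gcongr
    have hwp : 0 < w := by linarith
    refine le_of_mul_le_mul_left ?_ hwp
    calc w * (0.697 * (j:ℝ)) = 0.697 * w * j := by ring
      _ ≤ _ := a1.trans a2
      _ = _ := by ring
  rw [hpi]
  push_cast
  have h4 : (3.98:ℝ)^4 ≤ w^4 := by gcongr
  norm_num at h4
  rw [← hw]
  rw [← hw] at hm2 hn'
  linarith

theorem C_mlt (X : ℝ) (hX : 79 ≤ X) (d1 d2 m1 m2 : ℕ) (hd : d1 < d2)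
    (h1 : X^4 < (m1:ℝ) * d1^2) (h2 : (m2:ℝ) * d2^2 ≤ X^4 + 5 * X) : m2 < m1 := by
  by_contra hc
  push Not at hc
  have hc' : (m1:ℝ) ≤ m2 := by exact_mod_cast hc
  have hd' : (d1:ℝ) + 1 ≤ d2 := by exact_mod_cast hd
  have hd0 : (0:ℝ) ≤ d1 := by positivity
  have hm0 : (0:ℝ) ≤ m2 := by positivity
  have h3 : X^4 < (m2:ℝ) * d1^2 := lt_of_lt_of_le h1 (by gcongr)
  have hm1 : (1:ℝ) ≤ m2 := by
    have : m2 ≠ 0 := by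
      rintro rfl
      have : 0 < X^4 := by positivity
      simp at h3; linarith
    exact_mod_cast Nat.one_le_iff_ne_zero.2 this
  have h4 : ((d1:ℝ)+1)^2 ≤ d2^2 := by gcongr
  have h5 : (m2:ℝ) * ((d1:ℝ)+1)^2 ≤ X^4 + 5 * X := le_trans (by gcongr) h2
  have h6 : (m2:ℝ) * d1 < 2.5 * X := by nlinarith
  have h7 : (X^2)^2 < ((m2:ℝ) * d1)^2 := by
    calc (X^2)^2 = X^4 := by ring
      _ < (m2:ℝ) * d1^2 := h3
      _ ≤ m2 * (m2 * d1^2) := by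
        have : 0 ≤ (m2:ℝ) * d1^2 := by positivity
        nlinarith
      _ = _ := by ring
  have h8 : X^2 < (m2:ℝ) * d1 := lt_of_pow_lt_pow_left₀ 2 (by positivity) h7
  nlinarith

theorem C_gap (X : ℝ) (hX : 79 ≤ X) (d1 d2 m1 m2 : ℕ) (hd : d1 < d2)
    (hd1 : 6 * X ≤ d1)
    (h1 : X^4 < (m1:ℝ) * d1^2) (h1' : (m1:ℝ) * d1^2 ≤ X^4 + 5 * X)
    (h2' : X^4 < (m2:ℝ) * d2^2) (h2 : (m2:ℝ) * d2^2 ≤ X^4 + 5 * X) :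
    0.9 * (d1:ℝ)^3 ≤ 2 * X^4 * (d2 - d1) := by
  have hm : (m2:ℝ) + 1 ≤ m1 := by exact_mod_cast C_mlt X hX d1 d2 m1 m2 hd h1 h2
  have hd' : (d1:ℝ) + 1 ≤ d2 := by exact_mod_cast hd
  have hd0 : (0:ℝ) < d1 := by linarith
  generalize (d1:ℝ) = p at *
  generalize (d2:ℝ) = q at *
  generalize (m1:ℝ) = m at *
  generalize (m2:ℝ) = n at *
  have hq : 0 < q := by linarith
  have a1 : p^2 * q^2 ≤ (X^4 + 5 * X) * q^2 - X^4 * p^2 := by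
    have b1 : m * p^2 * q^2 ≤ (X^4 + 5 * X) * q^2 := by gcongr
    have b2 : X^4 * p^2 ≤ n * q^2 * p^2 := by gcongr
    have b3 : (n+1) * (p^2 * q^2) ≤ m * (p^2*q^2) := by gcongr
    linarith
  have a2 : 5 * X ≤ 0.1 * p^2 := by nlinarith
  have a3 : 0.9 * p^2 * q^2 ≤ X^4 * (q - p) * (p + q) := by nlinarith
  have hX4 : 0 < X^4 := by positivity
  have a4 : X^4 * (q - p) * (p + q) ≤ X^4 * (q - p) * (2 * q) := by
    apply mul_le_mul_of_nonneg_left (by linarith)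
    exact mul_nonneg hX4.le (by linarith)
  have a5 : (0.9 * p^2 * q) * q ≤ (2 * X^4 * (q - p)) * q := by linarith
  have a6 := le_of_mul_le_mul_right a5 hq
  nlinarith [mul_pos hd0 hd0]

theorem C_triple_aux (X : ℝ) (hX : 79 ≤ X) (d1 d2 d3 m1 m2 m3 : ℕ) (h12 : d1 < d2) (h23 : d2 < d3)
    (o1 : Odd d1) (o2 : Odd d2) (o3 : Odd d3) (hd1 : 6 * X ≤ d1) (h13 : (d3:ℝ) ≤ 1.5 * d1)
    (h1 : X^4 < (m1:ℝ) * d1^2) (h1' : (m1:ℝ) * d1^2 ≤ X^4 + 5 * X)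
    (h2 : X^4 < (m2:ℝ) * d2^2) (h2' : (m2:ℝ) * d2^2 ≤ X^4 + 5 * X)
    (h3 : X^4 < (m3:ℝ) * d3^2) (h3' : (m3:ℝ) * d3^2 ≤ X^4 + 5 * X) :
    (d1:ℝ)^4 ≤ 3/8 * X^4 * (d3 - d1)^3 + 5/2 * X * (d3 - d1) * d1^2 := by
  have hg := C_gap X hX d1 d2 m1 m2 h12 hd1 h1 h1' h2 h2'
  obtain ⟨a, ha⟩ : ∃ a, d2 = d1 + 2 * a := by
    obtain ⟨k, hk⟩ := o1; obtain ⟨l, hl⟩ := o2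
    exact ⟨l - k, by omega⟩
  obtain ⟨b, hb⟩ : ∃ b, d3 = d2 + 2 * b := by
    obtain ⟨k, hk⟩ := o2; obtain ⟨l, hl⟩ := o3
    exact ⟨l - k, by omega⟩
  have ha1 : (1:ℝ) ≤ a := by exact_mod_cast (by omega : 1 ≤ a)
  have hb1 : (1:ℝ) ≤ b := by exact_mod_cast (by omega : 1 ≤ b)
  have e2 : (d2:ℝ) = d1 + 2 * a := by exact_mod_cast ha
  have e3 : (d3:ℝ) = d2 + 2 * b := by exact_mod_cast hb
  have hM : ((m1 * b + m3 * a - m2 * (a + b) : ℤ) : ℝ) = m1 * b + m3 * a - m2 * (a + b) := by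
    push_cast; ring
  have key : 0 < ((m1 * b + m3 * a - m2 * (a + b) : ℤ) : ℝ) →
     1 ≤ ((m1 * b + m3 * a - m2 * (a + b) : ℤ) : ℝ) := by
    intro h
    have : 0 < (m1 * b + m3 * a - m2 * (a + b) : ℤ) := by exact_mod_cast h
    exact_mod_cast this
  rw [hM] at key
  have hp0 : (0:ℝ) < d1 := by linarith
  clear hM ha hb o1 o2 o3 h12 h23
  generalize (d1:ℝ) = p at *
  generalize (d2:ℝ) = q at *
  generalize (d3:ℝ) = r at *
  generalize (m1:ℝ) = m at *
  generalize (m2:ℝ) = n at *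
  generalize (m3:ℝ) = l at *
  generalize (a:ℝ) = a at *
  generalize (b:ℝ) = b at *
  have hq0 : 0 < q := by linarith
  have hr0 : 0 < r := by linarith
  have ha0 : 0 < a := by linarith
  have hb0 : 0 < b := by linarith
  have hX0 : 0 < X := by linarith
  have hD : 0 < (p*q*r)^2 := by positivity
  have hK : q^2*r^2*b + a*p^2*q^2 - (a+b)*p^2*r^2 = 4*a*b*(a+b)*(p*q+q*r+p*r) := by
    rw [e3, e2]; ring
  have hpos : 0 < m * b + l * a - n * (a+b) := by
    have c1 : X^4*(q^2*r^2*b) < m*p^2*(q^2*r^2*b) := by gcongr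
    have c2 : X^4*(a*p^2*q^2) < l*r^2*(a*p^2*q^2) := by gcongr
    have c3 : n*q^2*((a+b)*p^2*r^2) ≤ (X^4+5*X)*((a+b)*p^2*r^2) := by gcongr
    have c4 : X^4*(4*a*b*(a+b)*(p*q+q*r+p*r)) - 5*X*((a+b)*p^2*r^2) < (p*q*r)^2 * (m * b + l * a - n * (a+b)) := by
      rw [← hK]; linarith
    have c5 : 5*X*((a+b)*p^2*r^2) ≤ X^4*(4*a*b*(a+b)*(p*q+q*r+p*r)) := by
      have d1 : 2*p*r ≤ p*q+q*r+p*r := by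
        have t1 : p*r ≤ q*r := by gcongr; linarith
        have t2 : 0 < p*q := by positivity
        linarith
      have d2 : 5*X*r ≤ 1.8 * p^2 := by
        calc 5*X*r ≤ 5*X*(1.5*p) := by gcongr
          _ = (7.5*X)*p := by ring
          _ ≤ (1.8*p)*p := by gcongr ?_*p; linarith
          _ = _ := by ring
      have d3 : 0.9*p^3 ≤ 4*X^4*a := by rw [e2] at hg; linarith
      calc 5*X*((a+b)*p^2*r^2) = (5*X*r)*((a+b)*p^2*r) := by ring
        _ ≤ (1.8*p^2)*((a+b)*p^2*r) := by gcongr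
        _ = (0.9*p^3)*1*((a+b)*(2*p*r)) := by ring
        _ ≤ (4*X^4*a)*b*((a+b)*(p*q+q*r+p*r)) := by gcongr
        _ = _ := by ring
    have : 0 < (p*q*r)^2 * (m * b + l * a - n * (a+b)) := by linarith
    exact pos_of_mul_pos_right this hD.le
  have hone := key hpos
  have c1 : m*p^2*(q^2*r^2*b) ≤ (X^4+5*X)*(q^2*r^2*b) := by gcongr
  have c2 : l*r^2*(a*p^2*q^2) ≤ (X^4+5*X)*(a*p^2*q^2) := by gcongr
  have c3 : X^4*((a+b)*p^2*r^2) ≤ n*q^2*((a+b)*p^2*r^2) := by gcongr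
  have c4 : (p*q*r)^2 * (m * b + l * a - n * (a+b)) ≤ 
     X^4*(4*a*b*(a+b)*(p*q+q*r+p*r)) + 5*X*(q^2*r^2*b+a*p^2*q^2) := by
    rw [← hK]; linarith
  have c5 : (p*q*r)^2 ≤ X^4*(4*a*b*(a+b)*(p*q+q*r+p*r)) + 5*X*(q^2*r^2*b+a*p^2*q^2) := by
    refine le_trans ?_ c4
    exact le_mul_of_one_le_right hD.le hone
  have hpq : p ≤ q := by linarith
  have hpr : p ≤ r := by linarith
  have c6 : q^2*r^2*b+a*p^2*q^2 ≤ (a+b)*(q^2*r^2) := by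
    have : a*p^2*q^2 ≤ a*r^2*q^2 := by gcongr
    linarith
  have c7 : 4*a*b ≤ (a+b)^2 := by have := sq_nonneg (a-b); linarith
  have c8 : (p*q+q*r+p*r)*p^4 ≤ 3*(p*q*r)^2 := by
    have f1 : p*q*p^4 ≤ (p*q*r)^2 := by
      calc p*q*p^4 = (p*q)*(p*p*p*p) := by ring
        _ ≤ (p*q)*(p*q*r*r) := by gcongr
        _ = _ := by ring
    have f2 : q*r*p^4 ≤ (p*q*r)^2 := by
      calc q*r*p^4 = (q*r)*(p*p*p*p) := by ring
        _ ≤ (q*r)*(p*p*q*r) := by gcongr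
        _ = _ := by ring
    have f3 : p*r*p^4 ≤ (p*q*r)^2 := by
      calc p*r*p^4 = (p*r)*(p*p*p*p) := by ring
        _ ≤ (p*r)*(p*q*q*r) := by gcongr
        _ = _ := by ring
    linarith
  have es : r - p = 2*(a+b) := by linarith
  rw [es]
  refine le_of_mul_le_mul_left ?_ hD
  calc (p*q*r)^2 * p^4 ≤ (X^4*(4*a*b*(a+b)*(p*q+q*r+p*r)) + 5*X*(q^2*r^2*b+a*p^2*q^2))*p^4 := by gcongr
    _ ≤ (X^4*((a+b)^2*(a+b)*(p*q+q*r+p*r)) + 5*X*((a+b)*(q^2*r^2)))*p^4 := by gcongr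
    _ = X^4*(a+b)^3*((p*q+q*r+p*r)*p^4) + 5*X*(a+b)*p^2*(p*q*r)^2 := by ring
    _ ≤ X^4*(a+b)^3*(3*(p*q*r)^2) + 5*X*(a+b)*p^2*(p*q*r)^2 := by gcongr
    _ = _ := by ring

theorem C_triple (X Y u : ℝ) (hY : 2.4 ≤ Y) (hXY : X = Y^5) (hu : 15/8 ≤ u) (huY : u ≤ 16/15 * Y)
    (d1 d2 d3 m1 m2 m3 : ℕ) (h12 : d1 < d2) (h23 : d2 < d3)
    (o1 : Odd d1) (o2 : Odd d2) (o3 : Odd d3) (hd1 : (d1:ℝ) = u^3 * X)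
    (h1 : X^4 < (m1:ℝ) * d1^2) (h1' : (m1:ℝ) * d1^2 ≤ X^4 + 5 * X)
    (h2 : X^4 < (m2:ℝ) * d2^2) (h2' : (m2:ℝ) * d2^2 ≤ X^4 + 5 * X)
    (h3 : X^4 < (m3:ℝ) * d3^2) (h3' : (m3:ℝ) * d3^2 ≤ X^4 + 5 * X) :
    1.38 * u^4 ≤ (d3:ℝ) - d1 := by
  have hY4 : (2.4:ℝ)^4 ≤ Y^4 := by gcongr
  have hX : 79.6 ≤ X := by
    have : (2.4:ℝ)^5 ≤ Y^5 := by gcongr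
    norm_num at this; rw [hXY]; linarith
  have hu3 : (15/8:ℝ)^3 ≤ u^3 := by gcongr
  have hu0 : 0 < u := by linarith
  rcases le_or_gt (d3:ℝ) (1.5 * d1) with h13 | h13
  · have h := C_triple_aux X (by linarith) d1 d2 d3 m1 m2 m3 h12 h23 o1 o2 o3
      (by rw [hd1]; norm_num at hu3; nlinarith) h13 h1 h1' h2 h2' h3 h3'
    have hs0 : (0:ℝ) ≤ d3 - d1 := by
      have : (d1:ℝ) ≤ d3 := by exact_mod_cast (by omega)
      linarith
    by_contra hc
    push Not at hc
    generalize (d3:ℝ) - d1 = s at *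
    rw [hd1] at h
    have e1 : s^3 ≤ (1.38*u^4)^3 := by gcongr
    have e2 : 3/8 * X^4 * s^3 + 5/2 * X * s * (u^3*X)^2 ≤ 3/8 * X^4 * (1.38*u^4)^3 + 5/2 * X * (1.38*u^4) * (u^3*X)^2 := by gcongr
    have e3 : (u^3*X)^4 ≤ X^3*u^10*(3/8*1.38^3*X*u^2 + 5/2*1.38) := by
      calc _ ≤ _ := h.trans e2
        _ = _ := by ring
    have e4 : X^3*u^10*(X*u^2) ≤ X^3*u^10*(3/8*1.38^3*X*u^2 + 5/2*1.38) := by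
      calc _ = (u^3*X)^4 := by ring
        _ ≤ _ := e3
    have hX0 : 0 < X := by linarith
    have e5 := le_of_mul_le_mul_left e4 (by positivity)
    have hu2 : (15/8:ℝ)^2 ≤ u^2 := by gcongr
    have e6 : 79.6 * (15/8:ℝ)^2 ≤ X * u^2 := by gcongr
    norm_num at e5 e6
    linarith
  · have a1 : 2.76 * u ≤ X := by
      norm_num at hY4
      rw [hXY]
      nlinarith
    have a2 : 1.38 * u^4 ≤ 0.5 * (u^3 * X) := by
      have : u^3 * (2.76 * u) ≤ u^3 * X := by gcongr
      nlinarith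
    rw [hd1] at *
    linarith

theorem C_pot (X Y u1 u3 : ℝ) (hY : 2.4 ≤ Y) (hXY : X = Y^5) (hu : 15/8 ≤ u1) (huY : u1 ≤ 16/15 * Y)
    (hu3 : 0 < u3) (h : 1.38 * u1^4 ≤ u3^3*X - u1^3*X) :
    1.38/(3*X)*(1-1.5/Y^4) ≤ 1/u1 - 1/u3 := by
  have hY0 : 0 < Y := by linarith
  have hX0 : 0 < X := by rw [hXY]; positivity
  have hu0 : 0 < u1 := by linarith
  set z := 1.38*u1/X with hz
  have hz0 : 0 < z := by positivity
  have hzY : z ≤ 1.5/Y^4 := by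
    rw [hz, hXY, div_le_div_iff₀ (by positivity) (by positivity)]
    have : 0 ≤ Y^4 := by positivity
    nlinarith
  have hz1 : z ≤ 0.05 := by
    refine hzY.trans ?_
    have hY4 : (2.4:ℝ)^4 ≤ Y^4 := by gcongr
    norm_num at hY4
    rw [div_le_iff₀ (by positivity)]; linarith
  have h3 : u1^3*(1+z) ≤ u3^3 := by
    refine le_of_mul_le_mul_right ?_ hX0
    have : z * X = 1.38*u1 := by rw [hz]; field_simp
    calc u1^3*(1+z)*X = u1^3*X + u1^3*(z*X) := by ring
      _ = u1^3*X + 1.38*u1^4 := by rw [this]; ring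
      _ ≤ _ := by linarith
  by_contra hc
  push Not at hc
  set δ := 1.38/(3*X)*(1-1.5/Y^4) with hδ
  have hr : δ*u1 ≤ z/3*(1-z) := by
    have : δ*u1 = z/3*(1-1.5/Y^4) := by rw [hδ, hz]; field_simp
    rw [this]; gcongr
  set r := δ*u1
  have hq : 1 - r < u1/u3 := by
    have : (1/u1 - 1/u3) * u1 < δ * u1 := by gcongr
    have e : (1/u1 - 1/u3) * u1 = 1 - u1/u3 := by field_simp
    rw [e] at this; linarith
  have hr1 : r ≤ 0.05 := by nlinarith
  have hq3 : (1-r)^3 < (u1/u3)^3 := by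
    apply pow_lt_pow_left₀ hq (by linarith) (by norm_num)
  have hq4 : (u1/u3)^3 * (1+z) ≤ 1 := by
    rw [div_pow, div_mul_eq_mul_div, div_le_one (by positivity)]; exact h3
  have h5 : 1 - z*(1-z) ≤ (1-r)^3 := by
    have : 1 - 3*r ≤ (1-r)^3 := by nlinarith [mul_nonneg (sq_nonneg r) (by linarith : 0 ≤ 3 - r)]
    linarith
  have h6 : (1 - z*(1-z))*(1+z) ≤ (1-r)^3*(1+z) := by gcongr
  have h7 : (1-r)^3*(1+z) < (u1/u3)^3*(1+z) := by gcongr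
  have h8 : (1 - z*(1-z))*(1+z) = 1+z^3 := by ring
  have : 0 < z^3 := by positivity
  linarith

theorem C_count (v : ℕ → ℝ) (δ vlo vhi : ℝ) (hδ : 0 < δ) (hh : vlo ≤ vhi) : ∀ (N : ℕ) (S : Finset ℕ), S.card = N →
    (∀ d ∈ S, vlo ≤ v d ∧ v d ≤ vhi) →
    (∀ d1 ∈ S, ∀ d2 ∈ S, ∀ d3 ∈ S, d1 < d2 → d2 < d3 → δ ≤ v d1 - v d3) →
    (S.card : ℝ) ≤ 2 + 2 * (vhi - vlo)/δ := by
  intro N S hN hv ht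
  -- stronger statement
  have key : ∀ (N : ℕ) (S : Finset ℕ), S.card = N →
    (∀ d1 ∈ S, ∀ d2 ∈ S, ∀ d3 ∈ S, d1 < d2 → d2 < d3 → δ ≤ v d1 - v d3) →
    ∀ hne : S.Nonempty, (∀ d ∈ S, vlo ≤ v d) → (S.card : ℝ) ≤ 2 + 2 * (v (S.min' hne) - vlo)/δ := by
    intro N
    induction N using Nat.strong_induction_on with
    | _ N ih =>
    intro S hN ht hne hlo
    have hmin := S.min'_mem hne
    have hnn : 0 ≤ 2 * (v (S.min' hne) - vlo)/δ := by
      have := hlo _ hmin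
      apply div_nonneg _ hδ.le; linarith
    rcases le_or_gt S.card 2 with h2 | h2
    · have : (S.card:ℝ) ≤ 2 := by exact_mod_cast h2
      linarith
    set a := S.min' hne
    have c1 : (S.erase a).card = S.card - 1 := Finset.card_erase_of_mem hmin
    have hne1 : (S.erase a).Nonempty := Finset.card_pos.1 (by omega)
    set b := (S.erase a).min' hne1
    have hb := (S.erase a).min'_mem hne1
    have c2 : ((S.erase a).erase b).card = S.card - 2 := by
      rw [Finset.card_erase_of_mem hb]; omega
    have hne2 : ((S.erase a).erase b).Nonempty := Finset.card_pos.1 (by omega)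
    set c := ((S.erase a).erase b).min' hne2 with hcdef
    have hc := ((S.erase a).erase b).min'_mem hne2
    have hbS : b ∈ S := Finset.mem_of_mem_erase hb
    have hc1 : c ∈ S.erase a := Finset.mem_of_mem_erase hc
    have hcS : c ∈ S := Finset.mem_of_mem_erase hc1
    have hab : a < b := lt_of_le_of_ne (S.min'_le _ hbS) (Finset.ne_of_mem_erase hb).symm
    have hbc : b < c := lt_of_le_of_ne ((S.erase a).min'_le _ hc1) (Finset.ne_of_mem_erase hc).symm
    have h3 := ht a hmin b hbS c hcS hab hbc
    have hsub : ∀ d ∈ (S.erase a).erase b, d ∈ S := fun d hd =>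
      Finset.mem_of_mem_erase (Finset.mem_of_mem_erase hd)
    have h4 := ih (S.card - 2) (by omega) _ c2
      (fun d1 h1 d2 h2 d3 h3 => ht d1 (hsub _ h1) d2 (hsub _ h2) d3 (hsub _ h3)) hne2
      (fun d hd => hlo d (hsub _ hd))
    rw [← hcdef, c2] at h4
    have h5 : ((S.card - 2 : ℕ) : ℝ) = S.card - 2 := by
      rw [Nat.cast_sub h2.le]; norm_num
    rw [h5] at h4
    have h6 : 2 * (v a - vlo)/δ - 2 * (v c - vlo)/δ = 2 * ((v a - v c)/δ) := by ring
    have h7 : 1 ≤ (v a - v c)/δ := by rw [le_div_iff₀ hδ]; linarith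
    linarith
  rcases S.eq_empty_or_nonempty with h | h
  · rw [h]; simp
    have : 0 ≤ 2 * (vhi - vlo)/δ := by apply div_nonneg _ hδ.le; linarith
    linarith
  · refine (key N S hN ht h (fun d hd => (hv d hd).1)).trans ?_
    have := (hv _ (S.min'_mem h)).2
    gcongr

theorem D_recip_small (k : ℕ) : ∑ n ∈ Finset.range k, (1:ℝ)/((n:ℝ)+1001)^2 ≤ 1/1000 - 1/((k:ℝ)+1000) := by
  induction k with
  | zero => norm_num
  | succ k ih =>
    rw [Finset.sum_range_succ]
    have : (1:ℝ)/((k:ℝ)+1001)^2 ≤ 1/((k:ℝ)+1000) - 1/((k:ℝ)+1001) := by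
      have h : (1:ℝ)/((k:ℝ)+1000) - 1/((k:ℝ)+1001) = 1/(((k:ℝ)+1000)*((k:ℝ)+1001)) := by
        field_simp; ring
      rw [h]
      apply one_div_le_one_div_of_le (by positivity)
      rw [sq]; gcongr; linarith
    push_cast
    have e : (k:ℝ) + 1 + 1000 = k + 1001 := by ring
    rw [e]
    linarith

theorem D_recip_fin : ∑ p ∈ (Finset.Icc 5 1000).filter Nat.Prime, (1:ℝ)/(p:ℝ)^2 ≤ 0.0911 := by
  have h1 : ∑ p ∈ (Finset.Icc 5 1000).filter Nat.Prime, (100000000/(p^2) + 1) ≤ 9110000 := by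
    rw [Finset.filter_congr (q := fun n => trialPrime n = true)
      (fun n hn => trialPrime_iff n (by have := Finset.mem_Icc.1 hn; omega))]
    decide +kernel
  have h2 : ∑ p ∈ (Finset.Icc 5 1000).filter Nat.Prime, (1:ℝ)/(p:ℝ)^2 ≤
      (∑ p ∈ (Finset.Icc 5 1000).filter Nat.Prime, (100000000/(p^2) + 1) : ℕ) / 100000000 := by
    push_cast
    rw [Finset.sum_div]
    refine Finset.sum_le_sum fun p hp => ?_
    have hp5 : 0 < p := by
      have := Finset.mem_Icc.1 (Finset.mem_filter.1 hp).1; omega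
    have : (100000000 : ℕ) < (100000000/(p^2) + 1) * p^2 := by
      have := Nat.lt_div_mul_add (a := 100000000) (b := p^2) (by positivity)
      linarith
    have h3 : (100000000 : ℝ) < (((100000000/(p^2) : ℕ):ℝ) + 1) * (p:ℝ)^2 := by exact_mod_cast this
    rw [div_le_div_iff₀ (by positivity) (by norm_num)]
    linarith
  have h3 : ((∑ p ∈ (Finset.Icc 5 1000).filter Nat.Prime, (100000000/(p^2) + 1) : ℕ) : ℝ) ≤ 9110000 := by
    exact_mod_cast h1
  refine h2.trans ?_
  rw [div_le_iff₀ (by norm_num)]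
  refine h3.trans ?_
  norm_num

theorem D_recip (L : ℕ) : ∑ p ∈ (Finset.Icc 5 L).filter Nat.Prime, (1:ℝ)/(p:ℝ)^2 ≤ 0.0922 := by
  have hsub : (Finset.Icc 5 L).filter Nat.Prime ⊆
     (Finset.Icc 5 1000).filter Nat.Prime ∪ (Finset.range L).image (fun n : ℕ => n + 1001) := by
    intro p hp
    simp only [Finset.mem_filter, Finset.mem_Icc, Finset.mem_union, Finset.mem_image, Finset.mem_range] at hp ⊢
    rcases le_or_gt p 1000 with h | h
    · left; exact ⟨⟨hp.1.1, h⟩, hp.2⟩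
    · right; exact ⟨p - 1001, by omega, by omega⟩
  calc _ ≤ ∑ p ∈ (Finset.Icc 5 1000).filter Nat.Prime ∪ (Finset.range L).image (fun n : ℕ => n + 1001), (1:ℝ)/(p:ℝ)^2 :=
        Finset.sum_le_sum_of_subset_of_nonneg hsub (fun _ _ _ => by positivity)
    _ ≤ ∑ p ∈ (Finset.Icc 5 1000).filter Nat.Prime, (1:ℝ)/(p:ℝ)^2 +
         ∑ p ∈ (Finset.range L).image (fun n : ℕ => n + 1001), (1:ℝ)/(p:ℝ)^2 := by
        rw [← Finset.sum_union_inter]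
        have : 0 ≤ ∑ p ∈ (Finset.Icc 5 1000).filter Nat.Prime ∩ (Finset.range L).image (fun n : ℕ => n + 1001), (1:ℝ)/(p:ℝ)^2 :=
          Finset.sum_nonneg (fun _ _ => by positivity)
        linarith
    _ ≤ 0.0911 + 1/1000 := by
        refine add_le_add D_recip_fin ?_
        rw [Finset.sum_image (by intro a _ b _ h; exact Nat.add_right_cancel h)]
        have := D_recip_small L
        push_cast
        have h2 : 0 < 1/((L:ℝ)+1000) := by positivity
        linarith
    _ ≤ _ := by norm_num

theorem D_cnt (a b r : ℕ) (hab : a ≤ b) :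
    ((Finset.Ioc a b).filter (fun n => r ∣ n)).card = b / r - a / r := by
  have h : ((Finset.Ioc 0 b).filter (fun n => r ∣ n)).card = ((Finset.Ioc 0 a).filter (fun n => r ∣ n)).card
      + ((Finset.Ioc a b).filter (fun n => r ∣ n)).card := by
    rw [← Finset.card_union_of_disjoint, ← Finset.filter_union,
      Finset.Ioc_union_Ioc_eq_Ioc (Nat.zero_le _) hab]
    rw [Finset.disjoint_left]
    intro n h1 h2
    simp only [Finset.mem_filter, Finset.mem_Ioc] at h1 h2
    omega
  rw [Nat.Ioc_filter_dvd_card_eq_div, Nat.Ioc_filter_dvd_card_eq_div] at h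
  omega

theorem D_cnt_real (a b r : ℕ) (hab : a ≤ b) (hr : 0 < r) :
    (((Finset.Ioc a b).filter (fun n => r ∣ n)).card : ℝ) ≤ ((b:ℝ) - a) * (1 / r) + 1 ∧
    ((b:ℝ) - a) * (1 / r) - 1 ≤ (((Finset.Ioc a b).filter (fun n => r ∣ n)).card : ℝ) := by
  rw [D_cnt a b r hab, Nat.cast_sub (Nat.div_le_div_right hab)]
  have h : ∀ n : ℕ, (n:ℝ) * (1/r) - 1 ≤ ((n / r : ℕ) : ℝ) ∧ ((n / r : ℕ) : ℝ) ≤ n * (1/r) := by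
    intro n
    constructor
    · have := Nat.lt_div_mul_add (a := n) (b := r) hr
      have h2 : (n:ℝ) < ((n/r : ℕ):ℝ) * r + r := by exact_mod_cast this
      have hr' : (0:ℝ) < r := by exact_mod_cast hr
      rw [mul_one_div, tsub_le_iff_right, div_le_iff₀ hr']
      linarith
    · rw [mul_one_div]; exact Nat.cast_div_le
  have ha := h a
  have hb := h b
  constructor <;> linarith

theorem D_49 (a b : ℕ) (hab : a ≤ b) :
    (((Finset.Ioc a b).filter (fun n => 4 ∣ n ∨ 9 ∣ n)).card : ℝ) ≤ ((b:ℝ) - a) * (1 / 3) + 3 := by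
  have h := Finset.card_union_add_card_inter ((Finset.Ioc a b).filter (fun n => 4 ∣ n)) ((Finset.Ioc a b).filter (fun n => 9 ∣ n))
  rw [← Finset.filter_or, ← Finset.filter_and] at h
  have e : (Finset.Ioc a b).filter (fun n => 4 ∣ n ∧ 9 ∣ n) = (Finset.Ioc a b).filter (fun n => 36 ∣ n) := by
    apply Finset.filter_congr
    intro n _
    omega
  rw [e] at h
  have h' : (((Finset.Ioc a b).filter (fun n => 4 ∣ n ∨ 9 ∣ n)).card : ℝ) + ((Finset.Ioc a b).filter (fun n => 36 ∣ n)).card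
     = ((Finset.Ioc a b).filter (fun n => 4 ∣ n)).card + ((Finset.Ioc a b).filter (fun n => 9 ∣ n)).card := by exact_mod_cast h
  have h4 := (D_cnt_real a b 4 hab (by norm_num)).1
  have h9 := (D_cnt_real a b 9 hab (by norm_num)).1
  have h36 := (D_cnt_real a b 36 hab (by norm_num)).2
  norm_num at h4 h9 h36 ⊢
  linarith

theorem D_S2 (a b L : ℕ) (hab : a ≤ b) :
    ((((Finset.Icc 5 L).filter Nat.Prime).biUnion (fun p => (Finset.Ioc a b).filter (fun n => p^2 ∣ n))).card : ℝ)
    ≤ ((b:ℝ) - a) * 0.0922 + ((Finset.Icc 5 L).filter Nat.Prime).card := by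
  have h1 : ((((Finset.Icc 5 L).filter Nat.Prime).biUnion (fun p => (Finset.Ioc a b).filter (fun n => p^2 ∣ n))).card : ℝ)
     ≤ ∑ p ∈ (Finset.Icc 5 L).filter Nat.Prime, (((Finset.Ioc a b).filter (fun n => p^2 ∣ n)).card : ℝ) := by
    exact_mod_cast Finset.card_biUnion_le
  have hba : (0:ℝ) ≤ (b:ℝ) - a := by
    have : (a:ℝ) ≤ b := by exact_mod_cast hab
    linarith
  calc _ ≤ _ := h1
    _ ≤ ∑ p ∈ (Finset.Icc 5 L).filter Nat.Prime, (((b:ℝ) - a) * (1/(p:ℝ)^2) + 1) := by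
      refine Finset.sum_le_sum fun p hp => ?_
      have hp5 : 0 < p := by
        have := Finset.mem_Icc.1 (Finset.mem_filter.1 hp).1; omega
      have := (D_cnt_real a b (p^2) hab (by positivity)).1
      push_cast at this
      exact this
    _ = ((b:ℝ) - a) * ∑ p ∈ (Finset.Icc 5 L).filter Nat.Prime, (1/(p:ℝ)^2) + ((Finset.Icc 5 L).filter Nat.Prime).card := by
      rw [Finset.sum_add_distrib, Finset.mul_sum]; simp
    _ ≤ _ := by
      gcongr
      exact D_recip L

theorem D_pc (L : ℕ) (hL : 5 ≤ L) : ((Finset.Icc 5 L).filter Nat.Prime).card + 2 ≤ Nat.primeCounting L := by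
  rw [Nat.primeCounting, Nat.primeCounting', Nat.count_eq_card_filter_range]
  have h2 : (2:ℕ) ∉ insert 3 ((Finset.Icc 5 L).filter Nat.Prime) := by simp
  have h3 : (3:ℕ) ∉ (Finset.Icc 5 L).filter Nat.Prime := by simp
  have : (insert 2 (insert 3 ((Finset.Icc 5 L).filter Nat.Prime))).card = ((Finset.Icc 5 L).filter Nat.Prime).card + 2 := by
    rw [Finset.card_insert_of_notMem h2, Finset.card_insert_of_notMem h3]
  rw [← this]
  apply Finset.card_le_card
  intro p hp
  simp only [Finset.mem_insert, Finset.mem_filter, Finset.mem_Icc, Finset.mem_range] at hp ⊢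
  rcases hp with rfl | rfl | hp
  · exact ⟨by omega, by norm_num⟩
  · exact ⟨by omega, by norm_num⟩
  · exact ⟨by omega, hp.2⟩

theorem D_P2 (X Y : ℝ) (hY : 2.4 ≤ Y) (hXY : X = Y^5) (P : Finset ℕ)
    (hP : ∀ p ∈ P, Odd p ∧ 3375/512 * X ≤ p ∧ (p:ℝ) ≤ (16/15*Y)^3 * X ∧
      ∃ m : ℕ, X^4 < (m:ℝ) * p^2 ∧ (m:ℝ) * p^2 ≤ X^4 + 5 * X) :
    (P.card : ℝ) ≤ 2 + 2 * (8/15 - 15/(16*Y))/(1.38/(3*X)*(1-1.5/Y^4)) := by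
  have hY0 : 0 < Y := by linarith
  have hX0 : 0 < X := by rw [hXY]; positivity
  have hY4 : (2.4:ℝ)^4 ≤ Y^4 := by gcongr
  norm_num at hY4
  have hδ : 0 < 1.38/(3*X)*(1-1.5/Y^4) := by
    have : 1.5/Y^4 < 1 := by rw [div_lt_one (by positivity)]; linarith
    have : 0 < 1-1.5/Y^4 := by linarith
    positivity
  have hh : 15/(16*Y) ≤ 8/15 := by
    rw [div_le_div_iff₀ (by positivity) (by norm_num)]; linarith
  have hu : ∀ d : ℕ, ∃ u : ℝ, 0 ≤ u ∧ (d:ℝ) = u^3 * X := by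
    intro d
    refine ⟨((d:ℝ)/X)^((1:ℝ)/3), by positivity, ?_⟩
    rw [← Real.rpow_natCast, ← Real.rpow_mul (by positivity)]
    norm_num
    field_simp
  choose u hu0 hu using hu
  have hub : ∀ p ∈ P, 15/8 ≤ u p ∧ u p ≤ 16/15*Y := by
    intro p hp
    obtain ⟨_, h1, h2, _⟩ := hP p hp
    rw [hu p] at h1 h2
    have h3 := le_of_mul_le_mul_right h1 hX0
    have h4 := le_of_mul_le_mul_right h2 hX0
    refine ⟨le_of_pow_le_pow_left₀ (n := 3) (by norm_num) (hu0 p) ?_, le_of_pow_le_pow_left₀ (n := 3) (by norm_num) (by positivity) h4⟩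
    norm_num at h3 ⊢; linarith
  refine C_count (fun d => 1 / u d) _ (15/(16*Y)) (8/15) hδ hh _ P rfl ?_ ?_
  · intro d hd
    obtain ⟨h1, h2⟩ := hub d hd
    have h0 : 0 < u d := by linarith
    constructor
    · show 15/(16*Y) ≤ 1/u d
      rw [div_le_div_iff₀ (by positivity) h0]; linarith
    · show 1/u d ≤ 8/15
      rw [div_le_div_iff₀ h0 (by norm_num)]; linarith
  · intro d1 h1 d2 h2 d3 h3 h12 h23
    obtain ⟨o1, _, _, m1, a1, b1⟩ := hP d1 h1
    obtain ⟨o2, _, _, m2, a2, b2⟩ := hP d2 h2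
    obtain ⟨o3, _, _, m3, a3, b3⟩ := hP d3 h3
    have hb1 := hub d1 h1
    have hb3 := hub d3 h3
    have ht := C_triple X Y (u d1) hY hXY hb1.1 hb1.2 d1 d2 d3 m1 m2 m3 h12 h23 o1 o2 o3 (hu d1)
      a1 b1 a2 b2 a3 b3
    rw [hu d1, hu d3] at ht
    exact C_pot X Y (u d1) (u d3) hY hXY hb1.1 hb1.2 (by linarith) ht

theorem D_S4 (X T : ℝ) (hX : 79 ≤ X) (hT : 0 < T) (S : Finset ℕ)
    (hS : ∀ n ∈ S, X^4 < (n:ℝ) ∧ (n:ℝ) ≤ X^4 + 5 * X ∧ ∃ p m : ℕ, T ≤ (p:ℝ) ∧ n = m * p^2) :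
    (S.card : ℝ) ≤ (X^4 + 5 * X) / T^2 := by
  have h0 : 0 ≤ (X^4 + 5 * X) / T^2 := by positivity
  choose! hS1 hS2 p m hp hm using hS
  have hinj : Set.InjOn m (S : Set ℕ) := by
    intro a ha b hb hab
    have key : ∀ a ∈ S, ∀ b ∈ S, m a = m b → ¬ p a < p b := by
      intro a ha b hb hab hlt
      have := C_mlt X hX (p a) (p b) (m a) (m b) hlt
        (by have := hS1 a ha; rw [hm a ha] at this; push_cast at this; exact this)
        (by have := hS2 b hb; rw [hm b hb] at this; push_cast at this; exact this)
      omega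
    have h1 := key a ha b hb hab
    have h2 := key b hb a ha hab.symm
    have h3 : p a = p b := by omega
    rw [hm a ha, hm b hb, hab, h3]
  have hmaps : ∀ n ∈ S, m n ∈ Finset.Icc 1 ⌊(X^4 + 5 * X) / T^2⌋₊ := by
    intro n hn
    have h1 := hS1 n hn
    have h2 := hS2 n hn
    rw [hm n hn] at h1 h2
    push_cast at h1 h2
    rw [Finset.mem_Icc]
    constructor
    · rw [Nat.one_le_iff_ne_zero]
      intro h
      rw [h] at h1
      have : 0 < X^4 := by positivity
      simp at h1; linarith
    · apply Nat.le_floor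
      rw [le_div_iff₀ (by positivity)]
      have hpT := hp n hn
      refine le_trans ?_ h2
      gcongr
  have hc := Finset.card_le_card_of_injOn m hmaps hinj
  rw [Nat.card_Icc, Nat.add_sub_cancel] at hc
  calc (S.card : ℝ) ≤ (⌊(X^4 + 5 * X) / T^2⌋₊ : ℝ) := by exact_mod_cast hc
    _ ≤ _ := Nat.floor_le h0

theorem D_pi (Y : ℝ) (hY : 2.4 ≤ Y) :
    (Nat.primeCounting ⌊3375/512 * Y^5⌋₊ : ℝ) ≤ 0.07 * (3375/512 * Y^5) + 3.30106 * Y^4 := by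
  have hY5 : (2.4:ℝ)^5 ≤ Y^5 := by gcongr
  norm_num at hY5
  set L := ⌊3375/512 * Y^5⌋₊ with hL
  have hL1 : (L:ℝ) ≤ 3375/512 * Y^5 := Nat.floor_le (by positivity)
  have hL5 : 500 ≤ L := by apply Nat.le_floor; push_cast; linarith
  have hv5 : ((L:ℝ) ^ ((1:ℝ)/5))^5 = L := by
    rw [← Real.rpow_natCast, ← Real.rpow_mul (by positivity)]; norm_num
  set w := (L:ℝ) ^ ((1:ℝ)/5) with hw
  have hw0 : 0 ≤ w := by positivity
  have h := B_main L hL5 w hw0 hv5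
  have hw4 : w^4 ≤ 4.522 * Y^4 := by
    refine le_of_pow_le_pow_left₀ (n := 5) (by norm_num) (by positivity) ?_
    calc (w^4)^5 = (w^5)^4 := by ring
      _ ≤ (3375/512 * Y^5)^4 := by rw [hv5]; gcongr
      _ = (3375/512)^4 * Y^20 := by ring
      _ ≤ 4.522^5 * Y^20 := by gcongr ?_ * _; norm_num
      _ = _ := by ring
  linarith

theorem D_final (Y N P2 S4 : ℝ) (hY : 2.4 ≤ Y) (hN : 5 * Y^5 - 1 ≤ N)
   (h2 : P2 ≤ 2 + 2 * (8/15 - 15/(16*Y))/(1.38/(3*Y^5)*(1-1.5/Y^4)))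
   (h4 : S4 ≤ ((Y^5)^4 + 5 * Y^5) / ((16/15*Y)^3*Y^5)^2)
   (h : N ≤ (N * (1/3) + 3) + (N * 0.0922 + (0.07 * (3375/512 * Y^5) + 3.30106 * Y^4 - 2)) + P2 + S4) : False := by
  have hY0 : 0 < Y := by linarith
  have hY4 : (2.4:ℝ)^4 ≤ Y^4 := by gcongr
  norm_num at hY4
  have h4' : S4 ≤ 0.679 * Y^4 := by
    refine h4.trans ?_
    rw [div_le_iff₀ (by positivity)]
    have e : 0.679 * Y^4 * ((16/15*Y)^3*Y^5)^2 = 0.679 * (16/15)^6 * Y^20 := by ring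
    rw [e]
    have hY15 : (2.4:ℝ)^15 ≤ Y^15 := by gcongr
    have : Y^5 * 2.4^15 ≤ Y^5 * Y^15 := by gcongr
    have h5 : 0 < Y^5 := by positivity
    norm_num at this ⊢
    nlinarith
  have h2' : P2 ≤ 2 + 6/1.38 * (Y^5 + 1.572 * Y) * (8/15 - 15/(16*Y)) := by
    refine h2.trans ?_
    have hh : 0 ≤ 8/15 - 15/(16*Y) := by
      have : 15/(16*Y) ≤ 8/15 := by
        rw [div_le_div_iff₀ (by positivity) (by norm_num)]; linarith
      linarith
    have hq : 0 < Y^4 - 1.5 := by linarith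
    have e : 2 * (8/15 - 15/(16*Y))/(1.38/(3*Y^5)*(1-1.5/Y^4)) = (6/1.38 * (Y^9/(Y^4-1.5))) * (8/15 - 15/(16*Y)) := by
      have : 1.38/(3*Y^5)*(1-1.5/Y^4) = 1.38*(Y^4-1.5)/(3*Y^9) := by field_simp
      rw [this, div_div_eq_mul_div]
      generalize 8/15 - 15/(16*Y) = t
      field_simp
      ring
    rw [e]
    gcongr
    rw [div_le_iff₀ hq]
    nlinarith [mul_pos hY0 hq]
  have e : (Y^5 + 1.572 * Y) * (8/15 - 15/(16*Y)) = 8/15 * Y^5 - 15/16 * Y^4 + 1.572*8/15*Y - 1.572*15/16 := by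
    field_simp; ring
  rw [mul_assoc, e] at h2'
  have h5 : 13.8 * (4.8*Y-5.76) ≤ Y^5 := by
    have g1 : (2.4:ℝ)^3 ≤ Y^3 := by gcongr
    have g2 : 4.8*Y-5.76 ≤ Y^2 := by nlinarith [sq_nonneg (Y-2.4)]
    calc 13.8 * (4.8*Y-5.76) ≤ Y^3 * Y^2 := by
          apply mul_le_mul _ g2 (by linarith) (by positivity)
          norm_num at g1 ⊢; linarith
      _ = Y^5 := by ring
  norm_num at h2' h h4' h5 ⊢
  linarith

theorem D_main (Y : ℝ) (hY : 2.4 ≤ Y) :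
    ∃ n : ℕ, Y^20 < n ∧ (n:ℝ) ≤ Y^20 + 5 * Y^5 ∧ Squarefree n := by
  by_contra H
  push Not at H
  have hY0 : 0 < Y := by linarith
  have hX : 79 ≤ Y^5 := by
    have hY5 : (2.4:ℝ)^5 ≤ Y^5 := by gcongr
    norm_num at hY5; linarith
  obtain ⟨X, hXY⟩ : ∃ X, X = Y^5 := ⟨_, rfl⟩
  have hX4 : Y^20 = X^4 := by rw [hXY]; ring
  rw [hX4, ← hXY] at H
  rw [← hXY] at hX
  have hX0 : 0 < X := by linarith
  set a := ⌊X^4⌋₊ with ha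
  set b := ⌊X^4 + 5*X⌋₊ with hb
  have hab : a ≤ b := Nat.floor_le_floor (by linarith)
  have hI : ∀ n : ℕ, n ∈ Finset.Ioc a b ↔ X^4 < n ∧ (n:ℝ) ≤ X^4 + 5*X := by
    intro n
    rw [Finset.mem_Ioc, ha, hb, Nat.floor_lt (by positivity), Nat.le_floor_iff (by positivity)]
  have hN : 5 * Y^5 - 1 ≤ (b:ℝ) - a := by
    have h1 : (a:ℝ) ≤ X^4 := Nat.floor_le (by positivity)
    have h2 : X^4 + 5*X < b + 1 := Nat.lt_floor_add_one _
    rw [← hXY]; linarith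
  set L := ⌊3375/512 * X⌋₊ with hL
  set T := (16/15*Y)^3*X with hT
  set D := ⌊T⌋₊ with hD
  have hT0 : 0 < T := by positivity
  have hL5 : 5 ≤ L := by apply Nat.le_floor; push_cast; linarith
  classical
  set I := Finset.Ioc a b with hIdef
  set S1 := I.filter (fun n => 4 ∣ n ∨ 9 ∣ n) with hS1
  set S2 := ((Finset.Icc 5 L).filter Nat.Prime).biUnion (fun p => I.filter (fun n => p^2 ∣ n)) with hS2
  set P := (Finset.Ioc L D).filter (fun p => p.Prime ∧ ∃ n ∈ I, p^2 ∣ n) with hP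
  set S3 := P.biUnion (fun p => I.filter (fun n => p^2 ∣ n)) with hS3
  set S4 := I.filter (fun n => ∃ p : ℕ, D < p ∧ p^2 ∣ n) with hS4
  have hcover : I ⊆ ((S1 ∪ S2) ∪ S3) ∪ S4 := by
    intro n hn
    have hns := H n ((hI n).1 hn).1 ((hI n).1 hn).2
    rw [Nat.squarefree_iff_prime_squarefree] at hns
    push Not at hns
    obtain ⟨p, hp, hpn⟩ := hns
    rw [← sq] at hpn
    simp only [Finset.mem_union]
    by_cases hp5 : p < 5
    · left; left; left
      rw [hS1, Finset.mem_filter]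
      refine ⟨hn, ?_⟩
      have := hp.two_le
      interval_cases p
      · left; simpa using hpn
      · right; simpa using hpn
      · exact absurd hp (by norm_num)
    push Not at hp5
    by_cases hpL : p ≤ L
    · left; left; right
      rw [hS2, Finset.mem_biUnion]
      exact ⟨p, Finset.mem_filter.2 ⟨Finset.mem_Icc.2 ⟨hp5, hpL⟩, hp⟩, Finset.mem_filter.2 ⟨hn, hpn⟩⟩
    push Not at hpL
    by_cases hpD : p ≤ D
    · left; right
      rw [hS3, Finset.mem_biUnion]
      exact ⟨p, Finset.mem_filter.2 ⟨Finset.mem_Ioc.2 ⟨hpL, hpD⟩, hp, n, hn, hpn⟩, Finset.mem_filter.2 ⟨hn, hpn⟩⟩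
    push Not at hpD
    right
    rw [hS4, Finset.mem_filter]
    exact ⟨hn, p, hpD, hpn⟩
  have hPbig : ∀ p ∈ P, 3375/512 * X ≤ (p:ℝ) := by
    intro p hp
    have h1 := (Finset.mem_Ioc.1 (Finset.mem_filter.1 hp).1).1
    rw [hL] at h1
    exact (Nat.lt_of_floor_lt h1).le
  have c1 : (S1.card : ℝ) ≤ ((b:ℝ) - a) * (1/3) + 3 := D_49 a b hab
  have c2 := D_S2 a b L hab
  rw [← hIdef, ← hS2] at c2
  have c2' : (((Finset.Icc 5 L).filter Nat.Prime).card : ℝ) ≤ 0.07 * (3375/512 * Y^5) + 3.30106 * Y^4 - 2 := by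
    have h1 : (((Finset.Icc 5 L).filter Nat.Prime).card : ℝ) + 2 ≤ Nat.primeCounting L := by exact_mod_cast D_pc L hL5
    have h2 := D_pi Y hY
    rw [← hXY, ← hL] at h2
    rw [← hXY]; linarith
  have c3 : (S3.card : ℝ) ≤ P.card := by
    have : S3.card ≤ P.card * 1 := by
      apply Finset.card_biUnion_le_card_mul
      intro p hp
      rw [Finset.card_le_one]
      have hpb := hPbig p hp
      have hlt : 5 * X < (p:ℝ)^2 := by nlinarith
      have key : ∀ n ∈ I, ∀ n' ∈ I, p^2 ∣ n → p^2 ∣ n' → n ≤ n' → n = n' := by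
        intro n hn n' hn' h h' hle
        have hd : p^2 ∣ n' - n := Nat.dvd_sub h' h
        have h1 := (hI n).1 hn
        have h2 := (hI n').1 hn'
        have h3 : ((n' - n : ℕ):ℝ) < (p:ℝ)^2 := by
          rw [Nat.cast_sub hle]; linarith
        have h4 : n' - n < p^2 := by exact_mod_cast h3
        have := Nat.eq_zero_of_dvd_of_lt hd h4
        omega
      intro n hn n' hn'
      rw [Finset.mem_filter] at hn hn'
      rcases le_total n n' with h | h
      · exact key n hn.1 n' hn'.1 hn.2 hn'.2 h
      · exact (key n' hn'.1 n hn.1 hn'.2 hn.2 h).symm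
    rw [mul_one] at this
    exact_mod_cast this
  have c3' := D_P2 X Y hY hXY P (by
    intro p hp
    have hpb := hPbig p hp
    have hp' := Finset.mem_filter.1 hp
    obtain ⟨n, hn, m, hm⟩ := hp'.2.2
    have hnI := (hI n).1 hn
    rw [hm] at hnI
    push_cast at hnI
    refine ⟨hp'.2.1.odd_of_ne_two ?_, hpb, ?_, m, by linarith [hnI.1], by linarith [hnI.2]⟩
    · have := (Finset.mem_Ioc.1 hp'.1).1
      omega
    · exact (Nat.le_floor_iff hT0.le).1 (Finset.mem_Ioc.1 hp'.1).2)
  have c4 := D_S4 X T hX hT0 S4 (by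
    intro n hn
    obtain ⟨hn1, p, hp, m, hm⟩ := Finset.mem_filter.1 hn
    have hnI := (hI n).1 hn1
    exact ⟨hnI.1, hnI.2, p, m, (Nat.lt_of_floor_lt hp).le, by rw [hm]; ring⟩)
  have hcard : ((b:ℝ) - a) ≤ S1.card + S2.card + S3.card + S4.card := by
    have h1 := Finset.card_le_card hcover
    have h2 := Finset.card_union_le ((S1 ∪ S2) ∪ S3) S4
    have h3 := Finset.card_union_le (S1 ∪ S2) S3
    have h4 := Finset.card_union_le S1 S2
    have h5 : I.card = b - a := Nat.card_Ioc a b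
    have h6 : b ≤ S1.card + S2.card + S3.card + S4.card + a := by omega
    have h7 : (b:ℝ) ≤ S1.card + S2.card + S3.card + S4.card + a := by exact_mod_cast h6
    linarith
  rw [hT] at c4
  rw [hXY] at c3' c4
  exact D_final Y ((b:ℝ) - a) P.card S4.card hY hN c3' c4 (by linarith)

theorem squarefree_in_interval_quarter (x : ℝ) (hx : 2 ≤ x) :
    ∃ n : ℕ, 0 < n ∧ x < (n : ℝ) ∧ (n : ℝ) ≤ x + 5 * x ^ ((1 : ℝ) / 4) ∧
      Squarefree n := by
  have main : ∃ n : ℕ, x < (n : ℝ) ∧ (n : ℝ) ≤ x + 5 * x ^ ((1 : ℝ) / 4) ∧ Squarefree n := by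
    rcases lt_or_ge x 41000000 with h | h
    · exact sqf_small x hx h
    · have hx0 : 0 ≤ x := by linarith
      have e20 : (x ^ ((1:ℝ)/20))^20 = x := by
        rw [← Real.rpow_natCast, ← Real.rpow_mul hx0]; norm_num
      have e5 : (x ^ ((1:ℝ)/20))^5 = x ^ ((1:ℝ)/4) := by
        rw [← Real.rpow_natCast, ← Real.rpow_mul hx0]; norm_num
      have hY0 : 0 ≤ x ^ ((1:ℝ)/20) := by positivity
      have hY : 2.4 ≤ x ^ ((1:ℝ)/20) := by
        refine le_of_pow_le_pow_left₀ (n := 20) (by norm_num) hY0 ?_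
        rw [e20]; norm_num; linarith
      have := D_main _ hY
      rwa [e20, e5] at this
  obtain ⟨n, h1, h2, h3⟩ := main
  refine ⟨n, ?_, h1, h2, h3⟩
  have : (0:ℝ) < n := by linarith
  exact_mod_cast this
end
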